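/- arXiv:1010.4220 — 2 statements merged into one kernel-verified Lean document; each statement's English description precedes it below -/
import Mathlib

section
/- If w ∈ F is unimodular and k ≥ 2, then the natural homomorphism ι̃ = q ∘ ι : G → G̃ is injective; that is, G embeds naturally into the group G̃ = ⟨G, t | w^k = 1⟩. -/
/-- `F = G ∗ ⟨t⟩`: the free product of `G` with an infinite cyclic group. -/
abbrev FP (G : Type*) [Group G] : Type _ := Monoid.Coprod G (FreeGroup Unit)

/-- The additional generator `t ∈ F`. -/
def tgen (G : Type*) [Group G] : FP G := Monoid.Coprod.inr (FreeGroup.of ())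

/-- The canonical embedding `ι : G → F`. -/
def emb (G : Type*) [Group G] : G →* FP G := Monoid.Coprod.inl

/-- The exponent-sum homomorphism `σ : F → ℤ` killing `G` and sending `t` to `1`. -/
def expSum (G : Type*) [Group G] : FP G →* Multiplicative ℤ :=
  Monoid.Coprod.lift 1 (FreeGroup.lift fun _ => Multiplicative.ofAdd (1 : ℤ))

/-- A word `w ∈ F` is unimodular if the exponent sum of `t` in `w` is `1`. -/
def Unimodular {G : Type*} [Group G] (w : FP G) : Prop :=
  expSum G w = Multiplicative.ofAdd (1 : ℤ)

namespace CycleCount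

open Equiv Equiv.Perm

section Glue

variable {X : Type*}

/-- The equivalence relation obtained from `s` by identifying the classes of `i` and `j`. -/
def glue (s : Setoid X) (i j : X) : Setoid X where
  r x y := s x y ∨ ((s x i ∨ s x j) ∧ (s y i ∨ s y j))
  iseqv :=
    { refl := fun x => Or.inl (s.refl x)
      symm := fun h => h.elim (fun h => Or.inl (s.symm h)) fun h => Or.inr h.symm
      trans := by
        rintro x y z (h | ⟨h, h'⟩) (k | ⟨k, k'⟩)
        · exact Or.inl (s.trans h k)
        · exact Or.inr ⟨k.imp (s.trans h) (s.trans h), k'⟩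
        · exact Or.inr ⟨h, h'.imp (s.trans (s.symm k)) (s.trans (s.symm k))⟩
        · exact Or.inr ⟨h, k'⟩ }

theorem le_glue (s : Setoid X) (i j : X) : s ≤ glue s i j := fun _ _ h => Or.inl h

theorem glue_rel (s : Setoid X) (i j : X) : glue s i j i j :=
  Or.inr ⟨Or.inl (s.refl i), Or.inr (s.refl j)⟩

theorem glue_le {s u : Setoid X} {i j : X} (h : s ≤ u) (hij : u i j) : glue s i j ≤ u := by
  have key : ∀ x, (s x i ∨ s x j) → u x i := by
    rintro x (hx | hx)
    · exact h hx
    · exact u.trans (h hx) (u.symm hij)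
  rintro x y (hxy | ⟨hx, hy⟩)
  · exact h hxy
  · exact u.trans (key x hx) (u.symm (key y hy))

theorem glue_mono {s u : Setoid X} (i j : X) (h : s ≤ u) : glue s i j ≤ glue u i j :=
  glue_le (h.trans (le_glue u i j)) (glue_rel u i j)

theorem glue_eq_self {s : Setoid X} {i j : X} (h : s i j) : glue s i j = s :=
  le_antisymm (glue_le le_rfl h) (le_glue s i j)

/-- The number of classes of an equivalence relation. -/
noncomputable def numClasses (s : Setoid X) : ℕ := Nat.card (Quotient s)

variable [Finite X]

theorem numClasses_anti {s u : Setoid X} (h : s ≤ u) : numClasses u ≤ numClasses s :=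
  Nat.card_le_card_of_surjective (Quotient.map' id h)
    (fun q => Quotient.inductionOn' q fun x => ⟨Quotient.mk'' x, rfl⟩)

theorem numClasses_glue {s : Setoid X} {i j : X} (h : ¬ s i j) :
    numClasses (glue s i j) + 1 = numClasses s := by
  classical
  have e : {c : Quotient s // c ≠ Quotient.mk s j} ≃ Quotient (glue s i j) := by
    refine Equiv.ofBijective
      (fun c => Quotient.map' (s₁ := s) (s₂ := glue s i j) id (le_glue s i j) c.1) ⟨?_, ?_⟩
    · rintro ⟨a, ha⟩ ⟨b, hb⟩ hab
      induction a using Quotient.inductionOn with | _ a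
      induction b using Quotient.inductionOn with | _ b
      have ha' : ¬ s a j := fun h => ha (Quotient.sound h)
      have hb' : ¬ s b j := fun h => hb (Quotient.sound h)
      rcases (Quotient.exact hab : glue s i j a b) with h1 | ⟨h1, h2⟩
      · exact Subtype.ext (Quotient.sound h1)
      · exact Subtype.ext (Quotient.sound
          (s.trans (h1.resolve_right ha') (s.symm (h2.resolve_right hb'))))
    · intro q
      induction q using Quotient.inductionOn with | _ x
      by_cases hx : s x j
      · exact ⟨⟨Quotient.mk s i, fun h' => h (Quotient.exact h')⟩,
          Quotient.sound (Or.inr ⟨Or.inl (s.refl i), Or.inr hx⟩)⟩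
      · exact ⟨⟨Quotient.mk s x, fun h' => hx (Quotient.exact h')⟩, rfl⟩
  have := Fintype.ofFinite (Quotient s)
  have := Fintype.ofFinite (Quotient (glue s i j))
  rw [numClasses, numClasses, ← Nat.card_congr e, Nat.card_eq_fintype_card,
    Nat.card_eq_fintype_card, Fintype.card_subtype_compl, Fintype.card_subtype_eq]
  have : 0 < Fintype.card (Quotient s) := Fintype.card_pos_iff.2 ⟨Quotient.mk s j⟩
  omega

theorem numClasses_le_glue_add_one (s : Setoid X) (i j : X) :
    numClasses s ≤ numClasses (glue s i j) + 1 := by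
  by_cases h : s i j
  · rw [glue_eq_self h]; omega
  · rw [numClasses_glue h]

end Glue

section Counting

variable {X : Type*} [Finite X]

theorem two_mul_numClasses_le (s : Setoid X) (P Q : Finset X)
    (h : ∀ x, (∃ y ∈ Q, s x y) ∨ ∃ y ∈ P, ∃ z ∈ P, y ≠ z ∧ s x y ∧ s x z) :
    2 * numClasses s ≤ P.card + 2 * Q.card := by
  classical
  have := Fintype.ofFinite (Quotient s)
  have e1 := Finset.card_eq_sum_card_fiberwise (s := P) (t := Finset.univ)
    (f := Quotient.mk s) (fun _ _ => by simp)
  have e2 := Finset.card_eq_sum_card_fiberwise (s := Q) (t := Finset.univ)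
    (f := Quotient.mk s) (fun _ _ => by simp)
  rw [e1, e2, Finset.mul_sum, ← Finset.sum_add_distrib, numClasses, Nat.card_eq_fintype_card,
    ← Finset.card_univ, mul_comm, ← smul_eq_mul, ← Finset.sum_const]
  refine Finset.sum_le_sum fun c _ => ?_
  induction c using Quotient.inductionOn with | _ x
  rcases h x with ⟨y, hy, hxy⟩ | ⟨y, hy, z, hz, hyz, hxy, hxz⟩
  · have : 0 < (Q.filter fun a => Quotient.mk s a = Quotient.mk s x).card :=
      Finset.card_pos.2 ⟨y, Finset.mem_filter.2 ⟨hy, Quotient.sound (s.symm hxy)⟩⟩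
    omega
  · have : 1 < (P.filter fun a => Quotient.mk s a = Quotient.mk s x).card :=
      Finset.one_lt_card.2 ⟨y, Finset.mem_filter.2 ⟨hy, Quotient.sound (s.symm hxy)⟩,
        z, Finset.mem_filter.2 ⟨hz, Quotient.sound (s.symm hxz)⟩, hyz⟩
    omega

end Counting

section Cycles

variable {X : Type*}

/-- The equivalence relation of lying in the same cycle. -/
abbrev orbits (f : Perm X) : Setoid X := SameCycle.setoid f

theorem orbits_step (f : Perm X) (x : X) : orbits f x (f x) := ⟨1, by simp⟩

theorem orbits_le [Finite X] {f : Perm X} {u : Setoid X} (h : ∀ x, u x (f x)) : orbits f ≤ u := by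
  intro x y hxy
  obtain ⟨n, rfl⟩ := SameCycle.exists_nat_pow_eq hxy
  induction n with
  | zero => exact u.refl x
  | succ n ih => 
    rw [pow_succ']
    exact u.trans (ih ⟨n, by simp⟩) (h _)

variable [Finite X] [DecidableEq X]

theorem orbits_swap_mul_le (f : Perm X) (i j : X) :
    orbits (swap i j * f) ≤ glue (orbits f) i j := by
  refine orbits_le fun x => ?_
  have hx : glue (orbits f) i j x (f x) := le_glue _ _ _ (orbits_step f x)
  have hij := glue_rel (orbits f) i j
  rw [Perm.mul_apply]
  by_cases h1 : f x = i
  · rw [h1, swap_apply_left]; rw [h1] at hx; exact Setoid.trans' _ hx hij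
  by_cases h2 : f x = j
  · rw [h2, swap_apply_right]; rw [h2] at hx; exact Setoid.trans' _ hx (Setoid.symm' _ hij)
  · rwa [swap_apply_of_ne_of_ne h1 h2]

theorem glue_orbits_swap_mul (f : Perm X) (i j : X) :
    glue (orbits (swap i j * f)) i j = glue (orbits f) i j := by
  refine le_antisymm (glue_le (orbits_swap_mul_le f i j) (glue_rel _ _ _)) ?_
  refine glue_le ?_ (glue_rel _ _ _)
  have := orbits_swap_mul_le (swap i j * f) i j
  rwa [← mul_assoc, swap_mul_self, one_mul] at this

theorem orbits_swap_mul_of_not {f : Perm X} {i j : X} (h : ¬ orbits f i j) :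
    orbits (swap i j * f) i j := by
  set g := swap i j * f with hg
  have hpos : 0 < Function.minimalPeriod f i :=
    Function.IsPeriodicPt.minimalPeriod_pos (orderOf_pos f) (by
      rw [Function.IsPeriodicPt, Function.IsFixedPt, Perm.iterate_eq_pow, pow_orderOf_eq_one,
        Perm.one_apply])
  have key : ∀ n, n < Function.minimalPeriod f i → (g ^ n) i = (f ^ n) i := by
    intro n hn
    induction n with
    | zero => rfl
    | succ n ih =>
      rw [pow_succ', pow_succ', Perm.mul_apply, ih (by omega), hg, Perm.mul_apply,
        ← Perm.mul_apply f, ← pow_succ']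
      refine swap_apply_of_ne_of_ne (fun h' => ?_) (fun h' => h ⟨(n + 1 : ℕ), by rwa [zpow_natCast]⟩)
      refine Function.not_isPeriodicPt_of_pos_of_lt_minimalPeriod (Nat.succ_ne_zero n) hn ?_
      rw [Function.IsPeriodicPt, Function.IsFixedPt, Perm.iterate_eq_pow, h']
  obtain ⟨n, hn⟩ : ∃ n, Function.minimalPeriod f i = n + 1 := ⟨_, (Nat.sub_add_cancel hpos).symm⟩
  refine ⟨(n + 1 : ℕ), ?_⟩
  have hper : (f ^ (n + 1)) i = i := by
    rw [← hn, ← Perm.iterate_eq_pow]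
    exact Function.iterate_minimalPeriod
  rw [zpow_natCast, pow_succ', Perm.mul_apply, key n (by omega), hg, Perm.mul_apply,
    ← Perm.mul_apply f, ← pow_succ', hper, swap_apply_left]

theorem not_orbits_swap_mul {f : Perm X} {i j : X} (hij : i ≠ j) (h : orbits f i j) :
    ¬ orbits (swap i j * f) i j := by
  have hex : ∃ n : ℕ, (f ^ n) i = j := SameCycle.exists_nat_pow_eq h
  set g := swap i j * f with hg
  have hmin : ∀ k < Nat.find hex, (f ^ k) i ≠ j := fun k hk => Nat.find_min hex hk
  have h0 : 0 < Nat.find hex := by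
    rw [Nat.find_pos]
    exact hij
  have key : ∀ m : ℕ, ∃ k < Nat.find hex, (g ^ m) i = (f ^ k) i := by
    intro m
    induction m with
    | zero => exact ⟨0, h0, rfl⟩
    | succ m ih =>
      obtain ⟨k, hk, hm⟩ := ih
      rw [pow_succ', Perm.mul_apply, hm, hg, Perm.mul_apply, ← Perm.mul_apply f, ← pow_succ']
      rcases Nat.lt_or_ge (k + 1) (Nat.find hex) with hlt | hge
      · by_cases hi : (f ^ (k + 1)) i = i
        · exfalso
          have hf := Nat.find_spec hex
          obtain ⟨r, hr⟩ := Nat.exists_eq_add_of_le hlt.le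
          rw [hr, add_comm, pow_add, Perm.mul_apply, hi] at hf
          exact hmin r (by omega) hf
        · exact ⟨k + 1, hlt, swap_apply_of_ne_of_ne hi (hmin _ hlt)⟩
      · have : k + 1 = Nat.find hex := by omega
        exact ⟨0, h0, by rw [this, Nat.find_spec hex, swap_apply_right]; rfl⟩
  rintro hgij
  obtain ⟨m, hm⟩ := SameCycle.exists_nat_pow_eq hgij
  obtain ⟨k, hk, hk'⟩ := key m
  exact hmin k hk (hk'.symm.trans hm)

theorem orbits_swap_mul_eq_glue {f : Perm X} {i j : X} (h : ¬ orbits f i j) :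
    orbits (swap i j * f) = glue (orbits f) i j := by
  rw [← glue_orbits_swap_mul, glue_eq_self (orbits_swap_mul_of_not h)]

/-- The number of cycles, fixed points included. -/
noncomputable def cyc (f : Perm X) : ℕ := numClasses (orbits f)

theorem cyc_swap_mul_of_not {f : Perm X} {i j : X} (h : ¬ orbits f i j) :
    cyc (swap i j * f) + 1 = cyc f := by
  rw [cyc, orbits_swap_mul_eq_glue h, numClasses_glue h, cyc]

theorem cyc_swap_mul {f : Perm X} {i j : X} (hij : i ≠ j) (h : orbits f i j) :
    cyc (swap i j * f) = cyc f + 1 := by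
  have := cyc_swap_mul_of_not (not_orbits_swap_mul hij h)
  rw [← mul_assoc, swap_mul_self, one_mul] at this
  exact this.symm

theorem numClasses_bot {X : Type*} : numClasses (⊥ : Setoid X) = Nat.card X :=
  Nat.card_congr ⟨fun q => Quotient.liftOn q id fun _ _ h => h, Quotient.mk _,
    fun q => Quotient.inductionOn q fun _ => rfl, fun _ => rfl⟩

omit [DecidableEq X] in
theorem orbits_one : orbits (1 : Perm X) = ⊥ :=
  le_antisymm (orbits_le fun _ => rfl) bot_le

omit [DecidableEq X] in
theorem cyc_one : cyc (1 : Perm X) = Nat.card X := by rw [cyc, orbits_one, numClasses_bot]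

omit [DecidableEq X] in
theorem orbits_mul_le {f g : Perm X} {u : Setoid X} (hf : orbits f ≤ u) (hg : orbits g ≤ u) :
    orbits (f * g) ≤ u :=
  orbits_le fun x => u.trans (hg (orbits_step g x)) (hf (orbits_step f (g x)))

/-- Replacing `α` by `swap i j * α` and then gluing `i` and `j` does not change what is
generated together with `s`. -/
theorem glue_sup_swap_mul (s : Setoid X) (α : Perm X) (i j : X) :
    glue (s ⊔ orbits (swap i j * α)) i j = glue (s ⊔ orbits α) i j := by
  have aux : ∀ α : Perm X, glue (s ⊔ orbits (swap i j * α)) i j ≤ glue (s ⊔ orbits α) i j := by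
    intro α
    refine glue_le (sup_le (le_sup_left.trans (le_glue _ _ _)) ?_) (glue_rel _ _ _)
    exact (orbits_swap_mul_le α i j).trans (glue_mono _ _ le_sup_right)
  refine le_antisymm (aux α) ?_
  have := aux (swap i j * α)
  rwa [← mul_assoc, swap_mul_self, one_mul] at this

/-- The genus of a combinatorial map is nonnegative. -/
theorem genus_nonneg (φ α : Perm X) :
    cyc φ + cyc α + cyc (α * φ) ≤ Nat.card X + 2 * numClasses (orbits φ ⊔ orbits α) := by
  have := Fintype.ofFinite X
  induction hn : α.support.card using Nat.strong_induction_on generalizing α with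
  | _ n ih =>
  by_cases h1 : α = 1
  · subst h1
    rw [cyc_one, orbits_one, sup_bot_eq, one_mul, cyc]
    omega
  obtain ⟨x, hx⟩ : ∃ x, α x ≠ x := by
    by_contra! h
    exact h1 (Perm.ext h)
  have hlt := card_support_swap_mul hx
  rw [swap_comm] at hlt
  have IH := ih _ (hn ▸ hlt) (swap (α x) x * α) rfl
  have hc : cyc (swap (α x) x * α) = cyc α + 1 :=
    cyc_swap_mul hx ((orbits α).symm (orbits_step α x))
  rw [hc, mul_assoc] at IH
  have hg := glue_sup_swap_mul (orbits φ) α (α x) x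
  have hself : glue (orbits φ ⊔ orbits α) (α x) x = orbits φ ⊔ orbits α :=
    glue_eq_self ((le_sup_right : orbits α ≤ _) ((orbits α).symm (orbits_step α x)))
  rw [hself] at hg
  by_cases hs : orbits (α * φ) (α x) x
  · have h2 := cyc_swap_mul hx hs
    have h3 := numClasses_le_glue_add_one (orbits φ ⊔ orbits (swap (α x) x * α)) (α x) x
    rw [hg] at h3
    omega
  · have h2 := cyc_swap_mul_of_not hs
    have h4 := orbits_swap_mul_of_not hs
    rw [← mul_assoc] at h4
    have h5 : (orbits φ ⊔ orbits (swap (α x) x * α)) (α x) x :=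
      orbits_mul_le le_sup_right le_sup_left h4
    rw [glue_eq_self h5] at hg
    rw [hg] at IH
    omega

end Cycles

section Restriction

variable {X : Type*}

/-- The relation which agrees with `s` on `C` and is trivial elsewhere. -/
def restr (s : Setoid X) (C : Set X) : Setoid X where
  r x y := x = y ∨ (x ∈ C ∧ y ∈ C ∧ s x y)
  iseqv :=
    { refl := fun _ => Or.inl rfl
      symm := by
        rintro x y (rfl | ⟨hx, hy, h⟩)
        · exact Or.inl rfl
        · exact Or.inr ⟨hy, hx, s.symm h⟩
      trans := by
        rintro x y z (rfl | ⟨hx, hy, h⟩) (rfl | ⟨hx', hy', h'⟩)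
        · exact Or.inl rfl
        · exact Or.inr ⟨hx', hy', h'⟩
        · exact Or.inr ⟨hx, hy, h⟩
        · exact Or.inr ⟨hx, hy', s.trans h h'⟩ }

theorem restr_sup {a b : Setoid X} {C : Set X} (ha : ∀ x y, a x y → (x ∈ C ↔ y ∈ C))
    (hb : ∀ x y, b x y → (x ∈ C ↔ y ∈ C)) : restr (a ⊔ b) C = restr a C ⊔ restr b C := by
  refine le_antisymm ?_ (sup_le ?_ ?_)
  · let u : Setoid X :=
      { r := fun x y => (x ∈ C ↔ y ∈ C) ∧ (x ∈ C → (restr a C ⊔ restr b C) x y)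
        iseqv :=
          { refl := fun x => ⟨Iff.rfl, fun _ => Setoid.refl' _ x⟩
            symm := fun h => ⟨h.1.symm, fun hy => Setoid.symm' _ (h.2 (h.1.2 hy))⟩
            trans := fun h k => ⟨h.1.trans k.1, fun hx =>
              Setoid.trans' _ (h.2 hx) (k.2 (h.1.1 hx))⟩ } }
    have hu : a ⊔ b ≤ u := by
      refine sup_le (fun x y h => ⟨ha x y h, fun hx => ?_⟩) (fun x y h => ⟨hb x y h, fun hx => ?_⟩)
      · exact (le_sup_left : restr a C ≤ _) (Or.inr ⟨hx, (ha x y h).1 hx, h⟩)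
      · exact (le_sup_right : restr b C ≤ _) (Or.inr ⟨hx, (hb x y h).1 hx, h⟩)
    rintro x y (rfl | ⟨hx, hy, h⟩)
    · exact Setoid.refl' _ x
    · exact (hu h).2 hx
  · rintro x y (rfl | ⟨hx, hy, h⟩)
    · exact Setoid.refl' _ x
    · exact Or.inr ⟨hx, hy, (le_sup_left : a ≤ a ⊔ b) h⟩
  · rintro x y (rfl | ⟨hx, hy, h⟩)
    · exact Setoid.refl' _ x
    · exact Or.inr ⟨hx, hy, (le_sup_right : b ≤ a ⊔ b) h⟩

theorem orbits_restr [Finite X] {f g : Perm X} {C : Set X} (hC : ∀ x, f x ∈ C ↔ x ∈ C)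
    (hg : ∀ x ∈ C, g x = f x) (hg' : ∀ x ∉ C, g x = x) : orbits g = restr (orbits f) C := by
  refine le_antisymm (orbits_le fun x => ?_) ?_
  · by_cases hx : x ∈ C
    · rw [hg x hx]
      exact Or.inr ⟨hx, (hC x).2 hx, orbits_step f x⟩
    · exact Or.inl (hg' x hx).symm
  · rintro x y (rfl | ⟨hx, -, h⟩)
    · exact Setoid.refl' _ x
    · obtain ⟨n, rfl⟩ := SameCycle.exists_nat_pow_eq h
      suffices (f ^ n) x ∈ C ∧ orbits g x ((f ^ n) x) from this.2
      clear h
      induction n with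
      | zero => exact ⟨hx, Setoid.refl' _ x⟩
      | succ n ih =>
        rw [pow_succ', Perm.mul_apply]
        refine ⟨(hC _).2 ih.1, Setoid.trans' _ ih.2 ?_⟩
        rw [← hg _ ih.1]
        exact orbits_step g _

theorem exists_restr_perm (f : Perm X) {C : Set X} (hC : ∀ x, f x ∈ C ↔ x ∈ C) :
    ∃ g : Perm X, (∀ x ∈ C, g x = f x) ∧ ∀ x ∉ C, g x = x := by
  classical
  refine ⟨Perm.ofSubtype (f.subtypePerm (p := (· ∈ C)) hC), fun x hx => ?_, fun x hx => ?_⟩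
  · rw [Perm.ofSubtype_apply_of_mem _ hx]; rfl
  · exact Perm.ofSubtype_apply_of_not_mem _ hx

theorem numClasses_eq_sum [Fintype X] (s : Setoid X) :
    (numClasses s : ℚ) = ∑ x, (Nat.card {y // s x y} : ℚ)⁻¹ := by
  classical
  have := Fintype.ofFinite (Quotient s)
  rw [← Finset.sum_fiberwise (s := Finset.univ) (g := Quotient.mk s), numClasses,
    Nat.card_eq_fintype_card, ← Finset.card_univ, Finset.card_eq_sum_ones, Nat.cast_sum]
  refine Finset.sum_congr rfl fun q _ => ?_
  induction q using Quotient.inductionOn with | _ a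
  set P := Finset.univ.filter fun y => Quotient.mk s y = Quotient.mk s a with hP
  have hcard : ∀ x ∈ P, (Nat.card {y // s x y} : ℚ)⁻¹ = (P.card : ℚ)⁻¹ := by
    intro x hx
    have hx' : s x a := Quotient.exact (Finset.mem_filter.1 hx).2
    rw [Nat.card_eq_fintype_card, Fintype.card_subtype]
    congr 3
    ext y
    simp only [hP, Finset.mem_filter, Finset.mem_univ, true_and]
    exact ⟨fun h => Quotient.sound (s.trans (s.symm h) hx'),
      fun h => s.trans hx' (s.symm (Quotient.exact h))⟩
  rw [Finset.sum_congr rfl hcard, Finset.sum_const, nsmul_eq_mul, mul_inv_cancel₀, Nat.cast_one]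
  exact Nat.cast_ne_zero.2 (Finset.card_ne_zero_of_mem (a := a)
    (Finset.mem_filter.2 ⟨Finset.mem_univ _, rfl⟩))

theorem numClasses_restr_add [Finite X] {s : Setoid X} {C : Set X}
    (hC : ∀ x y, s x y → (x ∈ C ↔ y ∈ C)) :
    numClasses (restr s C) + numClasses (restr s Cᶜ) = numClasses s + Nat.card X := by
  classical
  have := Fintype.ofFinite X
  have h1 : (numClasses (restr s C) : ℚ) + numClasses (restr s Cᶜ)
      = numClasses s + Nat.card X := by
    have hX : (Nat.card X : ℚ) = ∑ x : X, (1 : ℚ) := by simp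
    rw [hX, numClasses_eq_sum, numClasses_eq_sum, numClasses_eq_sum, ← Finset.sum_add_distrib,
      ← Finset.sum_add_distrib]
    refine Finset.sum_congr rfl fun x _ => ?_
    have key : ∀ D : Set X, (∀ x y, s x y → (x ∈ D ↔ y ∈ D)) →
        (Nat.card {y // restr s D x y} = if x ∈ D then Nat.card {y // s x y} else 1) := by
      intro D hD
      split_ifs with hx
      · refine Nat.card_congr (Equiv.subtypeEquivRight fun y => ?_)
        constructor
        · rintro (rfl | h)
          · exact s.refl x
          · exact h.2.2
        · exact fun h => Or.inr ⟨hx, (hD x y h).1 hx, h⟩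
      · rw [Nat.card_eq_one_iff_unique]
        refine ⟨⟨?_⟩, ⟨⟨x, Or.inl rfl⟩⟩⟩
        rintro ⟨y, rfl | hy⟩ ⟨z, rfl | hz⟩
        · rfl
        · exact absurd hz.1 hx
        · exact absurd hy.1 hx
        · exact absurd hy.1 hx
    rw [key C hC, key Cᶜ (fun x y h => not_congr (hC x y h))]
    by_cases hx : x ∈ C
    · simp [hx]
    · simp [hx, add_comm]
  exact_mod_cast h1

end Restriction

end CycleCount

namespace Relative

open HNNExtension HNNExtension.NormalWord

variable {H : Type*} [Group H] {A B : Subgroup H}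

/-- A periodic word `∏ c j * t ^ e j` of an HNN extension in which the only corner between two
letters `t` of the same sign is the one at `0`, and which is otherwise reduced. -/
structure Relator (A B : Subgroup H) where
  /-- the period -/
  L : ℕ
  three_le : 3 ≤ L
  /-- the coefficients -/
  c : ℤ → H
  /-- the exponents -/
  e : ℤ → ℤˣ
  c_periodic : ∀ j, c (j + L) = c j
  e_periodic : ∀ j, e (j + L) = e j
  e_eq_iff : ∀ j, e (j - 1) = e j ↔ (L : ℤ) ∣ j
  e_zero : e 0 = 1
  notMem : ∀ j, ¬ (L : ℤ) ∣ j → c j ∉ toSubgroup A B (e (j - 1))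

variable (ψ : A ≃* B)

/-- The value of a list of letters `(h, u)`, standing for `h * t ^ u`. -/
def value (l : List (H × ℤˣ)) : HNNExtension H A B ψ :=
  (l.map fun a => of a.1 * t ^ (a.2 : ℤ)).prod

@[simp] theorem value_nil : value ψ ([] : List (H × ℤˣ)) = 1 := rfl

@[simp] theorem value_cons (a : H × ℤˣ) (l : List (H × ℤˣ)) :
    value ψ (a :: l) = of a.1 * t ^ (a.2 : ℤ) * value ψ l := List.prod_cons

@[simp] theorem value_append (l l' : List (H × ℤˣ)) :
    value ψ (l ++ l') = value ψ l * value ψ l' := by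
  simp [value]

theorem of_toSubgroupEquiv (u : ℤˣ) (g : toSubgroup A B u) :
    (of (toSubgroupEquiv ψ u g : H) : HNNExtension H A B ψ) =
      t ^ (u : ℤ) * of (g : H) * t ^ (-u : ℤ) := by
  rcases Int.units_eq_one_or u with rfl | rfl
  · simp only [Units.val_one, zpow_one, zpow_neg]
    exact equiv_eq_conj (φ := ψ) g
  · simp only [Units.val_neg, Units.val_one, zpow_neg, zpow_one, neg_neg]
    exact equiv_symm_eq_conj (φ := ψ) g

namespace Relator

variable (R : Relator A B)

/-- The subword of length `m` starting at position `s`. -/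
def posWord (m : ℕ) (s : ℤ) : List (H × ℤˣ) :=
  (List.range m).map fun i : ℕ => (R.c (s + i), R.e (s + i))

/-- The inverse subword of length `m`, read backwards from position `s`. -/
def negWord (m : ℕ) (s : ℤ) : List (H × ℤˣ) :=
  (List.range m).map fun i : ℕ => ((R.c (s - i + 1))⁻¹, - R.e (s - i))

theorem posWord_succ (m : ℕ) (s : ℤ) :
    R.posWord (m + 1) s = (R.c s, R.e s) :: R.posWord m (s + 1) := by
  simp [posWord, List.range_succ_eq_map, Function.comp_def, add_assoc, add_comm (1 : ℤ)]

theorem posWord_succ' (m : ℕ) (s : ℤ) :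
    R.posWord (m + 1) s = R.posWord m s ++ [(R.c (s + m), R.e (s + m))] := by
  simp [posWord, List.range_succ]

theorem negWord_succ (m : ℕ) (s : ℤ) :
    R.negWord (m + 1) s = ((R.c (s + 1))⁻¹, - R.e s) :: R.negWord m (s - 1) := by
  simp [negWord, List.range_succ_eq_map, Function.comp_def, sub_sub, add_comm]

theorem c_add_mul (j : ℤ) (k : ℤ) : R.c (j + R.L * k) = R.c j := by
  have h : Function.Periodic R.c (R.L : ℤ) := R.c_periodic
  rw [mul_comm, ← smul_eq_mul]; exact h.zsmul k j

theorem e_add_mul (j : ℤ) (k : ℤ) : R.e (j + R.L * k) = R.e j := by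
  have h : Function.Periodic R.e (R.L : ℤ) := R.e_periodic
  rw [mul_comm, ← smul_eq_mul]; exact h.zsmul k j

theorem c_congr {i j : ℤ} (h : (R.L : ℤ) ∣ j - i) : R.c i = R.c j := by
  obtain ⟨k, hk⟩ := h
  rw [← R.c_add_mul i k, ← hk]; congr 1; ring

theorem e_congr {i j : ℤ} (h : (R.L : ℤ) ∣ j - i) : R.e i = R.e j := by
  obtain ⟨k, hk⟩ := h
  rw [← R.e_add_mul i k, ← hk]; congr 1; ring

theorem posWord_congr (m : ℕ) {i j : ℤ} (h : (R.L : ℤ) ∣ j - i) :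
    R.posWord m i = R.posWord m j := by
  refine List.map_congr_left fun r _ => ?_
  rw [R.c_congr (i := i + r) (j := j + r) (by simpa using h),
    R.e_congr (i := i + r) (j := j + r) (by simpa using h)]

theorem negWord_congr (m : ℕ) {i j : ℤ} (h : (R.L : ℤ) ∣ j - i) :
    R.negWord m i = R.negWord m j := by
  refine List.map_congr_left fun r _ => ?_
  rw [R.c_congr (i := i - r + 1) (j := j - r + 1) (by simpa using h),
    R.e_congr (i := i - r) (j := j - r) (by simpa using h)]

theorem value_negWord_mul (m : ℕ) (s : ℤ) :
    value ψ (R.negWord m s) * (of (R.c (s - m + 1)))⁻¹ =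
      (of (R.c (s + 1)))⁻¹ * (value ψ (R.posWord m (s - m + 1)))⁻¹ := by
  induction m generalizing s with
  | zero => simp [negWord, posWord]
  | succ m ih =>
    rw [negWord_succ, posWord_succ', value_cons, value_append]
    have := ih (s - 1)
    push_cast at this ⊢
    rw [show s - 1 - (m : ℤ) + 1 = s - (m + 1) + 1 by ring, sub_add_cancel] at this
    rw [mul_assoc, this, show s - ((m : ℤ) + 1) + 1 + m = s by ring]
    simp [mul_assoc]

theorem value_negWord {m : ℕ} (hm : R.L ∣ m) (s : ℤ) :
    value ψ (R.negWord m s) =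
      (of (R.c (s + 1)))⁻¹ * (value ψ (R.posWord m (s + 1)))⁻¹ * of (R.c (s + 1)) := by
  have hm' : (R.L : ℤ) ∣ m := Int.natCast_dvd_natCast.2 hm
  have h1 : (R.L : ℤ) ∣ (s + 1) - (s - m + 1) := by
    rwa [show (s + 1) - (s - (m : ℤ) + 1) = m by ring]
  have := R.value_negWord_mul ψ m s
  rw [R.c_congr h1, R.posWord_congr m h1] at this
  rw [← this]; simp

theorem value_posWord_shift {m : ℕ} (hm : R.L ∣ m) (s : ℤ) :
    value ψ (R.posWord m s) * (of (R.c s) * t ^ (R.e s : ℤ)) =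
      of (R.c s) * t ^ (R.e s : ℤ) * value ψ (R.posWord m (s + 1)) := by
  have hm' : (R.L : ℤ) ∣ m := Int.natCast_dvd_natCast.2 hm
  have h := congrArg (value ψ) ((R.posWord_succ m s).symm.trans (R.posWord_succ' m s))
  rw [← R.c_congr (i := s) (j := s + m) (by simpa), ← R.e_congr (i := s) (j := s + m)
    (by simpa)] at h
  simpa using h.symm

end Relator

/-- The cyclic words which are boundary labels of disc diagrams over the HNN extension with the
additional relator of length `m`. -/
inductive Bounds (R : Relator A B) (m : ℕ) : List (H × ℤˣ) → Prop
  | pos (s : ℤ) : Bounds R m (R.posWord m s)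
  | neg (s : ℤ) : Bounds R m (R.negWord m s)
  | rot (l l' : List (H × ℤˣ)) : Bounds R m (l ++ l') → Bounds R m (l' ++ l)
  | digon (u : ℤˣ) (g : toSubgroup A B u) :
      Bounds R m [((toSubgroupEquiv ψ u g : H)⁻¹, u), ((g : H), -u)]
  | split (x y x' y' : H) (u u' : ℤˣ) (l l' : List (H × ℤˣ)) :
      Bounds R m ((x' * y, u) :: l) → Bounds R m ((x * y', u') :: l') →
      Bounds R m ((x * y, u) :: l ++ (x' * y', u') :: l')

section

variable {ψ} {R : Relator A B} {m : ℕ}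

theorem Bounds.two_le_length (hm : 2 ≤ m) {l : List (H × ℤˣ)} (h : Bounds ψ R m l) :
    2 ≤ l.length := by
  induction h with
  | pos s => simpa [Relator.posWord]
  | neg s => simpa [Relator.negWord]
  | rot l l' _ ih => simp only [List.length_append] at ih ⊢; omega
  | digon u g => simp
  | split => simp_all; omega

theorem Bounds.exists_cons (hm : 2 ≤ m) {l : List (H × ℤˣ)} (h : Bounds ψ R m l) :
    ∃ a l', l = a :: l' := by
  refine List.exists_cons_of_ne_nil ?_
  rintro rfl
  simpa using h.two_le_length hm

/-- The list of a Mathlib word, starting with `t ^ u`, corresponding to a list of letters. -/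
def shift : ℤˣ → List (H × ℤˣ) → List (ℤˣ × H)
  | u, [] => [(u, 1)]
  | u, a :: l => (u, a.1) :: shift a.2 l

theorem shift_ne_nil (u : ℤˣ) (l : List (H × ℤˣ)) : shift u l ≠ [] := by
  cases l <;> simp [shift]

theorem head_shift (u : ℤˣ) (l : List (H × ℤˣ)) (a : ℤˣ × H) (ha : a ∈ (shift u l).head?) :
    a.1 = u := by
  cases l <;> simp [shift] at ha <;> simp [← ha]

theorem prod_shift (u : ℤˣ) (l : List (H × ℤˣ)) :
    ((shift u l).map fun x => (t ^ (x.1 : ℤ) * of x.2 : HNNExtension H A B ψ)).prod =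
      t ^ (u : ℤ) * value ψ l := by
  induction l generalizing u with
  | nil => simp [shift]
  | cons a l ih => simp [shift, ih, mul_assoc]

theorem chain_shift (h : H) (u : ℤˣ) (l : List (H × ℤˣ))
    (hl : ∀ l₁ a v g w l₂, (h, u) :: l = l₁ ++ (a, v) :: (g, w) :: l₂ →
      g ∈ toSubgroup A B v → v = w) :
    (shift u l).IsChain fun a b => a.2 ∈ toSubgroup A B a.1 → a.1 = b.1 := by
  induction l generalizing h u with
  | nil => simp [shift]
  | cons a l ih =>
    rw [shift, List.isChain_cons]
    refine ⟨fun b hb hmem => ?_, ih a.1 a.2 fun l₁ b v g w l₂ he => ?_⟩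
    · rw [head_shift _ _ _ hb]
      exact hl [] h u a.1 a.2 l rfl hmem
    · refine hl ((h, u) :: l₁) b v g w l₂ ?_
      rw [List.cons_append, ← he]

/-- A consequence of Britton's lemma. -/
theorem exists_pinch {l : List (H × ℤˣ)} (hl : l ≠ []) (h : value ψ l = 1) :
    ∃ l₁ a u g l₂, l = l₁ ++ (a, u) :: (g, -u) :: l₂ ∧ g ∈ toSubgroup A B u := by
  obtain ⟨⟨b, v⟩, l, rfl⟩ := List.exists_cons_of_ne_nil hl
  by_contra! hcon
  let w : ReducedWord H A B :=
    { head := b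
      toList := shift v l
      chain := chain_shift b v l fun l₁ a u g w l₂ he hg => by
        by_contra hne
        have : w = -u := by
          rcases Int.units_eq_one_or u with rfl | rfl <;>
            rcases Int.units_eq_one_or w with rfl | rfl <;> simp_all
        exact hcon l₁ a u g l₂ (this ▸ he) hg }
  refine shift_ne_nil v l (ReducedWord.toList_eq_nil_of_mem_of_range ψ w ⟨1, ?_⟩)
  rw [map_one, ← h, ReducedWord.prod, prod_shift, value_cons, mul_assoc]

theorem Bounds.of_value_eq_one {l : List (H × ℤˣ)} (hl : l ≠ []) (h : value ψ l = 1) :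
    Bounds ψ R m l := by
  induction hn : l.length using Nat.strong_induction_on generalizing l with
  | _ n ih =>
  obtain ⟨l₁, a, u, g, l₂, rfl, hg⟩ := exists_pinch hl h
  have hrot : value ψ ((a, u) :: (g, -u) :: (l₂ ++ l₁)) = 1 := by
    rw [value_append] at h
    have := eq_inv_of_mul_eq_one_right h
    rw [← List.cons_append, ← List.cons_append, value_append, this, inv_mul_cancel]
  rw [← List.singleton_append, ← List.append_nil (_ ++ _)]
  suffices Bounds ψ R m ((a, u) :: (g, -u) :: (l₂ ++ l₁)) by
    have := Bounds.rot ((a, u) :: (g, -u) :: l₂) l₁ (by simpa using this)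
    simpa using this
  have hconj := of_toSubgroupEquiv ψ u ⟨g, hg⟩
  match hL : l₂ ++ l₁ with
  | [] =>
    rw [hL] at hrot
    have : a = (toSubgroupEquiv ψ u ⟨g, hg⟩ : H)⁻¹ := by
      rw [eq_inv_iff_mul_eq_one]
      apply of_injective (φ := ψ)
      rw [map_mul, map_one, hconj, ← hrot]
      simp [mul_assoc]
    rw [this]
    exact Bounds.digon u ⟨g, hg⟩
  | (b, v) :: l₃ =>
    rw [hL] at hrot
    have hlen : l₃.length + 1 = l₂.length + l₁.length := by
      have := congrArg List.length hL
      simpa using this.symm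
    have h3 := ih (l₃.length + 1) (by simp at hn; omega)
      (l := (a * ((toSubgroupEquiv ψ u ⟨g, hg⟩ : H) * b), v) :: l₃) (by simp) (by
        rw [← hrot]
        simp [hconj, mul_assoc]) (by simp)
    have := Bounds.split a 1 (toSubgroupEquiv ψ u ⟨g, hg⟩ : H)⁻¹
      ((toSubgroupEquiv ψ u ⟨g, hg⟩ : H) * b) u v [(g, -u)] l₃
      (by simpa using Bounds.digon u ⟨g, hg⟩) h3
    simpa using this

/-- The set of conjugates of values of boundary words. -/
def boundaryValues (ψ : A ≃* B) (R : Relator A B) (m : ℕ) : Set (HNNExtension H A B ψ) :=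
  {x | x = 1 ∨ ∃ l h, Bounds ψ R m l ∧ x = of h * value ψ l * (of h)⁻¹}

theorem boundaryValues_mul (hm : 2 ≤ m) {x y : HNNExtension H A B ψ}
    (hx : x ∈ boundaryValues ψ R m) (hy : y ∈ boundaryValues ψ R m) :
    x * y ∈ boundaryValues ψ R m := by
  rcases hx with rfl | ⟨l, h, hl, rfl⟩
  · simpa
  rcases hy with rfl | ⟨l', h', hl', rfl⟩
  · exact Or.inr ⟨l, h, hl, by simp⟩
  obtain ⟨⟨b, v⟩, l, rfl⟩ := hl.exists_cons hm
  obtain ⟨⟨b', v'⟩, l', rfl⟩ := hl'.exists_cons hm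
  refine Or.inr ⟨_, h', Bounds.split (h'⁻¹ * h) b 1 (h⁻¹ * h' * b') v v' l l' (by simpa)
    (by simpa [mul_assoc]), ?_⟩
  simp [mul_assoc]

theorem boundaryValues_conj (hm : 2 ≤ m) (k : HNNExtension H A B ψ) :
    (∀ x ∈ boundaryValues ψ R m, k * x * k⁻¹ ∈ boundaryValues ψ R m) ∧
      ∀ x ∈ boundaryValues ψ R m, k⁻¹ * x * k ∈ boundaryValues ψ R m := by
  have hof : ∀ g : H, ∀ x ∈ boundaryValues ψ R m,
      (of g : HNNExtension H A B ψ) * x * (of g)⁻¹ ∈ boundaryValues ψ R m := by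
    rintro g x (rfl | ⟨l, h, hl, rfl⟩)
    · exact Or.inl (by simp)
    · exact Or.inr ⟨l, g * h, hl, by simp [mul_assoc]⟩
  have ht : ∀ u : ℤˣ, ∀ x ∈ boundaryValues ψ R m,
      (t ^ (u : ℤ) : HNNExtension H A B ψ) * x * (t ^ (-u : ℤ)) ∈ boundaryValues ψ R m := by
    rintro u x (rfl | ⟨l, h, hl, rfl⟩)
    · exact Or.inl (by simp)
    obtain ⟨⟨b, v⟩, l, rfl⟩ := hl.exists_cons hm
    have hd := Bounds.digon (ψ := ψ) (R := R) (m := m) (-u) 1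
    have hs := Bounds.split (ψ := ψ) (R := R) (m := m) h⁻¹ 1 1 (h * b) (-u) v [(1, u)] l
      (by simpa using hd) (by simpa using hl)
    have := Bounds.rot [(h⁻¹, -u)] ((1, u) :: (h * b, v) :: l) (by simpa using hs)
    refine Or.inr ⟨_, 1, this, ?_⟩
    simp [mul_assoc]
  induction k using HNNExtension.induction_on with
  | of g => exact ⟨hof g, fun x hx => by simpa using hof g⁻¹ x hx⟩
  | t => exact ⟨fun x hx => by simpa using ht 1 x hx, fun x hx => by simpa using ht (-1) x hx⟩
  | mul a b iha ihb =>
    refine ⟨fun x hx => ?_, fun x hx => ?_⟩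
    · have := iha.1 _ (ihb.1 x hx)
      simpa [mul_assoc] using this
    · have := ihb.2 _ (iha.2 x hx)
      simpa [mul_assoc] using this
  | inv a ih => exact ⟨fun x hx => by simpa using ih.2 x hx, fun x hx => by simpa using ih.1 x hx⟩

theorem normalClosure_subset_boundaryValues (hm : 2 ≤ m) (hL : R.L ∣ m) {x : HNNExtension H A B ψ}
    (hx : x ∈ Subgroup.normalClosure {value ψ (R.posWord m 0)}) : x ∈ boundaryValues ψ R m := by
  have hpos : value ψ (R.posWord m 0) ∈ boundaryValues ψ R m :=
    Or.inr ⟨_, 1, Bounds.pos 0, by simp⟩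
  have hneg : (value ψ (R.posWord m 0))⁻¹ ∈ boundaryValues ψ R m := by
    refine Or.inr ⟨_, R.c 0, Bounds.neg (-1), ?_⟩
    rw [R.value_negWord ψ hL]
    simp [mul_assoc]
  rw [Subgroup.normalClosure, ← Subgroup.mem_toSubmonoid, Subgroup.closure_toSubmonoid] at hx
  induction hx using Submonoid.closure_induction with
  | mem x hx =>
    rcases hx with hx | hx
    · obtain ⟨_, rfl, hc⟩ := Group.mem_conjugatesOfSet_iff.1 hx
      obtain ⟨c, rfl⟩ := isConj_iff.1 hc
      exact (boundaryValues_conj hm c).1 _ hpos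
    · obtain ⟨_, rfl, hc⟩ := Group.mem_conjugatesOfSet_iff.1 (Set.mem_inv.1 hx)
      obtain ⟨c, hc⟩ := isConj_iff.1 hc
      rw [← inv_inv x, ← hc]
      have := (boundaryValues_conj hm c).1 _ hneg
      simpa [mul_assoc] using this
  | one => exact Or.inl rfl
  | mul x y _ _ hx hy => exact boundaryValues_mul hm hx hy

end

end Relative

namespace Relative

open HNNExtension Equiv Equiv.Perm CycleCount

section Faces

variable {X : Type*}

/-- The list `l` enumerates a cycle of `f`. -/
def IsFace (f : Perm X) (l : List X) : Prop := l.Nodup ∧ l ≠ [] ∧ l.map f = l.rotate 1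

theorem isFace_cons {f : Perm X} {a : X} {l : List X} :
    IsFace f (a :: l) ↔ (a :: l).Nodup ∧ (a :: l).map f = l ++ [a] := by
  simp [IsFace]

theorem IsFace.rotate {f : Perm X} {l : List X} (h : IsFace f l) (n : ℕ) :
    IsFace f (l.rotate n) := by
  refine ⟨List.nodup_rotate.2 h.1, by simpa using h.2.1, ?_⟩
  rw [List.map_rotate, h.2.2, List.rotate_rotate, List.rotate_rotate, add_comm]

theorem IsFace.append_comm {f : Perm X} {l l' : List X} (h : IsFace f (l ++ l')) :
    IsFace f (l' ++ l) := by
  have := h.rotate l.length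
  rwa [List.rotate_append_length_eq] at this

theorem IsFace.apply_mem {f : Perm X} {l : List X} (h : IsFace f l) {x : X} (hx : x ∈ l) :
    f x ∈ l := by
  have : f x ∈ l.map f := List.mem_map_of_mem hx
  rwa [h.2.2, List.mem_rotate] at this

theorem IsFace.mem_of_orbits [Finite X] {f : Perm X} {l : List X} (h : IsFace f l) {x y : X}
    (hx : x ∈ l) (hxy : orbits f x y) : y ∈ l := by
  obtain ⟨n, rfl⟩ := SameCycle.exists_nat_pow_eq hxy
  clear hxy
  induction n with
  | zero => exact hx
  | succ n ih => 
    rw [pow_succ', Perm.mul_apply]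
    exact h.apply_mem ih

theorem IsFace.getElem_eq {f : Perm X} {l : List X} (h : IsFace f l) (n : ℕ) (hn : n < l.length) :
    l[n] = (f ^ n) (l[0]'(by omega)) := by
  induction n with
  | zero => rfl
  | succ n ih =>
    have h1 : (l.map f)[n]'(by simpa using by omega) = (l.rotate 1)[n]'(by simpa using by omega) := by
      simp only [h.2.2]
    rw [List.getElem_map, List.getElem_rotate] at h1
    simp only [Nat.mod_eq_of_lt hn] at h1
    rw [← h1, ih (by omega), pow_succ', Perm.mul_apply]

theorem IsFace.orbits_of_mem [Finite X] {f : Perm X} {l : List X} (h : IsFace f l) {x y : X}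
    (hx : x ∈ l) (hy : y ∈ l) : orbits f x y := by
  have key : ∀ z ∈ l, ∃ a, orbits f a z ∧ l.head? = some a := by
    intro z hz
    obtain ⟨n, hn, rfl⟩ := List.getElem_of_mem hz
    refine ⟨l[0]'(by omega), ?_, ?_⟩
    · rw [h.getElem_eq n hn]
      exact ⟨n, by simp⟩
    · rw [List.head?_eq_getElem?, List.getElem?_eq_getElem]
  obtain ⟨a, ha, ha'⟩ := key x hx
  obtain ⟨b, hb, hb'⟩ := key y hy
  obtain rfl : a = b := by simpa [ha'] using hb'
  exact Setoid.trans' _ (Setoid.symm' _ ha) hb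

theorem IsFace.congr {f g : Perm X} {l : List X} (h : IsFace f l) (hg : ∀ x ∈ l, g x = f x) :
    IsFace g l :=
  ⟨h.1, h.2.1, by rw [← h.2.2]; exact List.map_congr_left hg⟩

theorem restrict_mul {f g f' g' : Perm X} {C : Set X} (hg : ∀ x, g x ∈ C ↔ x ∈ C)
    (h₁ : ∀ x ∈ C, f' x = f x) (h₂ : ∀ x ∉ C, f' x = x) (h₃ : ∀ x ∈ C, g' x = g x)
    (h₄ : ∀ x ∉ C, g' x = x) :
    (∀ x ∈ C, (f' * g') x = (f * g) x) ∧ ∀ x ∉ C, (f' * g') x = x := by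
  refine ⟨fun x hx => ?_, fun x hx => ?_⟩
  · rw [Perm.mul_apply, h₃ x hx, h₁ _ ((hg x).2 hx), Perm.mul_apply]
  · rw [Perm.mul_apply, h₄ x hx, h₂ x hx]

end Faces

section Genus

variable {X : Type*} [Fintype X] [DecidableEq X]

theorem card_le_two_mul_cyc {α : Perm X} (hα : ∀ x, α (α x) = x) :
    2 * Nat.card X ≤ 2 * cyc α + α.support.card := by
  have h : (2 * Nat.card X : ℚ) ≤ 2 * cyc α + α.support.card := by
    have h1 : (α.support.card : ℚ) = ∑ x, if α x ≠ x then (1 : ℚ) else 0 := by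
      rw [Finset.sum_boole]; rfl
    have h2 : (2 * Nat.card X : ℚ) = ∑ _x : X, (2 : ℚ) := by
      simp [mul_comm]
    rw [cyc, numClasses_eq_sum, h1, h2, Finset.mul_sum, ← Finset.sum_add_distrib]
    refine Finset.sum_le_sum fun x _ => ?_
    have hsub : ∀ y, orbits α x y → y = x ∨ y = α x := by
      intro y hy
      obtain ⟨n, rfl⟩ := SameCycle.exists_nat_pow_eq hy
      clear hy
      induction n with
      | zero => exact Or.inl rfl
      | succ n ih =>
        rw [pow_succ', Perm.mul_apply]
        rcases ih with ih | ih <;> rw [ih]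
        · exact Or.inr rfl
        · exact Or.inl (hα x)
    have hle : Nat.card {y // orbits α x y} ≤ ({x, α x} : Finset X).card := by
      rw [← Nat.card_eq_finsetCard]
      exact Nat.card_le_card_of_injective (fun z => ⟨z.1, by simpa using hsub z.1 z.2⟩)
        fun a b h => Subtype.ext (by simpa using h)
    have hpos : 0 < Nat.card {y // orbits α x y} := 
      Nat.card_pos_iff.2 ⟨⟨x, Setoid.refl' _ x⟩, inferInstance⟩
    rw [Finset.card_insert_eq_ite, Finset.card_singleton] at hle
    generalize Nat.card {y // orbits α x y} = c at *
    by_cases hx : α x = x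
    · obtain rfl : c = 1 := by simp [hx] at hle; omega
      norm_num [hx]
    · have : c ≤ 2 := hle.trans (by split_ifs <;> simp)
      interval_cases c <;> norm_num [hx]
  exact_mod_cast h

/-- The genus inequality for maps whose edges are the nontrivial orbits of an involution. -/
theorem two_mul_cyc_le (φ : Perm X) {α : Perm X} (hα : ∀ x, α (α x) = x) :
    2 * cyc φ + 2 * cyc (φ * α) ≤ α.support.card + 4 * numClasses (orbits φ ⊔ orbits α) := by
  have h1 := genus_nonneg α φ
  have h2 := card_le_two_mul_cyc hα
  rw [sup_comm] at h1
  omega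

end Genus

variable {H : Type*} [Group H] {A B : Subgroup H} 

/-- A planar map on the set of darts `X` (the darts fixed by `α` are considered as absent), with
faces labelled by boundary words, in which the corner labels are compatible with the
edge labels `p` at all darts of the component of `x₀`, with the exception of `x₀`. -/
structure Obstruction (ψ : A ≃* B) (R : Relator A B) (m : ℕ) (X : Type) [Fintype X]
    [DecidableEq X] where
  /-- the successor of a dart along its face -/
  φ : Perm X
  /-- the opposite dart -/
  α : Perm X
  /-- the exponent of a dart -/
  ε : X → ℤˣ
  /-- the corner at the origin of a dart -/
  κ : X → H
  /-- the edge labels -/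
  p : X → H
  /-- the potential -/
  θ : X → H
  /-- the exceptional dart -/
  x₀ : X
  inv : ∀ d, α (α d) = d
  dead : ∀ d, α d = d → φ d = d
  ε_α : ∀ d, α d ≠ d → ε (α d) = - ε d
  p_mem : ∀ d, α d ≠ d → p d ∈ toSubgroup A B (- ε d)
  p_α : ∀ d, α d ≠ d → (of (p (α d)) : HNNExtension H A B ψ) =
    t ^ (- ε d : ℤ) * (of (p d))⁻¹ * t ^ (ε d : ℤ)
  face : ∀ d, α d ≠ d → ∃ l, IsFace φ l ∧ d ∈ l ∧ Bounds ψ R m (l.map fun x => (κ x, ε x))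
  planar : α.support.card + 4 * numClasses (orbits φ ⊔ orbits α) ≤ 2 * cyc φ + 2 * cyc (φ * α)
  live : α x₀ ≠ x₀
  bad : θ (φ (α x₀)) ≠ θ x₀ * κ x₀ * p x₀
  good : ∀ d, (orbits φ ⊔ orbits α) x₀ d → d ≠ x₀ → θ (φ (α d)) = θ d * κ d * p d

namespace Obstruction

variable {ψ : A ≃* B} {R : Relator A B} {m : ℕ} {X : Type} [Fintype X] [DecidableEq X]
  (O : Obstruction ψ R m X)

/-- The complexity of an obstruction. -/
noncomputable def size : ℕ := O.α.support.card + (Nat.card X - cyc O.φ)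

/-- Lying in the same connected component. -/
def conn : Setoid X := orbits O.φ ⊔ orbits O.α

theorem conn_φ (x : X) : O.conn x (O.φ x) :=
  (le_sup_left : orbits O.φ ≤ _) (orbits_step _ x)

theorem conn_α (x : X) : O.conn x (O.α x) :=
  (le_sup_right : orbits O.α ≤ _) (orbits_step _ x)

theorem conn_le {u : Setoid X} (h : ∀ x, u x (O.φ x)) (h' : ∀ x, u x (O.α x)) : O.conn ≤ u :=
  sup_le (orbits_le h) (orbits_le h')

theorem exists_size_lt_of_not_conn {d : X} (hd : O.α d ≠ d) (h : ¬ O.conn O.x₀ d) :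
    ∃ O' : Obstruction ψ R m X, O'.size < O.size := by
  set C : Set X := {x | O.conn O.x₀ x}
  have hC : ∀ x y, O.conn x y → (x ∈ C ↔ y ∈ C) := fun x y hxy =>
    ⟨fun h => Setoid.trans' _ h hxy, fun h => Setoid.trans' _ h (Setoid.symm' _ hxy)⟩
  have hCφ : ∀ x, O.φ x ∈ C ↔ x ∈ C := fun x => (hC _ _ (O.conn_φ x)).symm
  have hCα : ∀ x, O.α x ∈ C ↔ x ∈ C := fun x => (hC _ _ (O.conn_α x)).symm
  have hCφ' : ∀ x, O.φ x ∈ Cᶜ ↔ x ∈ Cᶜ := fun x => not_congr (hCφ x)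
  have hCα' : ∀ x, O.α x ∈ Cᶜ ↔ x ∈ Cᶜ := fun x => not_congr (hCα x)
  have hoφ : ∀ x y, orbits O.φ x y → (x ∈ C ↔ y ∈ C) := fun x y h =>
    hC x y ((le_sup_left : orbits O.φ ≤ _) h)
  have hoα : ∀ x y, orbits O.α x y → (x ∈ C ↔ y ∈ C) := fun x y h =>
    hC x y ((le_sup_right : orbits O.α ≤ _) h)
  have hν : ∀ x, (O.φ * O.α) x ∈ C ↔ x ∈ C := fun x => (hCφ _).trans (hCα x)
  have hν' : ∀ x, (O.φ * O.α) x ∈ Cᶜ ↔ x ∈ Cᶜ := fun x => not_congr (hν x)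
  have hoν : ∀ x y, orbits (O.φ * O.α) x y → (x ∈ C ↔ y ∈ C) := fun x y h =>
    hC x y (orbits_mul_le le_sup_left le_sup_right h)
  obtain ⟨φ₁, hφ₁, hφ₁'⟩ := exists_restr_perm O.φ hCφ
  obtain ⟨φ₂, hφ₂, hφ₂'⟩ := exists_restr_perm O.φ hCφ'
  obtain ⟨α₁, hα₁, hα₁'⟩ := exists_restr_perm O.α hCα
  obtain ⟨α₂, hα₂, hα₂'⟩ := exists_restr_perm O.α hCα'
  obtain ⟨hν₁, hν₁'⟩ := restrict_mul hCα hφ₁ hφ₁' hα₁ hα₁'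
  obtain ⟨hν₂, hν₂'⟩ := restrict_mul hCα' hφ₂ hφ₂' hα₂ hα₂'
  have eF := numClasses_restr_add hoφ
  have eV := numClasses_restr_add hoν
  have eC := numClasses_restr_add hC
  rw [← orbits_restr hCφ hφ₁ hφ₁', ← orbits_restr hCφ' hφ₂ hφ₂'] at eF
  rw [← orbits_restr hν hν₁ hν₁', ← orbits_restr hν' hν₂ hν₂'] at eV
  have conn₁ : restr O.conn C = orbits φ₁ ⊔ orbits α₁ := by
    rw [conn, restr_sup hoφ hoα, ← orbits_restr hCφ hφ₁ hφ₁', ← orbits_restr hCα hα₁ hα₁']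
  have conn₂ : restr O.conn Cᶜ = orbits φ₂ ⊔ orbits α₂ := by
    rw [conn, restr_sup (C := Cᶜ) (fun x y h => not_congr (hoφ x y h)) (fun x y h => not_congr (hoα x y h)),
      ← orbits_restr hCφ' hφ₂ hφ₂', ← orbits_restr hCα' hα₂ hα₂']
  rw [conn₁, conn₂] at eC
  have inv₁ : ∀ x, α₁ (α₁ x) = x := fun x => by
    by_cases hx : x ∈ C
    · rw [hα₁ x hx, hα₁ _ ((hCα x).2 hx), O.inv]
    · rw [hα₁' x hx, hα₁' x hx]
  have inv₂ : ∀ x, α₂ (α₂ x) = x := fun x => by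
    by_cases hx : x ∈ Cᶜ
    · rw [hα₂ x hx, hα₂ _ ((hCα' x).2 hx), O.inv]
    · rw [hα₂' x hx, hα₂' x hx]
  have hS : α₁.support.card + α₂.support.card = O.α.support.card := by
    rw [← Finset.card_union_of_disjoint]
    · congr 1
      ext x
      by_cases hx : x ∈ C
      · simp [hα₁ x hx, hα₂' x (not_not.2 hx)]
      · simp [hα₁' x hx, hα₂ x hx]
    · rw [Finset.disjoint_left]
      intro x hx hx'
      by_cases hxC : x ∈ C
      · simp [hα₂' x (not_not.2 hxC)] at hx'
      · simp [hα₁' x hxC] at hx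
  have hdC : d ∈ Cᶜ := h
  have hS₂ : 0 < α₂.support.card := Finset.card_pos.2 ⟨d, by simpa [hα₂ d hdC] using hd⟩
  have hgenus := two_mul_cyc_le φ₂ inv₂
  have hx₀ : O.x₀ ∈ C := (Setoid.refl' _ _ : O.conn _ _)
  have live₁ : ∀ x, α₁ x ≠ x → x ∈ C ∧ α₁ x = O.α x ∧ O.α x ≠ x := fun x hx => by
    have hxC : x ∈ C := by_contra fun hxC => hx (hα₁' x hxC)
    exact ⟨hxC, hα₁ x hxC, hα₁ x hxC ▸ hx⟩
  have hplanar := O.planar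
  have hle : cyc O.φ ≤ cyc φ₁ := numClasses_anti <| orbits_le fun x => by
    by_cases hx : x ∈ C
    · rw [hφ₁ x hx]; exact orbits_step _ x
    · rw [hφ₁' x hx]
  refine ⟨{ O with
    φ := φ₁
    α := α₁
    inv := inv₁
    dead := fun x hx => ?_
    ε_α := fun x hx => ?_
    p_mem := fun x hx => O.p_mem x (live₁ x hx).2.2
    p_α := fun x hx => ?_
    face := fun x hx => ?_
    planar := ?_
    live := by rw [hα₁ _ hx₀]; exact O.live
    bad := by rw [hα₁ _ hx₀, hφ₁ _ ((hCα _).2 hx₀)]; exact O.bad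
    good := fun x hx hne => ?_ }, ?_⟩
  · by_cases hxC : x ∈ C
    · rw [hφ₁ x hxC]; exact O.dead x (by rwa [hα₁ x hxC] at hx)
    · exact hφ₁' x hxC
  · rw [(live₁ x hx).2.1]; exact O.ε_α x (live₁ x hx).2.2
  · rw [(live₁ x hx).2.1]; exact O.p_α x (live₁ x hx).2.2
  · obtain ⟨l, hl, hxl, hb⟩ := O.face x (live₁ x hx).2.2
    refine ⟨l, hl.congr fun y hy => hφ₁ y ?_, hxl, hb⟩
    exact (hoφ x y (hl.orbits_of_mem hxl hy)).1 (live₁ x hx).1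
  · simp only [cyc] at *
    simp only [conn] at eC
    omega
  · rw [← conn₁] at hx
    have hxC : x ∈ C := by
      rcases hx with rfl | hx
      · exact hx₀
      · exact hx.2.1
    rw [hα₁ x hxC, hφ₁ _ ((hCα x).2 hxC)]
    exact O.good x hxC hne
  · simp only [size]
    omega

end Obstruction

end Relative

namespace Relative

open HNNExtension Equiv Equiv.Perm CycleCount

theorem IsFace.swap_mul {X : Type*} [DecidableEq X] {φ : Perm X} {i j : X} {l₁ l₂ : List X}
    (h : IsFace φ ((i :: l₁) ++ (j :: l₂))) : IsFace (swap i j * φ) (i :: l₁) := by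
  rw [List.cons_append, isFace_cons] at h
  obtain ⟨hn, hm⟩ := h
  rw [← List.cons_append, List.map_append, List.append_assoc, List.cons_append,
    List.append_cons] at hm
  obtain ⟨h1, h2⟩ := List.append_inj hm (by simp)
  rw [isFace_cons]
  have hn' : (i :: l₁).Nodup := (List.nodup_append.1 (List.cons_append ▸ hn)).1
  refine ⟨hn', ?_⟩
  rw [Perm.coe_mul, ← List.map_map, h1, List.map_append]
  congr 1
  · conv_rhs => rw [← List.map_id l₁]
    refine List.map_congr_left fun x hx => swap_apply_of_ne_of_ne ?_ ?_
    · rintro rfl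
      exact (List.nodup_cons.1 hn').1 hx
    · rintro rfl
      simp [List.nodup_append] at hn
      grind
  · simp

theorem orbits_eq_of_fixed {X : Type*} {φ : Perm X} {i j : X} (h : orbits φ i j) (hj : φ j = j) :
    i = j := by
  have h' : SameCycle φ j i := Setoid.symm' _ h
  obtain ⟨n, hn⟩ := h'
  rw [← hn, Perm.zpow_apply_eq_self_of_apply_eq_self hj]

variable {H : Type*} [Group H] {A B : Subgroup H}

namespace Obstruction

variable {ψ : A ≃* B} {R : Relator A B} {m : ℕ} {X : Type} [Fintype X] [DecidableEq X]
  (O : Obstruction ψ R m X)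

/-- The label of a dart. -/
def lab (x : X) : H × ℤˣ := (O.κ x, O.ε x)

theorem live_of_φ_ne {d : X} (h : O.φ d ≠ d) : O.α d ≠ d := fun h' => h (O.dead d h')

theorem live_of_live {d : X} (h : O.α (O.φ (O.α d)) ≠ O.φ (O.α d)) : O.α d ≠ d := by
  intro h'
  rw [h', O.dead d h'] at h
  exact h h'

/-- A decomposition of a face into two, obtained by identifying two of its corners. -/
structure Pinch (i j : X) where
  /-- the first part -/
  l₁ : List X
  /-- the second part -/
  l₂ : List X
  /-- first half of the corner at `i` -/
  x : H
  /-- second half of the corner at `i` -/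
  y : H
  /-- first half of the corner at `j` -/
  x' : H
  /-- second half of the corner at `j` -/
  y' : H
  face : IsFace O.φ ((i :: l₁) ++ (j :: l₂))
  κ_i : O.κ i = x * y
  κ_j : O.κ j = x' * y'
  bounds₁ : Bounds ψ R m ((x' * y, O.ε i) :: l₁.map O.lab)
  bounds₂ : Bounds ψ R m ((x * y', O.ε j) :: l₂.map O.lab)

variable {O}

namespace Pinch

variable {i j : X} (P : O.Pinch i j)

/-- Exchanging the two corners. -/
def symm : O.Pinch j i :=
  ⟨P.l₂, P.l₁, P.x', P.y', P.x, P.y, P.face.append_comm, P.κ_j, P.κ_i, P.bounds₂, P.bounds₁⟩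

/-- The new corner labels. -/
def κ (d : X) : H := if d = i then P.x' * P.y else if d = j then P.x * P.y' else O.κ d

/-- The new potential. -/
def θ (d : X) : H :=
  if d = i then O.θ i * P.x * P.x'⁻¹ else if d = j then O.θ j * P.x' * P.x⁻¹ else O.θ d

include P in
theorem ne : i ≠ j := by
  rintro rfl
  have := P.face.1
  simp at this

theorem symm_κ : P.symm.κ = P.κ := by
  funext d
  have := P.ne
  unfold κ symm
  grind

include P in
theorem orbits_φ : orbits O.φ i j := P.face.orbits_of_mem (by simp) (by simp)

include P in
theorem live_j : O.α j ≠ j := fun h => P.ne (orbits_eq_of_fixed P.orbits_φ (O.dead j h))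

theorem θ_mul_κ (d : X) : P.θ d * P.κ d = O.θ d * O.κ d := by
  unfold θ κ
  split_ifs with h1 h2
  · rw [h1, P.κ_i]; group
  · rw [h2, P.κ_j]; group
  · rfl

theorem face_left : ∀ d ∈ i :: P.l₁, ∃ l, IsFace (swap i j * O.φ) l ∧ d ∈ l ∧
    Bounds ψ R m (l.map fun x => (P.κ x, O.ε x)) := by
  intro d hd
  refine ⟨i :: P.l₁, P.face.swap_mul, hd, ?_⟩
  have hn := P.face.1
  convert P.bounds₁ using 1
  rw [List.map_cons]
  congr 1
  · simp [κ]
  · refine List.map_congr_left fun x hx => ?_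
    have h1 : x ≠ i := by rintro rfl; simp [hx] at hn
    have h2 : x ≠ j := by rintro rfl; simp [List.nodup_append] at hn; grind
    simp [κ, lab, h1, h2]

theorem exists_face {d : X} (hd : O.α d ≠ d) : ∃ l, IsFace (swap i j * O.φ) l ∧ d ∈ l ∧
    Bounds ψ R m (l.map fun x => (P.κ x, O.ε x)) := by
  by_cases h : d ∈ (i :: P.l₁) ++ (j :: P.l₂)
  · rw [List.mem_append] at h
    rcases h with h | h
    · exact P.face_left d h
    · have := P.symm.face_left d h
      rwa [P.symm_κ, swap_comm] at this
  · obtain ⟨l, hl, hdl, hb⟩ := O.face d hd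
    have hi : ∀ x ∈ l, x ∉ (i :: P.l₁) ++ (j :: P.l₂) := fun x hx hx' =>
      h (P.face.mem_of_orbits hx' (hl.orbits_of_mem hx hdl))
    have hne : ∀ x ∈ l, x ≠ i ∧ x ≠ j := fun x hx => 
      ⟨by rintro rfl; exact hi _ hx (by simp), by rintro rfl; exact hi _ hx (by simp)⟩
    refine ⟨l, hl.congr fun x hx => ?_, hdl, ?_⟩
    · rw [Perm.mul_apply]
      exact swap_apply_of_ne_of_ne (hne _ (hl.apply_mem hx)).1 (hne _ (hl.apply_mem hx)).2
    · rwa [List.map_congr_left (g := fun x => (O.κ x, O.ε x))]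
      intro x hx
      simp [κ, hne x hx]

/-- The components after the pinch. -/
def conn (_ : O.Pinch i j) : Setoid X := orbits (swap i j * O.φ) ⊔ orbits O.α

theorem glue_conn : glue P.conn i j = O.conn := by
  have h := glue_sup_swap_mul (orbits O.α) O.φ i j
  rw [sup_comm, sup_comm (orbits O.α)] at h
  rw [conn, h, glue_eq_self ((le_sup_left : orbits O.φ ≤ _) P.orbits_φ), Obstruction.conn]

theorem conn_le : P.conn ≤ O.conn := P.glue_conn ▸ le_glue _ _ _

theorem conn_ν (d : X) : P.conn d (swap i j (O.φ (O.α d))) :=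
  Setoid.trans' _ ((le_sup_right : orbits O.α ≤ _) (orbits_step _ d))
    ((le_sup_left : orbits (swap i j * O.φ) ≤ _) (orbits_step _ (O.α d)))

theorem exists_size_lt_of_planar {x₁ : X} (hx₁ : O.α x₁ ≠ x₁)
    (hp : O.α.support.card + 4 * numClasses P.conn ≤
      2 * (cyc O.φ + 1) + 2 * cyc (swap i j * (O.φ * O.α)))
    (θ : X → H)
    (bad : θ (swap i j (O.φ (O.α x₁))) ≠ θ x₁ * P.κ x₁ * O.p x₁)
    (good : ∀ d, P.conn x₁ d → d ≠ x₁ →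
      θ (swap i j (O.φ (O.α d))) = θ d * P.κ d * O.p d) :
    ∃ O' : Obstruction ψ R m X, O'.size < O.size := by
  have hF : cyc (swap i j * O.φ) = cyc O.φ + 1 := cyc_swap_mul P.ne P.orbits_φ
  have hN : cyc (swap i j * O.φ) ≤ Nat.card X := by
    rw [← numClasses_bot]
    exact numClasses_anti bot_le
  refine ⟨{ O with
    φ := swap i j * O.φ
    κ := P.κ
    θ := θ
    x₀ := x₁
    dead := fun d hd => ?_
    face := fun d hd => P.exists_face hd
    planar := ?_
    live := hx₁
    bad := bad
    good := good }, ?_⟩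
  · rw [Perm.mul_apply, O.dead d hd]
    refine swap_apply_of_ne_of_ne ?_ ?_
    · rintro rfl
      exact P.symm.live_j hd
    · rintro rfl
      exact P.live_j hd
  · rw [hF, mul_assoc]
    exact hp
  · simp only [size]
    omega

theorem θ_swap (h : O.θ i * P.x = O.θ j * P.x') (d : X) : P.θ (swap i j d) = O.θ d := by
  have := P.ne
  by_cases h1 : d = i
  · subst h1
    rw [swap_apply_left]
    simp [θ, this.symm, ← h]
  by_cases h2 : d = j
  · subst h2
    rw [swap_apply_right]
    simp [θ, h]
  · rw [swap_apply_of_ne_of_ne h1 h2]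
    simp [θ, h1, h2]

theorem exists_size_lt_of_aligned (h : O.θ i * P.x = O.θ j * P.x')
    (hp : O.α.support.card + 4 * numClasses P.conn ≤
      2 * (cyc O.φ + 1) + 2 * cyc (swap i j * (O.φ * O.α))) :
    ∃ O' : Obstruction ψ R m X, O'.size < O.size := by
  refine P.exists_size_lt_of_planar O.live hp P.θ ?_ fun d hd hne => ?_
  · rw [P.θ_swap h, P.θ_mul_κ]
    exact O.bad
  · rw [P.θ_swap h, P.θ_mul_κ]
    exact O.good d (P.conn_le hd) hne

theorem exists_size_lt_of_not_conn (hconn : ∀ d, O.α d ≠ d → O.conn O.x₀ d) 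
    (h : O.θ i * P.x ≠ O.θ j * P.x') (hij : ¬ P.conn i j) (hi : ¬ P.conn O.x₀ i)
    (hp : O.α.support.card + 4 * numClasses P.conn ≤
      2 * (cyc O.φ + 1) + 2 * cyc (swap i j * (O.φ * O.α))) :
    ∃ O' : Obstruction ψ R m X, O'.size < O.size := by
  obtain ⟨b, hb⟩ := (O.φ * O.α).surjective j
  rw [Perm.mul_apply] at hb
  have hbl : O.α b ≠ b := O.live_of_live (hb ▸ P.live_j)
  have hbi : P.conn b i := by
    have := P.conn_ν b
    rwa [hb, swap_apply_right] at this
  have hb₀ : b ≠ O.x₀ := by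
    rintro rfl
    exact hi hbi
  have hgood := fun d hd => O.good d (Setoid.trans' _ (hconn b hbl) (P.conn_le hd))
  have hne := P.ne
  refine P.exists_size_lt_of_planar hbl hp P.θ ?_ fun d hd hdb => ?_
  · rw [P.θ_mul_κ, ← hgood b (Setoid.refl' _ _) hb₀, hb, swap_apply_right]
    simpa [θ, mul_inv_eq_iff_eq_mul] using h
  · have hd₀ : d ≠ O.x₀ := by
      rintro rfl
      exact hi (Setoid.trans' _ (Setoid.symm' _ hd) hbi)
    rw [P.θ_mul_κ, ← hgood d hd hd₀]
    have h1 : O.φ (O.α d) ≠ j := fun h' => hdb ((O.φ * O.α).injective (h'.trans hb.symm))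
    have h2 : O.φ (O.α d) ≠ i := by
      intro h'
      have := P.conn_ν d
      rw [h', swap_apply_left] at this
      exact hij (Setoid.trans' _ (Setoid.symm' _ (Setoid.trans' _ (Setoid.symm' _ hd) hbi)) this)
    rw [swap_apply_of_ne_of_ne h2 h1]
    simp [θ, h1, h2]

include P in
theorem exists_size_lt (hconn : ∀ d, O.α d ≠ d → O.conn O.x₀ d) :
    ∃ O' : Obstruction ψ R m X, O'.size < O.size := by
  have hplanar := O.planar
  have hcc := congrArg numClasses P.glue_conn
  have hle := numClasses_le_glue_add_one P.conn i j
  by_cases hij : orbits (O.φ * O.α) i j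
  · have hV := cyc_swap_mul P.ne hij
    have hp : O.α.support.card + 4 * numClasses P.conn ≤
        2 * (cyc O.φ + 1) + 2 * cyc (swap i j * (O.φ * O.α)) := by
      rw [Obstruction.conn] at hcc
      omega
    by_cases h : O.θ i * P.x = O.θ j * P.x'
    · exact P.exists_size_lt_of_aligned h hp
    have hnot : ¬ P.conn i j := by
      intro hc
      rw [glue_eq_self hc] at hcc
      have h1 := two_mul_cyc_le (swap i j * O.φ) O.inv
      rw [mul_assoc, cyc_swap_mul P.ne P.orbits_φ, hV] at h1
      change numClasses (orbits (swap i j * O.φ) ⊔ orbits O.α) = numClasses (orbits O.φ ⊔ orbits O.α)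
        at hcc
      omega
    by_cases hi : P.conn O.x₀ i
    · have hj : ¬ P.conn O.x₀ j := fun hj =>
        hnot (Setoid.trans' _ (Setoid.symm' _ hi) hj)
      have e : P.symm.conn = P.conn := by rw [conn, swap_comm, conn]
      refine P.symm.exists_size_lt_of_not_conn hconn (Ne.symm h) ?_ ?_ ?_
      · rw [e]
        exact fun h => hnot (Setoid.symm' _ h)
      · rwa [e]
      · rwa [e, swap_comm]
    · exact P.exists_size_lt_of_not_conn hconn h hnot hi hp
  · have hV := cyc_swap_mul_of_not hij
    have hc : P.conn i j :=
      orbits_le (u := P.conn) P.conn_ν (orbits_swap_mul_of_not hij)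
    rw [glue_eq_self hc, Obstruction.conn] at hcc
    classical
    let g : H := O.θ i * P.x * P.x'⁻¹ * (O.θ j)⁻¹
    let θ' : X → H := fun d => if orbits (O.φ * O.α) j d then g * O.θ d else O.θ d
    have hθ' : ∀ d, θ' (O.φ (O.α d)) = θ' d * O.κ d * O.p d ↔
        O.θ (O.φ (O.α d)) = O.θ d * O.κ d * O.p d := by
      intro d
      have h : orbits (O.φ * O.α) j (O.φ (O.α d)) ↔ orbits (O.φ * O.α) j d :=
        sameCycle_apply_right
      simp only [θ', h]
      split_ifs
      · simp only [mul_assoc, mul_right_inj]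
      · rfl
    let O' : Obstruction ψ R m X :=
      { O with
        θ := θ'
        bad := fun h => O.bad ((hθ' _).1 h)
        good := fun d hd hne => (hθ' d).2 (O.good d hd hne) }
    let P' : O'.Pinch i j :=
      ⟨P.l₁, P.l₂, P.x, P.y, P.x', P.y', P.face, P.κ_i, P.κ_j, P.bounds₁, P.bounds₂⟩
    refine P'.exists_size_lt_of_aligned ?_ ?_
    · have h1 : ¬ orbits (O.φ * O.α) j i := fun h => hij (Setoid.symm' _ h)
      have h2 : orbits (O.φ * O.α) j j := Setoid.refl' _ _
      change θ' i * P.x = θ' j * P.x'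
      simp only [θ', h1, h2, if_true, if_false, g]
      group
    · change O.α.support.card + 4 * numClasses P.conn ≤
        2 * (cyc O.φ + 1) + 2 * cyc (swap i j * (O.φ * O.α))
      omega

end Pinch

end Obstruction

end Relative

namespace Relative

open HNNExtension Equiv Equiv.Perm CycleCount

theorem eq_of_sup_orbits {X : Type*} [Finite X] {f g : Perm X} {e d : X} (hf : f e = e)
    (hg : g e = e) (h : (orbits f ⊔ orbits g) e d) : d = e := by
  have key : orbits f ⊔ orbits g ≤ Setoid.ker (fun x => x = e) := by
    refine sup_le (orbits_le fun x => ?_) (orbits_le fun x => ?_)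
    · refine Setoid.ker_def.2 (propext ⟨fun h => by rw [h, hf], fun h => f.injective (h.trans hf.symm)⟩)
    · refine Setoid.ker_def.2 (propext ⟨fun h => by rw [h, hg], fun h => g.injective (h.trans hg.symm)⟩)
  have := Setoid.ker_def.1 (key h)
  simpa using this

theorem rel_swap_apply {X : Type*} [DecidableEq X] {u : Setoid X} {i j : X} (h : u i j) (x : X) :
    u x (swap i j x) := by
  by_cases h1 : x = i
  · rw [h1, swap_apply_left]; exact h
  by_cases h2 : x = j
  · rw [h2, swap_apply_right]; exact Setoid.symm' _ h
  rw [swap_apply_of_ne_of_ne h1 h2]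

variable {H : Type*} [Group H] {A B : Subgroup H}

namespace Obstruction

variable {ψ : A ≃* B} {R : Relator A B} {m : ℕ} {X : Type} [Fintype X] [DecidableEq X]
  (O : Obstruction ψ R m X)

/-- An edge with trivial label between two different faces whose union is a boundary word. -/
structure Deletion (e a e' a' : X) where
  /-- the rest of the first face -/
  l₁ : List X
  /-- the rest of the second face -/
  l₂ : List X
  α_e : O.α e = e'
  face₁ : IsFace O.φ (e :: a :: l₁)
  face₂ : IsFace O.φ (e' :: a' :: l₂)
  not_orbits : ¬ orbits O.φ e e'
  p_e : O.p e = 1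
  bounds : Bounds ψ R m (((O.κ e' * O.κ a, O.ε a) :: l₁.map O.lab) ++
    ((O.κ e * O.κ a', O.ε a') :: l₂.map O.lab))

variable {O}

namespace Deletion

variable {e a e' a' : X} (D : O.Deletion e a e' a')

include D

theorem φ_e : O.φ e = a := by
  have := (isFace_cons.1 D.face₁).2
  simp at this
  exact this.1

theorem φ_e' : O.φ e' = a' := by
  have := (isFace_cons.1 D.face₂).2
  simp at this
  exact this.1

theorem α_e' : O.α e' = e := by rw [← D.α_e, O.inv]

theorem not_orbits_of_mem {x y : X} (hx : x ∈ e :: a :: D.l₁) (hy : y ∈ e' :: a' :: D.l₂) :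
    ¬ orbits O.φ x y := fun h =>
  D.not_orbits (Setoid.trans' _ (D.face₁.orbits_of_mem (by simp) hx)
    (Setoid.trans' _ h (D.face₂.orbits_of_mem hy (by simp))))

theorem ne_of_mem {x y : X} (hx : x ∈ e :: a :: D.l₁) (hy : y ∈ e' :: a' :: D.l₂) : x ≠ y := by
  rintro rfl
  exact D.not_orbits_of_mem hx hy (Setoid.refl' _ _)

theorem e_ne_e' : e ≠ e' := D.ne_of_mem (by simp) (by simp)

theorem e_ne_a' : e ≠ a' := D.ne_of_mem (by simp) (by simp)

theorem a_ne_e' : a ≠ e' := D.ne_of_mem (by simp) (by simp)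

theorem a_ne_a' : a ≠ a' := D.ne_of_mem (by simp) (by simp)

theorem e_ne_a : e ≠ a := by
  have := D.face₁.1
  grind

theorem e'_ne_a' : e' ≠ a' := by
  have := D.face₂.1
  grind

theorem live_e : O.α e ≠ e := by rw [D.α_e]; exact D.e_ne_e'.symm

theorem live_e' : O.α e' ≠ e' := by rw [D.α_e']; exact D.e_ne_e'

theorem live_a : O.α a ≠ a := by
  refine O.live_of_φ_ne fun h => D.e_ne_a ?_
  exact orbits_eq_of_fixed (D.face₁.orbits_of_mem (by simp) (by simp)) h

theorem live_a' : O.α a' ≠ a' := by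
  refine O.live_of_φ_ne fun h => D.e'_ne_a' ?_
  exact orbits_eq_of_fixed (D.face₂.orbits_of_mem (by simp) (by simp)) h

theorem p_e' : O.p e' = 1 := by
  have h := O.p_α e D.live_e
  rw [D.α_e, D.p_e] at h
  exact of_injective ψ (h.trans (by simp))

/-- The modification of the permutations around the deleted edge. -/
def bypass (_ : O.Deletion e a e' a') : Perm X := swap e' a * swap e a' * swap a' a

theorem bypass_e : D.bypass e = a' := by
  simp only [bypass, Perm.mul_apply]
  rw [swap_apply_of_ne_of_ne D.e_ne_a' D.e_ne_a, swap_apply_left,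
    swap_apply_of_ne_of_ne D.e'_ne_a'.symm D.a_ne_a'.symm]

theorem bypass_e' : D.bypass e' = a := by
  simp only [bypass, Perm.mul_apply]
  rw [swap_apply_of_ne_of_ne D.e'_ne_a' D.a_ne_e'.symm,
    swap_apply_of_ne_of_ne D.e_ne_e'.symm D.e'_ne_a', swap_apply_left]

theorem bypass_a : D.bypass a = e := by
  simp only [bypass, Perm.mul_apply]
  rw [swap_apply_right, swap_apply_right, swap_apply_of_ne_of_ne D.e_ne_e' D.e_ne_a]

theorem bypass_a' : D.bypass a' = e' := by
  simp only [bypass, Perm.mul_apply]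
  rw [swap_apply_left, swap_apply_of_ne_of_ne D.e_ne_a.symm D.a_ne_a', swap_apply_right]

theorem bypass_of_ne {x : X} (h1 : x ≠ e) (h2 : x ≠ e') (h3 : x ≠ a) (h4 : x ≠ a') :
    D.bypass x = x := by
  simp only [bypass, Perm.mul_apply]
  rw [swap_apply_of_ne_of_ne h4 h3, swap_apply_of_ne_of_ne h1 h4, swap_apply_of_ne_of_ne h2 h3]

theorem isFace : IsFace (D.bypass * O.φ) ((a :: D.l₁) ++ (a' :: D.l₂)) := by
  obtain ⟨n1, m1⟩ := isFace_cons.1 D.face₁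
  obtain ⟨n2, m2⟩ := isFace_cons.1 D.face₂
  have hdisj := fun x (hx : x ∈ e :: a :: D.l₁) y (hy : y ∈ e' :: a' :: D.l₂) => D.ne_of_mem hx hy
  have fix₁ : ∀ x ∈ D.l₁, D.bypass x = x := fun x hx => D.bypass_of_ne
    (by rintro rfl; grind) (by grind) (by rintro rfl; grind) (by grind)
  have fix₂ : ∀ x ∈ D.l₂, D.bypass x = x := fun x hx => D.bypass_of_ne
    (by grind) (by rintro rfl; grind) (by grind) (by rintro rfl; grind)
  rw [List.cons_append, isFace_cons]
  constructor
  · rw [← List.cons_append, List.nodup_append]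
    exact ⟨(List.nodup_cons.1 n1).2, (List.nodup_cons.1 n2).2, fun x hx y hy =>
      hdisj x (List.mem_cons_of_mem _ hx) y (List.mem_cons_of_mem _ hy)⟩
  · rw [List.map_cons] at m1 m2
    have m1' : (a :: D.l₁).map O.φ = D.l₁ ++ [e] := by simpa using (List.cons.inj m1).2
    have m2' : (a' :: D.l₂).map O.φ = D.l₂ ++ [e'] := by simpa using (List.cons.inj m2).2
    rw [← List.cons_append, Perm.coe_mul, ← List.map_map, List.map_append, m1', m2']
    simp [D.bypass_e, D.bypass_e', List.map_congr_left fix₁, List.map_congr_left fix₂]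

/-- The new corner labels. -/
def κ (_ : O.Deletion e a e' a') (d : X) : H :=
  if d = a then O.κ e' * O.κ a else if d = a' then O.κ e * O.κ a' else O.κ d

/-- The new potential. -/
def θ (_ : O.Deletion e a e' a') (d : X) : H :=
  if d = a then O.θ e' else if d = a' then O.θ e else O.θ d

theorem exists_face {d : X} (hd : O.α d ≠ d) (hde : d ≠ e) (hde' : d ≠ e') :
    ∃ l, IsFace (D.bypass * O.φ) l ∧ d ∈ l ∧ Bounds ψ R m (l.map fun x => (D.κ x, O.ε x)) := by
  obtain ⟨n1, m1⟩ := isFace_cons.1 D.face₁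
  obtain ⟨n2, m2⟩ := isFace_cons.1 D.face₂
  have hdisj := fun x (hx : x ∈ e :: a :: D.l₁) y (hy : y ∈ e' :: a' :: D.l₂) => D.ne_of_mem hx hy
  by_cases h : d ∈ (a :: D.l₁) ++ (a' :: D.l₂)
  · refine ⟨_, D.isFace, h, ?_⟩
    convert D.bounds using 1
    rw [List.map_append, List.map_cons, List.map_cons]
    have h1 : ∀ x ∈ D.l₁, (D.κ x, O.ε x) = O.lab x := fun x hx => by
      have : x ≠ a := by rintro rfl; grind
      have : x ≠ a' := by grind
      simp [κ, lab, *]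
    have h2 : ∀ x ∈ D.l₂, (D.κ x, O.ε x) = O.lab x := fun x hx => by
      have : x ≠ a' := by rintro rfl; grind
      have : x ≠ a := by grind
      simp [κ, lab, *]
    rw [List.map_congr_left h1, List.map_congr_left h2]
    simp [κ, D.a_ne_a'.symm]
  · obtain ⟨l, hl, hdl, hb⟩ := O.face d hd
    have h₁ : ∀ x ∈ l, x ∉ e :: a :: D.l₁ := fun x hx hx' => by
      have := D.face₁.mem_of_orbits hx' (hl.orbits_of_mem hx hdl)
      grind
    have h₂ : ∀ x ∈ l, x ∉ e' :: a' :: D.l₂ := fun x hx hx' => by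
      have := D.face₂.mem_of_orbits hx' (hl.orbits_of_mem hx hdl)
      grind
    refine ⟨l, hl.congr fun x hx => ?_, hdl, ?_⟩
    · have h₁ := h₁ _ (hl.apply_mem hx)
      have h₂ := h₂ _ (hl.apply_mem hx)
      simp only [List.mem_cons, not_or] at h₁ h₂
      exact D.bypass_of_ne h₁.1 h₂.1 h₁.2.1 h₂.2.1
    · rwa [List.map_congr_left (g := fun x => (O.κ x, O.ε x))]
      intro x hx
      have h₁ := h₁ _ hx
      have h₂ := h₂ _ hx
      simp only [List.mem_cons, not_or] at h₁ h₂
      simp [κ, h₁.2.1, h₂.2.1]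

theorem cyc_φ : cyc (D.bypass * O.φ) = cyc O.φ + 1 := by
  have h1 : ¬ orbits O.φ a' a := fun h => D.not_orbits_of_mem (by simp) (by simp) (Setoid.symm' _ h)
  have e1 := cyc_swap_mul_of_not h1
  have h2 : orbits (swap a' a * O.φ) e a' := by
    have := orbits_step (swap a' a * O.φ) e
    rwa [Perm.mul_apply, D.φ_e, swap_apply_right] at this
  have e2 := cyc_swap_mul D.e_ne_a' h2
  have h3 : orbits (swap e a' * (swap a' a * O.φ)) e' a := by
    have := orbits_step (swap e a' * (swap a' a * O.φ)) e'
    rwa [Perm.mul_apply, Perm.mul_apply, D.φ_e', swap_apply_left,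
      swap_apply_of_ne_of_ne D.e_ne_a.symm D.a_ne_a'] at this
  have e3 := cyc_swap_mul D.a_ne_e'.symm h3
  rw [bypass, mul_assoc, mul_assoc, e3]
  omega

theorem ν_eq : D.bypass * O.φ * (swap e e' * O.α) = swap e' a * (swap e a' * (O.φ * O.α)) := by
  have h : O.φ * swap e e' = swap a' a * O.φ := by
    rw [← D.φ_e, ← D.φ_e', swap_comm, Equiv.mul_swap_eq_swap_mul]
  calc D.bypass * O.φ * (swap e e' * O.α) = D.bypass * (O.φ * swap e e') * O.α := by
        simp only [mul_assoc]
    _ = _ := by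
        rw [h, bypass]
        simp only [mul_assoc, swap_mul_self_mul]

theorem cyc_ν : cyc (D.bypass * O.φ * (swap e e' * O.α)) = cyc (O.φ * O.α) + 2 := by
  rw [D.ν_eq]
  have h1 : orbits (O.φ * O.α) e a' := by
    have := orbits_step (O.φ * O.α) e
    rwa [Perm.mul_apply, D.α_e, D.φ_e'] at this
  have e1 := cyc_swap_mul D.e_ne_a' h1
  have h2 : orbits (swap e a' * (O.φ * O.α)) e' a := by
    have := orbits_step (swap e a' * (O.φ * O.α)) e'
    rwa [Perm.mul_apply, Perm.mul_apply, D.α_e', D.φ_e,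
      swap_apply_of_ne_of_ne D.e_ne_a.symm D.a_ne_a'] at this
  rw [cyc_swap_mul D.a_ne_e'.symm h2, e1]

theorem α_apply_ne {d : X} (h1 : d ≠ e) (h2 : d ≠ e') : (swap e e' * O.α) d = O.α d := by
  refine swap_apply_of_ne_of_ne (fun h => h2 ?_) (fun h => h1 ?_)
  · rw [← D.α_e, ← h, O.inv]
  · rw [← D.α_e', ← h, O.inv]

theorem α_apply_e : (swap e e' * O.α) e = e := by
  rw [Perm.mul_apply, D.α_e, swap_apply_right]

theorem α_apply_e' : (swap e e' * O.α) e' = e' := by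
  rw [Perm.mul_apply, D.α_e', swap_apply_left]

theorem φ_apply_e : (D.bypass * O.φ) e = e := by
  rw [Perm.mul_apply, D.φ_e, D.bypass_a]

theorem φ_apply_e' : (D.bypass * O.φ) e' = e' := by
  rw [Perm.mul_apply, D.φ_e', D.bypass_a']

theorem live_iff {d : X} : (swap e e' * O.α) d ≠ d ↔ O.α d ≠ d ∧ d ≠ e ∧ d ≠ e' := by
  by_cases h1 : d = e
  · subst h1; simp only [D.α_apply_e]; simp
  by_cases h2 : d = e'
  · subst h2; simp only [D.α_apply_e']; simp
  rw [D.α_apply_ne h1 h2]; tauto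

theorem card_support : (swap e e' * O.α).support.card + 2 = O.α.support.card := by
  have h : O.α.support = insert e (insert e' (swap e e' * O.α).support) := by
    ext d
    have := D.live_e
    have := D.live_e'
    rw [Finset.mem_insert, Finset.mem_insert, Perm.mem_support, Perm.mem_support, D.live_iff]
    by_cases h1 : d = e
    · simp_all
    by_cases h2 : d = e'
    · simp_all
    simp_all
  rw [h, Finset.card_insert_of_notMem, Finset.card_insert_of_notMem]
  · rw [Perm.mem_support, D.live_iff]; tauto
  · have := D.e_ne_e'
    rw [Finset.mem_insert, Perm.mem_support, D.live_iff]; tauto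

theorem conn_e_a : O.conn e a := D.φ_e ▸ O.conn_φ e

theorem conn_e'_a' : O.conn e' a' := D.φ_e' ▸ O.conn_φ e'

theorem conn_e_e' : O.conn e e' := D.α_e ▸ O.conn_α e

theorem conn_le : orbits (D.bypass * O.φ) ⊔ orbits (swap e e' * O.α) ≤ O.conn := by
  have h1 := D.conn_e_a
  have h2 := D.conn_e'_a'
  have h3 := D.conn_e_e'
  have h4 : O.conn e' a := Setoid.trans' _ (Setoid.symm' _ h3) h1
  have h5 : O.conn e a' := Setoid.trans' _ h3 h2
  have h6 : O.conn a' a := Setoid.trans' _ (Setoid.symm' _ h5) h1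
  refine sup_le (orbits_le fun x => ?_) (orbits_le fun x => ?_)
  · exact Setoid.trans' _ (O.conn_φ x) (Setoid.trans' _ (rel_swap_apply h6 _)
      (Setoid.trans' _ (rel_swap_apply h5 _) (rel_swap_apply h4 _)))
  · exact Setoid.trans' _ (O.conn_α x) (rel_swap_apply h3 _)

theorem numClasses_le :
    numClasses (orbits (D.bypass * O.φ) ⊔ orbits (swap e e' * O.α)) ≤ numClasses O.conn + 2 := by
  set s := orbits (D.bypass * O.φ) ⊔ orbits (swap e e' * O.α) with hs
  have h1 := numClasses_le_glue_add_one s e a'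
  have h2 := numClasses_le_glue_add_one (glue s e a') e' a
  set u := glue (glue s e a') e' a with hu
  have hsu : s ≤ u := (le_glue _ _ _).trans (le_glue _ _ _)
  have h4 : u e' a := glue_rel _ _ _
  have h5 : u e a' := le_glue _ _ _ (glue_rel _ _ _)
  have h6 : u a' a := hsu ((le_sup_left : orbits (D.bypass * O.φ) ≤ s)
    (D.isFace.orbits_of_mem (by simp) (by simp)))
  have h3 : u e e' := Setoid.trans' _ h5 (Setoid.trans' _ h6 (Setoid.symm' _ h4))
  have : O.conn ≤ u := by
    refine O.conn_le (fun x => ?_) fun x => ?_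
    · have : u x ((D.bypass * O.φ) x) := hsu ((le_sup_left : orbits (D.bypass * O.φ) ≤ s)
        (orbits_step _ _))
      refine Setoid.trans' _ this (Setoid.symm' _ ?_)
      exact (Setoid.trans' _ (rel_swap_apply h6 _)
        (Setoid.trans' _ (rel_swap_apply h5 _) (rel_swap_apply h4 _)))
    · have : u x ((swap e e' * O.α) x) := hsu ((le_sup_right : orbits (swap e e' * O.α) ≤ s)
        (orbits_step _ _))
      exact Setoid.trans' _ this (Setoid.symm' _ (rel_swap_apply h3 _))
  have := numClasses_anti this
  omega

theorem θ_ν {d : X} (h1 : d ≠ e) (h2 : d ≠ e') :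
    D.θ ((D.bypass * O.φ) ((swap e e' * O.α) d)) = O.θ (O.φ (O.α d)) := by
  rw [D.α_apply_ne h1 h2, Perm.mul_apply]
  have h3 : O.φ (O.α d) ≠ a := by
    rw [← D.φ_e, ← D.α_e', O.φ.injective.ne_iff, O.α.injective.ne_iff]
    exact h2
  have h4 : O.φ (O.α d) ≠ a' := by
    rw [← D.φ_e', ← D.α_e, O.φ.injective.ne_iff, O.α.injective.ne_iff]
    exact h1
  by_cases h5 : O.φ (O.α d) = e
  · rw [h5, D.bypass_e]
    simp [θ, D.a_ne_a'.symm]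
  by_cases h6 : O.φ (O.α d) = e'
  · rw [h6, D.bypass_e']
    simp [θ]
  rw [D.bypass_of_ne h5 h6 h3 h4]
  simp [θ, h3, h4]

theorem θ_κ (hconn : O.conn O.x₀ e) {d : X} (h1 : d = a → O.x₀ ≠ e') (h2 : d = a' → O.x₀ ≠ e) :
    D.θ d * D.κ d = O.θ d * O.κ d := by
  by_cases ha : d = a
  · have := O.good e' (Setoid.trans' _ hconn D.conn_e_e') (h1 ha).symm
    rw [D.α_e', D.φ_e, D.p_e', mul_one] at this
    simp [θ, κ, ha, this, mul_assoc]
  by_cases ha' : d = a'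
  · have := O.good e hconn (h2 ha').symm
    rw [D.α_e, D.φ_e', D.p_e, mul_one] at this
    simp [θ, κ, ha', this, D.a_ne_a'.symm, mul_assoc]
  simp [θ, κ, ha, ha']

theorem exists_size_lt_aux (hconn : O.conn O.x₀ e) {x₁ : X} (hx₁ : O.α x₁ ≠ x₁) (h1 : x₁ ≠ e)
    (h2 : x₁ ≠ e') (hx₀ : O.conn O.x₀ x₁)
    (bad : O.θ (O.φ (O.α x₁)) ≠ D.θ x₁ * D.κ x₁ * O.p x₁)
    (good : ∀ d, O.conn O.x₀ d → d ≠ x₁ → d ≠ e → d ≠ e' →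
      O.θ (O.φ (O.α d)) = D.θ d * D.κ d * O.p d) :
    ∃ O' : Obstruction ψ R m X, O'.size < O.size := by
  have hN : cyc (D.bypass * O.φ) ≤ Nat.card X := by
    rw [← numClasses_bot]
    exact numClasses_anti bot_le
  have hF := D.cyc_φ
  have hS := D.card_support
  refine ⟨{ O with
    φ := D.bypass * O.φ
    α := swap e e' * O.α
    κ := D.κ
    θ := D.θ
    x₀ := x₁
    inv := fun d => ?_
    dead := fun d hd => ?_
    ε_α := fun d hd => ?_
    p_mem := fun d hd => O.p_mem d (D.live_iff.1 hd).1
    p_α := fun d hd => ?_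
    face := fun d hd => ?_
    planar := ?_
    live := D.live_iff.2 ⟨hx₁, h1, h2⟩
    bad := ?_
    good := fun d hd hne => ?_ }, ?_⟩
  · by_cases h1 : d = e
    · rw [h1, D.α_apply_e, D.α_apply_e]
    by_cases h2 : d = e'
    · rw [h2, D.α_apply_e', D.α_apply_e']
    rw [D.α_apply_ne h1 h2, D.α_apply_ne, O.inv]
    · intro h
      exact h2 (by rw [← D.α_e, ← h, O.inv])
    · intro h
      exact h1 (by rw [← D.α_e', ← h, O.inv])
  · by_cases h1 : d = e
    · rw [h1, D.φ_apply_e]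
    by_cases h2 : d = e'
    · rw [h2, D.φ_apply_e']
    rw [D.α_apply_ne h1 h2] at hd
    rw [Perm.mul_apply, O.dead d hd]
    refine D.bypass_of_ne h1 h2 ?_ ?_
    · rintro rfl; exact D.live_a hd
    · rintro rfl; exact D.live_a' hd
  · obtain ⟨hd, h1, h2⟩ := D.live_iff.1 hd
    rw [D.α_apply_ne h1 h2]
    exact O.ε_α d hd
  · obtain ⟨hd, h1, h2⟩ := D.live_iff.1 hd
    rw [D.α_apply_ne h1 h2]
    exact O.p_α d hd
  · obtain ⟨hd, h1, h2⟩ := D.live_iff.1 hd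
    exact D.exists_face hd h1 h2
  · have h1 := D.numClasses_le
    have h2 := O.planar
    rw [conn] at h1
    rw [hF, D.cyc_ν]
    omega
  · rw [D.θ_ν h1 h2]
    exact bad
  · have h3 : d ≠ e := by
      rintro rfl
      exact h1 (eq_of_sup_orbits D.φ_apply_e D.α_apply_e (Setoid.symm' _ hd))
    have h4 : d ≠ e' := by
      rintro rfl
      exact h2 (eq_of_sup_orbits D.φ_apply_e' D.α_apply_e' (Setoid.symm' _ hd))
    rw [D.θ_ν h3 h4]
    exact good d (Setoid.trans' _ hx₀ (D.conn_le hd)) hne h3 h4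
  · simp only [size]
    omega

theorem exists_size_lt (hconn : O.conn O.x₀ e) :
    ∃ O' : Obstruction ψ R m X, O'.size < O.size := by
  have c1 : O.conn O.x₀ a := Setoid.trans' _ hconn D.conn_e_a
  have c2 : O.conn O.x₀ e' := Setoid.trans' _ hconn D.conn_e_e'
  have c3 : O.conn O.x₀ a' := Setoid.trans' _ c2 D.conn_e'_a'
  have hee := D.e_ne_e'
  by_cases he : O.x₀ = e
  · refine D.exists_size_lt_aux hconn D.live_a' D.e_ne_a'.symm D.e'_ne_a'.symm c3 ?_ ?_
    · rw [O.good a' c3 (he ▸ D.e_ne_a'.symm)]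
      have hbad := O.bad
      rw [he, D.α_e, D.φ_e', D.p_e, mul_one] at hbad
      simp only [θ, κ, D.a_ne_a'.symm, if_true, if_false, ← mul_assoc]
      simpa using hbad
    · intro d hd h1 h2 h3
      rw [D.θ_κ hconn (fun _ => he ▸ hee) (fun h => absurd h h1)]
      exact O.good d hd (he ▸ h2)
  by_cases he' : O.x₀ = e'
  · refine D.exists_size_lt_aux hconn D.live_a D.e_ne_a.symm D.a_ne_e' c1 ?_ ?_
    · rw [O.good a c1 (he' ▸ D.a_ne_e')]
      have hbad := O.bad
      rw [he', D.α_e', D.φ_e, D.p_e', mul_one] at hbad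
      simp only [θ, κ, if_true, ← mul_assoc]
      simpa using hbad
    · intro d hd h1 h2 h3
      rw [D.θ_κ hconn (fun h => absurd h h1) (fun _ => he)]
      exact O.good d hd (he' ▸ h3)
  · refine D.exists_size_lt_aux hconn O.live he he' (Setoid.refl' _ _) ?_ ?_
    · rw [D.θ_κ hconn (fun _ => he') (fun _ => he)]
      exact O.bad
    · intro d hd h1 _ _
      rw [D.θ_κ hconn (fun _ => he') (fun _ => he)]
      exact O.good d hd h1

end Deletion

end Obstruction

end Relative

namespace Relative

open HNNExtension Equiv Equiv.Perm CycleCount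

variable {H : Type*} [Group H] {A B : Subgroup H}

namespace Obstruction

variable {ψ : A ≃* B} {R : Relator A B} {m : ℕ} {X : Type} [Fintype X] [DecidableEq X]
  (O : Obstruction ψ R m X)

theorem exists_face_cons (hm : 2 ≤ m) {d : X} (hd : O.α d ≠ d) :
    ∃ a l, IsFace O.φ (d :: a :: l) ∧ Bounds ψ R m ((d :: a :: l).map O.lab) := by
  obtain ⟨l, hl, hdl, hb⟩ := O.face d hd
  obtain ⟨l₁, l₂, rfl⟩ := List.append_of_mem hdl
  have hb' : Bounds ψ R m ((d :: l₂ ++ l₁).map O.lab) := by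
    rw [List.map_append]
    apply Bounds.rot
    rwa [← List.map_append]
  have hl' := hl.append_comm
  have := hb'.two_le_length hm
  rcases h : l₂ ++ l₁ with _ | ⟨a, l⟩
  · simp [h] at this
  · rw [List.cons_append, h] at hb' hl'
    exact ⟨a, l, hl', hb'⟩

/-- A face with two sides bounding a trivial word. -/
structure Digon (d d' : X) where
  /-- the exponent -/
  u : ℤˣ
  /-- the corner -/
  g : toSubgroup A B u
  face : IsFace O.φ [d, d']
  κ_d : O.κ d = (toSubgroupEquiv ψ u g : H)⁻¹
  ε_d : O.ε d = u
  κ_d' : O.κ d' = g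
  ε_d' : O.ε d' = -u

variable {O}

namespace Digon

variable {d d' : X} (D : O.Digon d d')

include D

theorem φ_d : O.φ d = d' := by
  have := (isFace_cons.1 D.face).2
  simp at this
  exact this.1

theorem φ_d' : O.φ d' = d := by
  have := (isFace_cons.1 D.face).2
  simp at this
  exact this.2

theorem ne : d ≠ d' := by
  have := D.face.1
  simpa using this

theorem live_d : O.α d ≠ d := O.live_of_φ_ne (by rw [D.φ_d]; exact D.ne.symm)

theorem live_d' : O.α d' ≠ d' := O.live_of_φ_ne (by rw [D.φ_d']; exact D.ne)

theorem of_κ_d : (of (O.κ d) : HNNExtension H A B ψ) =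
    t ^ (D.u : ℤ) * (of (O.κ d'))⁻¹ * t ^ (-D.u : ℤ) := by
  rw [D.κ_d, D.κ_d', map_inv, of_toSubgroupEquiv]
  simp only [mul_inv_rev, zpow_neg, inv_inv, mul_assoc]

theorem of_κ_d' : (of (O.κ d') : HNNExtension H A B ψ) =
    t ^ (-D.u : ℤ) * (of (O.κ d))⁻¹ * t ^ (D.u : ℤ) := by
  rw [D.of_κ_d]
  simp only [zpow_neg]
  group

theorem p_α_d : (of (O.p (O.α d)) : HNNExtension H A B ψ) =
    t ^ (-D.u : ℤ) * (of (O.p d))⁻¹ * t ^ (D.u : ℤ) := by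
  rw [O.p_α d D.live_d, D.ε_d]

theorem p_α_d' : (of (O.p (O.α d')) : HNNExtension H A B ψ) =
    t ^ (D.u : ℤ) * (of (O.p d'))⁻¹ * t ^ (-D.u : ℤ) := by
  rw [O.p_α d' D.live_d', D.ε_d']
  simp

theorem κ_d_mem : O.κ d ∈ toSubgroup A B (-D.u) := by
  rw [D.κ_d]; exact inv_mem (SetLike.coe_mem _)

theorem κ_d'_mem : O.κ d' ∈ toSubgroup A B D.u := by
  rw [D.κ_d']; exact SetLike.coe_mem _

theorem not_α (hconn : ∀ x, O.α x ≠ x → O.conn O.x₀ x) : O.α d ≠ d' := by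
  intro h
  have h' : O.α d' = d := by rw [← h, O.inv]
  have hle : O.conn ≤ Setoid.ker (fun x => x = d ∨ x = d') := by
    have h1 := D.φ_d
    have h2 := D.φ_d'
    have i1 := O.φ.injective
    have i2 := O.α.injective
    refine O.conn_le (fun x => Setoid.ker_def.2 (propext ?_))
      fun x => Setoid.ker_def.2 (propext ?_)
    · constructor
      · rintro (rfl | rfl) <;> simp [h1, h2]
      · rintro (h | h)
        · exact Or.inr (i1 (h.trans h2.symm))
        · exact Or.inl (i1 (h.trans h1.symm))
    · constructor
      · rintro (rfl | rfl) <;> simp [*]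
      · rintro (h'' | h'')
        · exact Or.inr (i2 (h''.trans h'.symm))
        · exact Or.inl (i2 (h''.trans h.symm))
  have h₀ : O.x₀ = d ∨ O.x₀ = d' := by
    have := Setoid.ker_def.1 (hle (hconn d D.live_d))
    simpa using this
  have cd := hconn d D.live_d
  have cd' := hconn d' D.live_d'
  have hp := D.p_α_d
  rw [congrArg O.p h] at hp
  have key : O.κ d * O.p d = 1 ↔ O.κ d' * O.p d' = 1 := by
    rw [← (of_injective ψ).eq_iff (a := O.κ d * O.p d),
      ← (of_injective ψ).eq_iff (a := O.κ d' * O.p d'), map_mul, map_mul, D.of_κ_d', hp,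
      map_one, zpow_neg]
    constructor
    · intro hk
      rw [mul_eq_one_iff_eq_inv] at hk
      rw [hk]
      group
    · intro hk
      have : (of (O.κ d))⁻¹ * (of (O.p d))⁻¹ = (1 : HNNExtension H A B ψ) := by
        have := congrArg (fun z => t ^ (D.u : ℤ) * z * (t ^ (D.u : ℤ))⁻¹) hk
        simpa only [mul_assoc, mul_inv_cancel_left, inv_mul_cancel_left, mul_inv_cancel, mul_one]
          using this
      rw [← mul_inv_rev, inv_eq_one, mul_eq_one_iff_eq_inv] at this
      rw [this, mul_inv_cancel]
  have e1 : O.θ (O.φ (O.α d)) = O.θ d * O.κ d * O.p d ↔ O.κ d * O.p d = 1 := by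
    rw [h, D.φ_d', mul_assoc, left_eq_mul]
  have e2 : O.θ (O.φ (O.α d')) = O.θ d' * O.κ d' * O.p d' ↔ O.κ d' * O.p d' = 1 := by
    rw [h', D.φ_d, mul_assoc, left_eq_mul]
  rcases h₀ with h₀ | h₀
  · exact O.bad (by
      rw [h₀, e1, key, ← e2]
      exact O.good d' cd' (h₀ ▸ D.ne.symm))
  · exact O.bad (by
      rw [h₀, e2, ← key, ← e1]
      exact O.good d cd (h₀ ▸ D.ne))

/-- The new corner labels. -/
def κ (_ : O.Digon d d') (x : X) : H := if x = d ∨ x = d' then 1 else O.κ x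

/-- The new potential. -/
def θ (_ : O.Digon d d') (x : X) : H :=
  if x = d then O.θ d * (O.p (O.α d'))⁻¹
  else if x = d' then O.θ d' * O.κ d' * O.p d'
  else O.θ x

/-- The new edge labels. -/
def p (_ : O.Digon d d') (x : X) : H :=
  if x = d' ∨ x = O.α d' then 1
  else if x = d then O.p (O.α d') * O.κ d * O.p d
  else if x = O.α d then O.p (O.α d) * O.κ d' * O.p d'
  else O.p x

theorem status (h : O.α d ≠ d') (x : X) :
    D.θ (O.φ (O.α x)) = D.θ x * D.κ x * D.p x ↔ O.θ (O.φ (O.α x)) = O.θ x * O.κ x * O.p x := by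
  have h' : O.α d' ≠ d := fun h' => h (by rw [← h', O.inv])
  have hd := D.live_d
  have hd' := D.live_d'
  have hne := D.ne
  have hνd : O.φ (O.α x) = d ↔ x = O.α d' := by
    rw [← D.φ_d', O.φ.injective.eq_iff]
    exact ⟨fun h => by rw [← h, O.inv], fun h => by rw [h, O.inv]⟩
  have hνd' : O.φ (O.α x) = d' ↔ x = O.α d := by
    rw [← D.φ_d, O.φ.injective.eq_iff]
    exact ⟨fun h => by rw [← h, O.inv], fun h => by rw [h, O.inv]⟩
  have hαα : O.α d ≠ O.α d' := fun h => hne (O.α.injective h)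
  by_cases h1 : x = d
  · have e1 : O.φ (O.α x) ≠ d := by rw [Ne, hνd, h1]; exact h'.symm
    have e2 : O.φ (O.α x) ≠ d' := by rw [Ne, hνd', h1]; exact hd.symm
    subst h1
    simp [θ, κ, p, e1, e2, hne, h'.symm, mul_assoc]
  by_cases h2 : x = d'
  · have e1 : O.φ (O.α x) ≠ d := by rw [Ne, hνd, h2]; exact hd'.symm
    have e2 : O.φ (O.α x) ≠ d' := by rw [Ne, hνd', h2]; exact h.symm
    subst h2
    simp [θ, κ, p, e1, e2, hne.symm]
  by_cases h3 : x = O.α d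
  · have e2 : O.φ (O.α x) = d' := hνd'.2 h3
    rw [e2]
    subst h3
    simp [θ, κ, p, hd, h, hαα, hne.symm, ← mul_assoc]
  by_cases h4 : x = O.α d'
  · have e1 : O.φ (O.α x) = d := hνd.2 h4
    rw [e1]
    subst h4
    simp [θ, κ, p, hd', h', mul_inv_eq_iff_eq_mul]
  · have e1 : O.φ (O.α x) ≠ d := by rwa [Ne, hνd]
    have e2 : O.φ (O.α x) ≠ d' := by rwa [Ne, hνd']
    simp [θ, κ, p, h1, h2, h3, h4, e1, e2]

theorem of_p_d (h : O.α d ≠ d') : (of (D.p (O.α d)) : HNNExtension H A B ψ) =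
    t ^ (-D.u : ℤ) * (of (D.p d))⁻¹ * t ^ (D.u : ℤ) := by
  have h' : O.α d' ≠ d := fun h' => h (by rw [← h', O.inv])
  have hαα : O.α d ≠ O.α d' := fun h => D.ne (O.α.injective h)
  have e1 : D.p (O.α d) = O.p (O.α d) * O.κ d' * O.p d' := by
    simp [p, h, hαα, D.live_d]
  have e2 : D.p d = O.p (O.α d') * O.κ d * O.p d := by
    simp [p, D.ne, h'.symm]
  rw [e1, e2]
  simp only [map_mul]
  rw [D.p_α_d, D.p_α_d', D.of_κ_d']
  simp only [zpow_neg]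
  group

/-- The obstruction in which one of the edges of the digon has trivial label. -/
def gauge (h : O.α d ≠ d') : Obstruction ψ R m X where
  φ := O.φ
  α := O.α
  ε := O.ε
  x₀ := O.x₀
  inv := O.inv
  dead := O.dead
  ε_α := O.ε_α
  planar := O.planar
  live := O.live
  κ := D.κ
  p := D.p
  θ := D.θ
  p_mem := fun x hx => by
    unfold p
    split_ifs with h1 h2 h3
    · exact one_mem _
    · have h1 := O.p_mem (O.α d') (by rw [O.inv]; exact D.live_d'.symm)
      have h2' := O.p_mem d D.live_d
      rw [O.ε_α _ D.live_d', D.ε_d', neg_neg] at h1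
      rw [D.ε_d] at h2'
      rw [h2, D.ε_d]
      exact mul_mem (mul_mem h1 D.κ_d_mem) h2'
    · have h1 := O.p_mem (O.α d) (by rw [O.inv]; exact D.live_d.symm)
      have h2' := O.p_mem d' D.live_d'
      rw [O.ε_α _ D.live_d, D.ε_d, neg_neg] at h1
      rw [D.ε_d', neg_neg] at h2'
      rw [h3, O.ε_α _ D.live_d, D.ε_d, neg_neg]
      exact mul_mem (mul_mem h1 D.κ_d'_mem) h2'
    · exact O.p_mem x hx
  p_α := fun x hx => by
    by_cases h1 : x = d
    · rw [h1, D.of_p_d h, D.ε_d]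
    by_cases h2 : x = O.α d
    · have := D.of_p_d h
      rw [h2, O.ε_α d D.live_d, O.inv, D.ε_d, this]
      simp only [zpow_neg, Units.val_neg, neg_neg]
      group
    by_cases h3 : x = d' ∨ x = O.α d'
    · have e1 : D.p x = 1 := by simp [p, h3]
      have e2 : D.p (O.α x) = 1 := by
        rcases h3 with rfl | rfl <;> simp [p, O.inv]
      rw [e1, e2]
      simp
    · have h3' : ¬ (O.α x = d' ∨ O.α x = O.α d') := by
        rw [O.α.injective.eq_iff]
        rintro (h | h)
        · exact h3 (Or.inr (by rw [← h, O.inv]))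
        · exact h3 (Or.inl h)
      have h2' : O.α x ≠ O.α d := fun h => h1 (O.α.injective h)
      have h1' : O.α x ≠ d := fun h => h2 (by rw [← h, O.inv])
      simp only [p, h1, h2, h3, h1', h2', h3', if_false]
      exact O.p_α x hx
  face := fun x hx => by
    by_cases h1 : x ∈ [d, d']
    · refine ⟨_, D.face, h1, ?_⟩
      have := Bounds.digon (ψ := ψ) (R := R) (m := m) D.u 1
      simpa [κ, D.ε_d, D.ε_d'] using this
    · obtain ⟨l, hl, hxl, hb⟩ := O.face x hx
      refine ⟨l, hl, hxl, ?_⟩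
      rwa [List.map_congr_left (g := fun x => (O.κ x, O.ε x))]
      intro y hy
      have : ¬ (y = d ∨ y = d') := fun h' =>
        h1 (D.face.mem_of_orbits (by simpa using h') (hl.orbits_of_mem hy hxl))
      simp [κ, this]
  bad := fun h' => O.bad ((D.status h _).1 h')
  good := fun x hx hne => (D.status h x).2 (O.good x hx hne)

theorem exists_size_lt (hm : 2 ≤ m) (hconn : ∀ x, O.α x ≠ x → O.conn O.x₀ x) :
    ∃ O' : Obstruction ψ R m X, O'.size < O.size := by
  have h := D.not_α hconn
  have h' : O.α d' ≠ d := fun h' => h (by rw [← h', O.inv])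
  obtain ⟨a', l, hl, hb⟩ := (D.gauge h).exists_face_cons hm (d := O.α d')
    (by change O.α _ ≠ _; rw [O.inv]; exact D.live_d'.symm)
  have hε : O.ε (O.α d') = O.ε d := by
    rw [O.ε_α _ D.live_d', D.ε_d', neg_neg, D.ε_d]
  refine Deletion.exists_size_lt (O := D.gauge h) (e := d') (e' := O.α d') (a := d) (a' := a')
    ⟨[], l, rfl, D.face.append_comm (l := [d]), hl, fun hn => ?_, ?_, ?_⟩ (hconn d' D.live_d')
  · have := (D.face.append_comm (l := [d])).mem_of_orbits (by simp) hn
    simp [D.live_d', h'] at this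
  · change D.p d' = 1
    simp [p]
  · have e1 : D.κ d = 1 := by simp [κ]
    have e2 : D.κ d' = 1 := by simp [κ]
    change Bounds ψ R m (((D.κ (O.α d') * D.κ d, O.ε d) :: _) ++
      ((D.κ d' * D.κ a', O.ε a') :: _))
    rw [e1, e2, mul_one, one_mul, ← hε]
    exact hb

end Digon

end Obstruction

end Relative

namespace Relative

open HNNExtension Equiv Equiv.Perm CycleCount

theorem IsFace.pow_length {X : Type*} {f : Perm X} {l : List X} (h : IsFace f l)
    (h0 : 0 < l.length) : (f ^ l.length) l[0] = l[0] := by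
  have h1 : (l.map f)[l.length - 1]'(by simpa using by omega) =
      (l.rotate 1)[l.length - 1]'(by simpa using by omega) := by
    simp only [h.2.2]
  rw [List.getElem_map, List.getElem_rotate, h.getElem_eq (l.length - 1) (by omega)] at h1
  rw [← Perm.mul_apply, ← pow_succ'] at h1
  simpa only [Nat.sub_add_cancel h0, Nat.mod_self] using h1

variable {H : Type*} [Group H] {A B : Subgroup H}

namespace Obstruction

variable {ψ : A ≃* B} {R : Relator A B} {m : ℕ} {X : Type} [Fintype X] [DecidableEq X]
  (O : Obstruction ψ R m X)

/-- The face of `d` reads the relator from position `s`. -/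
def IsPos (d : X) (s : ℤ) : Prop := ∀ i : ℤ, O.lab ((O.φ ^ i) d) = (R.c (s + i), R.e (s + i))

/-- The face of `d` reads the inverse of the relator from position `s`. -/
def IsNeg (d : X) (s : ℤ) : Prop :=
  ∀ i : ℤ, O.lab ((O.φ ^ i) d) = ((R.c (s - i + 1))⁻¹, - R.e (s - i))

variable {O}

theorem IsPos.zpow {d : X} {s : ℤ} (h : O.IsPos d s) (n : ℤ) : O.IsPos ((O.φ ^ n) d) (s + n) := by
  intro i
  rw [← Perm.mul_apply, ← zpow_add, h, add_comm i n, add_assoc]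

theorem IsNeg.zpow {d : X} {s : ℤ} (h : O.IsNeg d s) (n : ℤ) : O.IsNeg ((O.φ ^ n) d) (s - n) := by
  intro i
  rw [← Perm.mul_apply, ← zpow_add, h, add_comm i n, sub_sub]

theorem IsPos.not_isNeg {d : X} {s s' : ℤ} (h : O.IsPos d s) (h' : O.IsNeg d s') : False := by
  have e1 := congrArg Prod.snd ((h (-s)).symm.trans (h' (-s)))
  have e2 := congrArg Prod.snd ((h (-s - 1)).symm.trans (h' (-s - 1)))
  have e3 := (R.e_eq_iff 0).2 (dvd_zero _)
  have e4 := R.e_eq_iff (s' + s + 1)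
  simp only [add_neg_cancel, R.e_zero, sub_neg_eq_add, zero_sub, add_sub_cancel_right] at e1 e2 e3 e4
  rw [show s + (-s - 1) = -1 by ring, e3, show s' - (-s - 1) = s' + s + 1 by ring] at e2
  have e5 : R.e (s' + s) = R.e (s' + s + 1) := neg_injective (e1.symm.trans e2)
  have e6 := R.e_congr (i := 0) (j := s' + s + 1) (by simpa using e4.1 e5)
  rw [R.e_zero] at e6
  rw [← e6] at e2
  exact absurd e2 (by decide)

theorem isPos_of_face {l : List X} {s : ℤ} (hL : R.L ∣ m) (hl : IsFace O.φ l)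
    (h : l.map O.lab = R.posWord m s) : l.length = m ∧ ∀ x ∈ l, ∃ s, O.IsPos x s := by
  have hlen : l.length = m := by
    have := congrArg List.length h
    simpa [Relator.posWord] using this
  refine ⟨hlen, ?_⟩
  have hpos : 0 < l.length := List.length_pos_iff.2 hl.2.1
  have key : O.IsPos l[0] s := by
    intro i
    have hm : (m : ℤ) ≠ 0 := by omega
    obtain ⟨n, hn⟩ := Int.eq_ofNat_of_zero_le (Int.emod_nonneg i hm)
    have hnm : n < m := by
      have := Int.emod_lt_of_pos i (show (0 : ℤ) < m by omega)
      omega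
    have hi : i = n + m * (i / m) := by
      have := Int.emod_add_mul_ediv i m
      rw [hn] at this
      exact this.symm
    have hfix : (O.φ ^ (m : ℤ)) l[0] = l[0] := by
      have := hl.pow_length hpos
      rwa [hlen] at this
    have hφ : (O.φ ^ i) l[0] = l[n] := by
      have hi' := congrArg (fun j : ℤ => (O.φ ^ j) l[0]) hi
      rw [hl.getElem_eq n (by omega)]
      refine hi'.trans ?_
      rw [zpow_add, zpow_mul, Perm.mul_apply, Perm.zpow_apply_eq_self_of_apply_eq_self hfix,
        zpow_natCast]
    have hlab : O.lab l[n] = (R.c (s + n), R.e (s + n)) := by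
      have : (l.map O.lab)[n]'(by simpa using by omega) =
          (R.posWord m s)[n]'(by simpa [Relator.posWord] using hnm) := by simp only [h]
      simpa [Relator.posWord] using this
    have hdvd : (R.L : ℤ) ∣ s + i - (s + n) := by
      have : s + i - (s + n) = m * (i / m) := by rw [add_sub_add_left_eq_sub]; omega
      rw [this]
      exact (Int.natCast_dvd_natCast.2 hL).mul_right _
    rw [hφ, hlab, R.c_congr hdvd, R.e_congr hdvd]
  intro x hx
  obtain ⟨n, hn, rfl⟩ := List.getElem_of_mem hx
  rw [hl.getElem_eq n hn]
  exact ⟨_, key.zpow n⟩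

theorem isNeg_of_face {l : List X} {s : ℤ} (hL : R.L ∣ m) (hl : IsFace O.φ l)
    (h : l.map O.lab = R.negWord m s) : l.length = m ∧ ∀ x ∈ l, ∃ s, O.IsNeg x s := by
  have hlen : l.length = m := by
    have := congrArg List.length h
    simpa [Relator.negWord] using this
  refine ⟨hlen, ?_⟩
  have hpos : 0 < l.length := List.length_pos_iff.2 hl.2.1
  have key : O.IsNeg l[0] s := by
    intro i
    have hm : (m : ℤ) ≠ 0 := by omega
    obtain ⟨n, hn⟩ := Int.eq_ofNat_of_zero_le (Int.emod_nonneg i hm)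
    have hnm : n < m := by
      have := Int.emod_lt_of_pos i (show (0 : ℤ) < m by omega)
      omega
    have hi : i = n + m * (i / m) := by
      have := Int.emod_add_mul_ediv i m
      rw [hn] at this
      exact this.symm
    have hfix : (O.φ ^ (m : ℤ)) l[0] = l[0] := by
      have := hl.pow_length hpos
      rwa [hlen] at this
    have hφ : (O.φ ^ i) l[0] = l[n] := by
      have hi' := congrArg (fun j : ℤ => (O.φ ^ j) l[0]) hi
      rw [hl.getElem_eq n (by omega)]
      refine hi'.trans ?_
      rw [zpow_add, zpow_mul, Perm.mul_apply, Perm.zpow_apply_eq_self_of_apply_eq_self hfix,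
        zpow_natCast]
    have hlab : O.lab l[n] = ((R.c (s - n + 1))⁻¹, - R.e (s - n)) := by
      have : (l.map O.lab)[n]'(by simpa using by omega) =
          (R.negWord m s)[n]'(by simpa [Relator.negWord] using hnm) := by simp only [h]
      simpa [Relator.negWord] using this
    have hdvd : (R.L : ℤ) ∣ s - n - (s - i) := by
      have : s - n - (s - i) = m * (i / m) := by omega
      rw [this]
      exact (Int.natCast_dvd_natCast.2 hL).mul_right _
    rw [hφ, hlab, R.e_congr hdvd, R.c_congr (i := s - i + 1) (j := s - n + 1)
      (by simpa using hdvd)]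
  intro x hx
  obtain ⟨n, hn, rfl⟩ := List.getElem_of_mem hx
  rw [hl.getElem_eq n hn]
  exact ⟨_, key.zpow n⟩

variable (hmin : ∀ O' : Obstruction ψ R m X, O.size ≤ O'.size)

include hmin

theorem conn_of_minimal {d : X} (hd : O.α d ≠ d) : O.conn O.x₀ d := by
  by_contra h
  obtain ⟨O', h'⟩ := O.exists_size_lt_of_not_conn hd h
  exact absurd (hmin O') (by omega)

theorem isPos_or_isNeg_of_face (hm : 2 ≤ m) (hL : R.L ∣ m) {l : List X} (hl : IsFace O.φ l)
    (h : Bounds ψ R m (l.map O.lab)) :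
    l.length = m ∧ ((∀ x ∈ l, ∃ s, O.IsPos x s) ∨ ∀ x ∈ l, ∃ s, O.IsNeg x s) := by
  have hconn := fun d => O.conn_of_minimal hmin (d := d)
  generalize hw : l.map O.lab = w at h
  induction h generalizing l with
  | pos s =>
    obtain ⟨h1, h2⟩ := isPos_of_face hL hl hw
    exact ⟨h1, Or.inl h2⟩
  | neg s =>
    obtain ⟨h1, h2⟩ := isNeg_of_face hL hl hw
    exact ⟨h1, Or.inr h2⟩
  | rot w₁ w₂ _ ih =>
    obtain ⟨l₂, l₁, rfl, h₂, h₁⟩ := List.map_eq_append_iff.1 hw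
    have := ih hl.append_comm (by rw [List.map_append, h₁, h₂])
    simpa [add_comm, or_comm] using this
  | digon u g =>
    exfalso
    obtain ⟨d, l, rfl, hd, hw⟩ := List.map_eq_cons_iff.1 hw
    obtain ⟨d', l, rfl, hd', hw⟩ := List.map_eq_cons_iff.1 hw
    obtain rfl := List.map_eq_nil_iff.1 hw
    rw [lab, Prod.mk.injEq] at hd hd'
    let D : O.Digon d d' := ⟨u, g, hl, hd.1, hd.2, hd'.1, hd'.2⟩
    obtain ⟨O', h'⟩ := D.exists_size_lt hm hconn
    exact absurd (hmin O') (by omega)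
  | split x y x' y' u u' w₁ w₂ h1 h2 =>
    exfalso
    obtain ⟨l₁, l₂, rfl, h₁, h₂⟩ := List.map_eq_append_iff.1 hw
    obtain ⟨i, l₁, rfl, hi, rfl⟩ := List.map_eq_cons_iff.1 h₁
    obtain ⟨j, l₂, rfl, hj, rfl⟩ := List.map_eq_cons_iff.1 h₂
    rw [lab, Prod.mk.injEq] at hi hj
    obtain ⟨hi, rfl⟩ := hi
    obtain ⟨hj, rfl⟩ := hj
    let P : O.Pinch i j := ⟨l₁, l₂, x, y, x', y', hl, hi, hj, h1, h2⟩
    obtain ⟨O', h'⟩ := P.exists_size_lt hconn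
    exact absurd (hmin O') (by omega)

theorem isPos_or_isNeg (hm : 2 ≤ m) (hL : R.L ∣ m) {d : X} (hd : O.α d ≠ d) :
    (∃ s, O.IsPos d s) ∨ ∃ s, O.IsNeg d s := by
  obtain ⟨a, l, hl, hb⟩ := O.exists_face_cons hm hd
  obtain ⟨-, h | h⟩ := isPos_or_isNeg_of_face hmin hm hL hl hb
  · exact Or.inl (h d (by simp))
  · exact Or.inr (h d (by simp))

theorem not_mirrored (hm : 2 ≤ m) (hL : R.L ∣ m) {d : X} {s s' : ℤ} (hd : O.α d ≠ d)
    (hpos : O.IsPos d s) (hneg : O.IsNeg (O.α d) s') (hs : (R.L : ℤ) ∣ s - s') (hp : O.p d = 1) :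
    False := by
  obtain ⟨a, l₁, hl₁, hb₁⟩ := O.exists_face_cons hm hd
  obtain ⟨a', l₂, hl₂, hb₂⟩ := O.exists_face_cons hm (d := O.α d) (by rwa [O.inv, ne_comm])
  obtain ⟨len₁, -⟩ := isPos_or_isNeg_of_face hmin hm hL hl₁ hb₁
  obtain ⟨len₂, -⟩ := isPos_or_isNeg_of_face hmin hm hL hl₂ hb₂
  have w₁ : (d :: a :: l₁).map O.lab = R.posWord m s := by
    refine List.ext_getElem (by simp [Relator.posWord, ← len₁]) fun n h1 h2 => ?_
    rw [List.getElem_map, hl₁.getElem_eq n (by simpa using h1)]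
    have := hpos n
    rw [zpow_natCast] at this
    simpa [Relator.posWord] using this
  have w₂ : (O.α d :: a' :: l₂).map O.lab = R.negWord m s := by
    rw [← R.negWord_congr m hs]
    refine List.ext_getElem (by simp [Relator.negWord, ← len₂]) fun n h1 h2 => ?_
    rw [List.getElem_map, hl₂.getElem_eq n (by simpa using h1)]
    have := hneg n
    rw [zpow_natCast] at this
    simpa [Relator.negWord] using this
  have hno : ¬ orbits O.φ d (O.α d) := by
    rintro ⟨n, hn⟩
    exact (hpos.zpow n).not_isNeg (hn ▸ hneg)
  obtain ⟨n, rfl⟩ : ∃ n, m = n + 1 := ⟨m - 1, by omega⟩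
  have v := R.value_negWord ψ hL s
  have v' := R.value_posWord_shift ψ hL s
  rw [← w₂] at v
  rw [← w₁] at v'
  rw [R.posWord_succ, List.map_cons, List.cons.injEq, lab, Prod.mk.injEq] at w₁
  rw [R.negWord_succ, List.map_cons, List.cons.injEq, lab, Prod.mk.injEq] at w₂
  obtain ⟨⟨k₁, ε₁⟩, w₁⟩ := w₁
  obtain ⟨⟨k₂, ε₂⟩, w₂⟩ := w₂
  let D : O.Deletion d a (O.α d) a' := ⟨l₁, l₂, rfl, hl₁, hl₂, hno, hp, by
    refine Bounds.of_value_eq_one (by simp) ?_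
    rw [value_append, value_cons, value_cons]
    rw [List.map_cons, value_cons, List.map_cons, value_cons] at v v'
    simp only [lab, k₁, k₂, ε₁, ε₂, map_mul, map_inv] at v v' ⊢
    rw [mul_assoc (of (R.c s) * t ^ (R.e s : ℤ)), mul_right_inj] at v'
    rw [← v', Units.val_neg, zpow_neg] at v
    simp only [mul_assoc, mul_right_inj, inv_mul_eq_iff_eq_mul] at v ⊢
    rw [v]
    group⟩
  obtain ⟨O', h'⟩ := D.exists_size_lt (conn_of_minimal hmin hd)
  exact absurd (hmin O') (by omega)

end Obstruction

end Relative

namespace Relative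

open HNNExtension Equiv Equiv.Perm CycleCount

variable {H : Type*} [Group H] {A B : Subgroup H}

/-- Distinct conjugates of the subgroup intersect trivially. -/
def Malnormal (K : Subgroup H) : Prop := ∀ h ∉ K, ∀ x ∈ K, h * x * h⁻¹ ∈ K → x = 1

namespace Obstruction

variable {ψ : A ≃* B} {R : Relator A B} {m : ℕ} {X : Type} [Fintype X] [DecidableEq X]
  {O : Obstruction ψ R m X}

variable (O) in
/-- The corner at the origin of `d` lies between two letters `t` of the same sign. -/
def Flat (d : X) : Prop := O.ε (O.φ⁻¹ d) = O.ε d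

variable (O) in
/-- The corners after `d` and at the end of `d` are both flat. -/
def Gives (d : X) : Prop := O.Flat (O.α d) ∧ O.Flat (O.φ d)

theorem flat_φ {d : X} : O.Flat (O.φ d) ↔ O.ε d = O.ε (O.φ d) := by
  simp [Flat]

theorem flat_ν {d : X} (hd : O.α d ≠ d) :
    O.Flat (O.φ (O.α d)) ↔ O.ε (O.φ (O.α d)) = - O.ε d := by
  rw [flat_φ, O.ε_α d hd, eq_comm]

theorem ε_ν_of_not_flat {d : X} (hd : O.α d ≠ d) (h : ¬ O.Flat (O.φ (O.α d))) :
    O.ε (O.φ (O.α d)) = O.ε d := by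
  rw [flat_ν hd] at h
  rcases Int.units_eq_one_or (O.ε d) with h1 | h1 <;>
    rcases Int.units_eq_one_or (O.ε (O.φ (O.α d))) with h2 | h2 <;> simp_all

theorem IsPos.lab_eq {d : X} {s : ℤ} (h : O.IsPos d s) : O.κ d = R.c s ∧ O.ε d = R.e s := by
  simpa [lab] using h 0

theorem IsNeg.lab_eq {d : X} {s : ℤ} (h : O.IsNeg d s) :
    O.κ d = (R.c (s + 1))⁻¹ ∧ O.ε d = - R.e s := by
  simpa [lab] using h 0

theorem IsPos.step {d : X} {s : ℤ} (h : O.IsPos d s) : O.IsPos (O.φ d) (s + 1) := by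
  simpa using h.zpow 1

theorem IsNeg.step {d : X} {s : ℤ} (h : O.IsNeg d s) : O.IsNeg (O.φ d) (s - 1) := by
  simpa using h.zpow 1

theorem IsPos.flat_iff {d : X} {s : ℤ} (h : O.IsPos d s) : O.Flat d ↔ (R.L : ℤ) ∣ s := by
  have h' := h.zpow (-1)
  rw [zpow_neg_one] at h'
  rw [Flat, h'.lab_eq.2, h.lab_eq.2, ← sub_eq_add_neg, R.e_eq_iff]

theorem IsNeg.flat_iff {d : X} {s : ℤ} (h : O.IsNeg d s) : O.Flat d ↔ (R.L : ℤ) ∣ s + 1 := by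
  have h' := h.zpow (-1)
  rw [zpow_neg_one, sub_neg_eq_add] at h'
  rw [Flat, h'.lab_eq.2, h.lab_eq.2, neg_inj, eq_comm, ← R.e_eq_iff, add_sub_cancel_right]

theorem live_α {d : X} (hd : O.α d ≠ d) : O.α (O.α d) ≠ O.α d := by
  rwa [O.inv, ne_comm]

theorem live_φ (hm : 2 ≤ m) {d : X} (hd : O.α d ≠ d) : O.α (O.φ d) ≠ O.φ d := by
  obtain ⟨a, l, hl, -⟩ := O.exists_face_cons hm hd
  have h := isFace_cons.1 hl
  have ha : O.φ d = a := by simpa using congrArg List.head? h.2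
  intro h'
  have := O.φ.injective (O.dead _ h')
  rw [ha] at this
  subst this
  simp at h

section

variable (hmin : ∀ O' : Obstruction ψ R m X, O.size ≤ O'.size) (hm : 2 ≤ m) (hL : R.L ∣ m)

include hmin hm hL

theorem flat_cases {d : X} (hd : O.α d ≠ d) (h : O.Flat d) :
    (∃ s, (R.L : ℤ) ∣ s ∧ O.IsPos d s ∧ O.ε d = 1) ∨
      ∃ s, (R.L : ℤ) ∣ s + 1 ∧ O.IsNeg d s ∧ O.ε d = -1 := by
  obtain ⟨s, hs⟩ | ⟨s, hs⟩ := isPos_or_isNeg hmin hm hL hd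
  · have h' := hs.flat_iff.1 h
    refine Or.inl ⟨s, h', hs, ?_⟩
    rw [hs.lab_eq.2, ← R.e_zero, R.e_congr (i := s) (j := 0) (by simpa using h')]
  · have h' := hs.flat_iff.1 h
    refine Or.inr ⟨s, h', hs, ?_⟩
    have h1 := (R.e_eq_iff (s + 1)).2 h'
    rw [add_sub_cancel_right] at h1
    rw [hs.lab_eq.2, h1, ← R.e_zero, R.e_congr (i := s + 1) (j := 0) (by rwa [zero_sub, dvd_neg])]

theorem κ_notMem {d : X} (hd : O.α d ≠ d) (h : ¬ O.Flat d) :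
    O.κ d ∉ toSubgroup A B (- O.ε d) := by
  obtain ⟨s, hs⟩ | ⟨s, hs⟩ := isPos_or_isNeg hmin hm hL hd
  · rw [hs.flat_iff] at h
    have h1 := R.notMem s h
    rw [← R.e_eq_iff] at h
    rw [hs.lab_eq.1, hs.lab_eq.2]
    rcases Int.units_eq_one_or (R.e s) with h2 | h2 <;>
      rcases Int.units_eq_one_or (R.e (s - 1)) with h3 | h3 <;> simp_all
  · rw [hs.flat_iff] at h
    have h1 := R.notMem (s + 1) h
    rw [add_sub_cancel_right] at h1
    rwa [hs.lab_eq.1, hs.lab_eq.2, neg_neg, inv_mem_iff]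

theorem not_flat_φ {d : X} (hd : O.α d ≠ d) (h : O.Flat d) : ¬ O.Flat (O.φ d) := by
  have h3 := R.three_le
  obtain ⟨s, h1, hs, -⟩ | ⟨s, h1, hs, -⟩ := flat_cases hmin hm hL hd h
  · rw [hs.step.flat_iff]
    intro h2
    have := Int.le_of_dvd one_pos ((dvd_add_right h1).1 h2)
    omega
  · rw [hs.step.flat_iff]
    intro h2
    have := Int.le_of_dvd one_pos ((dvd_add_right h2).1 (by simpa using h1))
    omega

theorem ε_φ_φ {d : X} (hd : O.α d ≠ d) (h : O.Flat d) (h' : O.Flat (O.φ (O.φ d))) :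
    O.ε (O.φ (O.φ d)) = O.ε d := by
  have hd' := live_φ hm (live_φ hm hd)
  obtain ⟨s, -, hs, e⟩ | ⟨s, -, hs, e⟩ := flat_cases hmin hm hL hd h <;>
    obtain ⟨s', -, hs', e'⟩ | ⟨s', -, hs', e'⟩ := flat_cases hmin hm hL hd' h'
  · rw [e, e']
  · exact (hs.step.step.not_isNeg hs').elim
  · exact (hs'.not_isNeg hs.step.step).elim
  · rw [e, e']

theorem Gives.not_flat {d : X} (hd : O.α d ≠ d) (h : O.Gives d) : ¬ O.Flat d :=
  fun h' => not_flat_φ hmin hm hL hd h' h.2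

theorem Gives.ν {d : X} (hd : O.α d ≠ d) (h : O.Gives d) :
    ¬ O.Flat (O.φ (O.α d)) ∧ ¬ O.Gives (O.φ (O.α d)) := by
  have h1 := not_flat_φ hmin hm hL (live_α hd) h.1
  refine ⟨h1, fun h2 => h1 ?_⟩
  have h3 := ε_φ_φ hmin hm hL (live_α hd) h.1 h2.2
  rw [flat_ν hd, flat_φ.1 h2.2, h3, O.ε_α d hd]

/-- A minimal obstruction has no vertex of degree two at which a non-flat corner meets the
corner of a giving dart. -/
theorem ν_ν_ne (hA : Malnormal A) (hB : Malnormal B) {n : X} (hn : O.α n ≠ n)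
    (h : ¬ O.Flat n) (hb : O.Gives (O.φ (O.α n)))
    (g₁ : O.θ (O.φ (O.α n)) = O.θ n * O.κ n * O.p n)
    (g₂ : O.θ (O.φ (O.α (O.φ (O.α n)))) =
      O.θ (O.φ (O.α n)) * O.κ (O.φ (O.α n)) * O.p (O.φ (O.α n))) :
    O.φ (O.α (O.φ (O.α n))) ≠ n := by
  intro e
  set b := O.φ (O.α n) with hb'
  have hbl : O.α b ≠ b := live_φ hm (live_α hn)
  have hε : O.ε n = O.ε b := by
    rw [← ε_ν_of_not_flat hbl (by rwa [e]), e]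
  have hp := O.p_mem n hn
  have hp' := O.p_mem b hbl
  have hκ := κ_notMem hmin hm hL hn h
  rw [← hε] at hp'
  have hM : Malnormal (toSubgroup A B (- O.ε n)) := by
    rcases Int.units_eq_one_or (- O.ε n) with h | h <;> rw [h]
    exacts [hA, hB]
  have key : O.κ n * O.p n * O.κ b * O.p b = 1 := by
    rw [e, g₁] at g₂
    simp only [mul_assoc] at g₂ ⊢
    exact (left_eq_mul.1 g₂)
  have fin (hκ' : O.κ b = (O.κ n)⁻¹) : O.p b = 1 := by
    rw [hκ', mul_eq_one_iff_eq_inv] at key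
    have h1 := hM _ hκ _ hp (by rw [key]; exact inv_mem hp')
    rw [h1] at key
    simpa using key.symm
  obtain ⟨f₁, f₂⟩ := hb
  obtain ⟨s, d, hs, e₁⟩ | ⟨s, d, hs, e₁⟩ := flat_cases hmin hm hL (live_α hbl) f₁
  · have e₂ : O.ε b = -1 := by rw [O.ε_α b hbl] at e₁; exact neg_eq_iff_eq_neg.1 e₁
    obtain ⟨s', d', hs', e₃⟩ | ⟨s', d', hs', e₃⟩ := flat_cases hmin hm hL (live_φ hm hbl) f₂
    · rw [← flat_φ.1 f₂, e₂] at e₃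
      exact absurd e₃ (by decide)
    have hbn : O.IsNeg b (s' + 1) := by simpa using hs'.zpow (-1)
    have hn' := hs.step
    rw [e] at hn'
    have hpb : O.p b = 1 := fin (by
      rw [hbn.lab_eq.1, hn'.lab_eq.1, R.c_congr (i := s' + 1 + 1) (j := s + 1)]
      have := dvd_sub d d'
      rwa [show s + 1 - (s' + 1 + 1) = s - (s' + 1) by ring])
    have hpα : O.p (O.α b) = 1 := by
      have := O.p_α b hbl
      rw [hpb] at this
      refine of_injective (φ := ψ) ?_
      rw [this]; simp
    refine not_mirrored hmin hm hL (live_α hbl) hs (by rwa [O.inv]) (dvd_sub d d') hpα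
  · have e₂ : O.ε b = 1 := by rw [O.ε_α b hbl] at e₁; exact neg_injective e₁
    obtain ⟨s', d', hs', e₃⟩ | ⟨s', d', hs', e₃⟩ := flat_cases hmin hm hL (live_φ hm hbl) f₂
    swap
    · rw [← flat_φ.1 f₂, e₂] at e₃
      exact absurd e₃ (by decide)
    have hbn : O.IsPos b (s' - 1) := by simpa [sub_eq_add_neg] using hs'.zpow (-1)
    have hn' := hs.step
    rw [e] at hn'
    have hd : (R.L : ℤ) ∣ s' - 1 - s := by
      have := dvd_sub d' d
      rwa [show s' - 1 - s = s' - (s + 1) by ring]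
    have hpb : O.p b = 1 := fin (by
      rw [hbn.lab_eq.1, hn'.lab_eq.1, inv_inv, R.c_congr (i := s - 1 + 1) (j := s' - 1)]
      simpa using hd)
    exact not_mirrored hmin hm hL hbl hbn hs hd hpb

variable (O) in
/-- The darts counted at the vertices. -/
def Counted (d : X) : Prop :=
  O.Flat d ∧ O.Flat (O.φ (O.α d)) ∨ ¬ O.Flat d ∧ ¬ O.Gives d

theorem exists_two_counted (hA : Malnormal A) (hB : Malnormal B) {x : X} {S : X → Prop}
    (hx : S x) (hS : ∀ y, S y → S (O.φ (O.α y))) (hlive : ∀ y, S y → O.α y ≠ y)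
    (hgood : ∀ y, S y → O.θ (O.φ (O.α y)) = O.θ y * O.κ y * O.p y) :
    ∃ y z, S y ∧ S z ∧ O.Counted y ∧ O.Counted z ∧ y ≠ z := by
  by_cases hall : ∀ y, S y → O.Flat y
  · have f := fun y hy => hall _ (hS y hy)
    refine ⟨x, _, hx, hS x hx, Or.inl ⟨hall x hx, f x hx⟩,
      Or.inl ⟨f x hx, f _ (hS x hx)⟩, fun e => ?_⟩
    have h1 := (flat_ν (hlive x hx)).1 (f x hx)
    rw [← e] at h1
    rcases Int.units_eq_one_or (O.ε x) with h | h <;> rw [h] at h1 <;> exact absurd h1 (by decide)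
  have give := fun y hy => Gives.ν hmin hm hL (d := y) (hlive y hy)
  obtain ⟨n, hn, fn, gn⟩ : ∃ n, S n ∧ ¬ O.Flat n ∧ ¬ O.Gives n := by
    push Not at hall
    obtain ⟨b, hb, fb⟩ := hall
    by_cases gb : O.Gives b
    · exact ⟨_, hS b hb, give b hb gb⟩
    · exact ⟨b, hb, fb, gb⟩
  have sign : ∀ y, O.ε y = - O.ε n → n ≠ y := by
    rintro y h rfl
    rcases Int.units_eq_one_or (O.ε n) with h' | h' <;> rw [h'] at h <;> exact absurd h (by decide)
  suffices ∃ y, S y ∧ O.Counted y ∧ n ≠ y by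
    obtain ⟨y, h1, h2, h3⟩ := this
    exact ⟨n, y, hn, h1, Or.inr ⟨fn, gn⟩, h2, h3⟩
  have l₁ := hlive _ (hS n hn)
  have l₂ := hlive _ (hS _ (hS n hn))
  by_cases f₁ : O.Flat (O.φ (O.α n))
  · have s₁ := (flat_ν (hlive n hn)).1 f₁
    by_cases f₂ : O.Flat (O.φ (O.α (O.φ (O.α n))))
    · exact ⟨_, hS n hn, Or.inl ⟨f₁, f₂⟩, sign _ s₁⟩
    have s₂ := (ε_ν_of_not_flat l₁ f₂).trans s₁
    by_cases g₂ : O.Gives (O.φ (O.α (O.φ (O.α n))))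
    · obtain ⟨f₃, g₃⟩ := give _ (hS _ (hS n hn)) g₂
      exact ⟨_, hS _ (hS _ (hS n hn)), Or.inr ⟨f₃, g₃⟩,
        sign _ ((ε_ν_of_not_flat l₂ f₃).trans s₂)⟩
    · exact ⟨_, hS _ (hS n hn), Or.inr ⟨f₂, g₂⟩, sign _ s₂⟩
  by_cases g₁ : O.Gives (O.φ (O.α n))
  · exact ⟨_, hS _ (hS n hn), Or.inr (give _ (hS n hn) g₁),
      (ν_ν_ne hmin hm hL hA hB (hlive n hn) fn g₁ (hgood n hn) (hgood _ (hS n hn))).symm⟩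
  · refine ⟨_, hS n hn, Or.inr ⟨f₁, g₁⟩, fun e => ?_⟩
    have h1 := hgood n hn
    rw [← e, mul_assoc, left_eq_mul, mul_eq_one_iff_eq_inv] at h1
    exact κ_notMem hmin hm hL (hlive n hn) fn (h1 ▸ inv_mem (O.p_mem n (hlive n hn)))

theorem exists_two_flat (hlt : R.L < m) {x : X} (hx : O.α x ≠ x) :
    ∃ y z, (O.Flat y ∧ O.α y ≠ y) ∧ (O.Flat z ∧ O.α z ≠ z) ∧ y ≠ z ∧
      orbits O.φ x y ∧ orbits O.φ x z := by
  have hlive : ∀ n : ℕ, ∀ y, O.α y ≠ y → O.α ((O.φ ^ n) y) ≠ (O.φ ^ n) y := by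
    intro n y hy
    induction n with
    | zero => exact hy
    | succ n ih => rw [pow_succ', Perm.mul_apply]; exact live_φ hm ih
  obtain ⟨y, hxy, hy, fy, fy'⟩ : ∃ y, orbits O.φ x y ∧ O.α y ≠ y ∧ O.Flat y ∧
      O.Flat ((O.φ ^ R.L) y) := by
    have hz (i : ℤ) : orbits O.φ x ((O.φ ^ i) x) := ⟨i, rfl⟩
    have hlz (i : ℤ) : O.α ((O.φ ^ i) x) ≠ (O.φ ^ i) x := by
      obtain ⟨n, hn⟩ := SameCycle.exists_nat_pow_eq (hz i)
      rw [← hn]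
      exact hlive n x hx
    obtain ⟨s, hs⟩ | ⟨s, hs⟩ := isPos_or_isNeg hmin hm hL hx
    · have h1 := hs.zpow (-s)
      have h2 := h1.zpow R.L
      rw [zpow_natCast] at h2
      exact ⟨_, hz (-s), hlz _, h1.flat_iff.2 (by simp), h2.flat_iff.2 (by simp)⟩
    · have h1 := hs.zpow (s + 1)
      have h2 := h1.zpow R.L
      rw [zpow_natCast] at h2
      exact ⟨_, hz (s + 1), hlz _, h1.flat_iff.2 (by simp), h2.flat_iff.2 (by ring_nf; simp)⟩
  obtain ⟨a, l, hl, hb⟩ := O.exists_face_cons hm hy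
  obtain ⟨hlen, -⟩ := isPos_or_isNeg_of_face hmin hm hL hl hb
  refine ⟨y, _, ⟨fy, hy⟩, ⟨fy', hlive _ y hy⟩, ?_, hxy, Setoid.trans' _ hxy ⟨R.L, by simp⟩⟩
  have h3 := R.three_le
  have h0 := hl.getElem_eq R.L (by omega)
  simp only [List.getElem_cons_zero] at h0
  rw [← h0]
  intro h1
  have := (hl.1.getElem_inj_iff (i := 0) (j := R.L) (hi := by simp) (hj := by omega)).1
    (by simpa using h1)
  omega

theorem false_of_minimal (hlt : R.L < m) (hA : Malnormal A) (hB : Malnormal B) : False := by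
  classical
  have hconn := fun d => O.conn_of_minimal hmin (d := d)
  set D : Finset X := {d | O.α d = d}
  set S : Finset X := {d | O.α d ≠ d}
  have hS : O.α.support = S := by ext; simp [S]
  have e1 : (S.filter O.Flat).card + (S.filter fun d => ¬ O.Flat d).card = S.card :=
    Finset.card_filter_add_card_filter_not _
  have e2 : ((S.filter fun d => ¬ O.Flat d).filter O.Gives).card +
      ((S.filter fun d => ¬ O.Flat d).filter fun d => ¬ O.Gives d).card =
        (S.filter fun d => ¬ O.Flat d).card :=
    Finset.card_filter_add_card_filter_not _
  have e3 : (S.filter fun d => O.Flat d ∧ O.Flat (O.φ (O.α d))).card ≤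
      ((S.filter fun d => ¬ O.Flat d).filter O.Gives).card := by
    refine Finset.card_le_card_of_injOn O.α (fun d hd => ?_) O.α.injective.injOn
    simp only [S, Finset.coe_filter, Finset.mem_filter, Finset.mem_univ, true_and,
      Set.mem_ofPred_eq] at hd ⊢
    have hg : O.Gives (O.α d) := ⟨by rw [O.inv]; exact hd.2.1, hd.2.2⟩
    exact ⟨⟨live_α hd.1, hg.not_flat hmin hm hL (live_α hd.1)⟩, hg⟩
  have e4 : (S.filter O.Counted).card ≤
      (S.filter fun d => O.Flat d ∧ O.Flat (O.φ (O.α d))).card +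
        ((S.filter fun d => ¬ O.Flat d).filter fun d => ¬ O.Gives d).card := by
    refine (Finset.card_le_card fun d hd => ?_).trans (Finset.card_union_le _ _)
    simp only [Finset.mem_filter, Finset.mem_union, Counted] at hd ⊢
    tauto
  have e5 : 2 * cyc (O.φ * O.α) ≤ (S.filter O.Counted).card + 2 * (insert O.x₀ D).card := by
    refine two_mul_numClasses_le _ _ _ fun x => ?_
    by_cases h : ∃ y ∈ insert O.x₀ D, orbits (O.φ * O.α) x y
    · exact Or.inl h
    right
    push Not at h
    have hl : ∀ y, orbits (O.φ * O.α) x y → O.α y ≠ y := fun y hy h' =>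
      h y (by simp [D, h']) hy
    obtain ⟨y, z, hy, hz, cy, cz, hne⟩ := exists_two_counted hmin hm hL hA hB
      (x := x) (S := fun y => orbits (O.φ * O.α) x y) (Setoid.refl' _ x)
      (fun y hy => Setoid.trans' _ hy (orbits_step _ y)) hl
      (fun y hy => O.good y (hconn y (hl y hy)) fun h' => h y (by simp [h']) hy)
    exact ⟨y, by simp [S, hl y hy, cy], z, by simp [S, hl z hz, cz], hne, hy, hz⟩
  have e6 : 2 * cyc O.φ ≤ (S.filter O.Flat).card + 2 * D.card := by
    refine two_mul_numClasses_le _ _ _ fun x => ?_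
    by_cases hx : O.α x = x
    · exact Or.inl ⟨x, by simp [D, hx], Setoid.refl' _ x⟩
    · obtain ⟨y, z, hy, hz, h⟩ := exists_two_flat hmin hm hL hlt hx
      exact Or.inr ⟨y, by simp [S, hy], z, by simp [S, hz], h⟩
  have e7 : (insert O.x₀ D).card = D.card + 1 :=
    Finset.card_insert_of_notMem (by simpa [D] using O.live)
  have e8 : (insert O.x₀ D).card ≤ numClasses (orbits O.φ ⊔ orbits O.α) := by
    have hu : orbits O.φ ⊔ orbits O.α ≤ Setoid.ker (fun x => if O.α x = x then some x else none) := by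
      refine sup_le (orbits_le fun x => ?_) (orbits_le fun x => ?_)
      · by_cases hx : O.α x = x
        · rw [O.dead x hx]
        · simp [Setoid.ker_def, hx, live_φ hm hx]
      · by_cases hx : O.α x = x
        · rw [hx]
        · simp [Setoid.ker_def, hx, live_α hx]
    have := Fintype.ofFinite (Quotient (orbits O.φ ⊔ orbits O.α))
    rw [numClasses, Nat.card_eq_fintype_card, ← Finset.card_univ]
    refine Finset.card_le_card_of_injOn (Quotient.mk _) (by simp) fun x hx y hy h => ?_
    have h' := hu (Quotient.exact h)
    rw [Setoid.ker_def] at h'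
    simp only [Finset.coe_insert, Set.mem_insert_iff, Finset.mem_coe, D, Finset.mem_filter,
      Finset.mem_univ, true_and] at hx hy
    have hlive := O.live
    rcases hx with rfl | hx <;> rcases hy with rfl | hy <;> simp_all
  have e9 := O.planar
  rw [hS] at e9
  omega

end

theorem isEmpty (hm : 2 ≤ m) (hL : R.L ∣ m) (hlt : R.L < m) (hA : Malnormal A)
    (hB : Malnormal B) : IsEmpty (Obstruction ψ R m X) := by
  refine ⟨fun O => ?_⟩
  have : Nonempty (Obstruction ψ R m X) := ⟨O⟩
  obtain ⟨O', h⟩ : ∃ O' : Obstruction ψ R m X, ∀ O'' : Obstruction ψ R m X, O'.size ≤ O''.size :=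
    ⟨_, fun O'' => Function.argmin_le (size : Obstruction ψ R m X → ℕ) O''⟩
  exact false_of_minimal h hm hL hlt hA hB

end Obstruction

end Relative

namespace Relative

open HNNExtension Equiv Equiv.Perm CycleCount

theorem card_le_numClasses {X Y : Type*} [Finite X] {s : Setoid X} (f : X → Y)
    (hf : Function.Surjective f) (h : ∀ x y, s x y → f x = f y) : Nat.card Y ≤ numClasses s :=
  Nat.card_le_card_of_surjective (Quotient.lift f h) fun y => by
    obtain ⟨x, rfl⟩ := hf y
    exact ⟨Quotient.mk _ x, rfl⟩

variable {H : Type*} [Group H] {A B : Subgroup H} {ψ : A ≃* B} {R : Relator A B} {m : ℕ}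

theorem value_reverse (a : ℕ → H) (u : ℕ → ℤˣ) (n : ℕ) :
    value ψ ((List.range n).map fun i => ((a (n - i))⁻¹, - u (n - 1 - i))) * (of (a 0))⁻¹ =
      (of (a n))⁻¹ * (value ψ ((List.range n).map fun i => (a i, u i)))⁻¹ := by
  induction n with
  | zero => simp
  | succ n ih =>
    have h : (List.range (n + 1)).map (fun i => ((a (n + 1 - i))⁻¹, - u (n + 1 - 1 - i))) =
        ((a (n + 1))⁻¹, - u n) :: (List.range n).map fun i => ((a (n - i))⁻¹, - u (n - 1 - i)) := by
      rw [List.range_succ_eq_map, List.map_cons, List.map_map]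
      congr 1
      refine List.map_congr_left fun i _ => ?_
      simp only [Function.comp_apply]
      rw [show n + 1 - i.succ = n - i by omega, show n + 1 - 1 - i.succ = n - 1 - i by omega]
    rw [h, value_cons, mul_assoc, ih, List.range_succ, List.map_append, value_append]
    simp [mul_assoc]

namespace Sphere

variable (N : ℕ)

/-- The face permutation of the sphere obtained by gluing two discs along their boundaries. -/
def φ : Perm (Bool × Fin (N + 1)) where
  toFun x := (x.1, x.2 + if x.1 then 1 else -1)
  invFun x := (x.1, x.2 - if x.1 then 1 else -1)
  left_inv x := by simp
  right_inv x := by simp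

/-- The edge involution of the sphere obtained by gluing two discs along their boundaries. -/
def α : Perm (Bool × Fin (N + 1)) := prodCongr boolNot (Equiv.refl _)

@[simp] theorem φ_true (i : Fin (N + 1)) : φ N (true, i) = (true, i + 1) := rfl

@[simp] theorem φ_false (i : Fin (N + 1)) : φ N (false, i) = (false, i - 1) :=
  Prod.ext rfl (sub_eq_add_neg i 1).symm

@[simp] theorem α_apply (b : Bool) (i : Fin (N + 1)) : α N (b, i) = (!b, i) := rfl

theorem isFace_true :
    IsFace (φ N) ((List.range (N + 1)).map fun i : ℕ => (true, Fin.ofNat (N + 1) i)) := by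
  refine ⟨(List.nodup_map_iff_inj_on List.nodup_range).2 fun i hi j hj h => ?_, by simp, ?_⟩
  · rw [List.mem_range] at hi hj
    have := congrArg Fin.val (congrArg Prod.snd h)
    simpa [Nat.mod_eq_of_lt hi, Nat.mod_eq_of_lt hj] using this
  · refine List.ext_getElem (by simp) fun i h1 h2 => ?_
    rw [List.getElem_rotate]
    simp only [List.getElem_map, List.getElem_range, φ_true, List.length_map, List.length_range]
    refine Prod.ext rfl (Fin.ext ?_)
    simp [Fin.val_add]

theorem isFace_false :
    IsFace (φ N) ((List.range (N + 1)).map fun i : ℕ => (false, Fin.ofNat (N + 1) (N - i))) := by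
  refine ⟨(List.nodup_map_iff_inj_on List.nodup_range).2 fun i hi j hj h => ?_, by simp, ?_⟩
  · rw [List.mem_range] at hi hj
    have := congrArg Fin.val (congrArg Prod.snd h)
    rw [Fin.val_ofNat, Fin.val_ofNat, Nat.mod_eq_of_lt (by omega), Nat.mod_eq_of_lt (by omega)]
      at this
    omega
  · refine List.ext_getElem (by simp) fun i h1 h2 => ?_
    rw [List.getElem_rotate]
    simp only [List.getElem_map, List.getElem_range, φ_false, List.length_map, List.length_range]
    refine Prod.ext rfl ?_
    rw [sub_eq_iff_eq_add]
    refine Fin.ext ?_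
    have hi : i < N + 1 := by simpa using h1
    obtain rfl | hi := Nat.eq_or_lt_of_le (Nat.lt_succ_iff.1 hi)
    · simp
    · rw [Nat.mod_eq_of_lt (by omega)]
      simp only [Fin.val_add, Fin.val_ofNat, Nat.add_mod_mod, Nat.mod_add_mod, Fin.val_one']
      congr 1
      omega

theorem planar : (α N).support.card + 4 * numClasses (orbits (φ N) ⊔ orbits (α N)) ≤
    2 * cyc (φ N) + 2 * cyc (φ N * α N) := by
  have h1 : (α N).support.card ≤ 2 * (N + 1) := by
    refine (Finset.card_le_univ _).trans ?_
    simp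
  have h2 : 2 ≤ cyc (φ N) := by
    have := card_le_numClasses (s := orbits (φ N)) Prod.fst Prod.fst_surjective
      (orbits_le (u := Setoid.ker _) fun _ => rfl)
    simpa [cyc] using this
  have h3 : N + 1 ≤ cyc (φ N * α N) := by
    have := card_le_numClasses (s := orbits (φ N * α N)) (fun x => x.2 + if x.1 then 0 else 1)
      (fun i => ⟨(true, i), by simp⟩) (orbits_le (u := Setoid.ker _) fun x => by
        rw [Setoid.ker_def]
        obtain ⟨_ | _, i⟩ := x <;> simp)
    simpa [cyc] using this
  have h4 : numClasses (orbits (φ N) ⊔ orbits (α N)) ≤ 1 := by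
    have h (x) : (orbits (φ N) ⊔ orbits (α N)) (true, 0) x := by
      have hφ : ∀ x, (orbits (φ N) ⊔ orbits (α N)) x (φ N x) := fun x =>
        (le_sup_left : orbits (φ N) ≤ _) (orbits_step _ x)
      have hα : ∀ x, (orbits (φ N) ⊔ orbits (α N)) x (α N x) := fun x =>
        (le_sup_right : orbits (α N) ≤ _) (orbits_step _ x)
      have key (n : ℕ) : (orbits (φ N) ⊔ orbits (α N)) (true, 0) (true, Fin.ofNat (N + 1) n) := by
        induction n with
        | zero => exact Setoid.refl' _ _
        | succ n ih =>
          refine Setoid.trans' _ ih ?_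
          have := hφ (true, Fin.ofNat (N + 1) n)
          rw [φ_true] at this
          convert this using 2
          exact Fin.ext (by simp [Fin.val_add])
      obtain ⟨b, i⟩ := x
      have hi := key i
      rw [Fin.ofNat_val_eq_self] at hi
      cases b
      · exact Setoid.trans' _ hi (hα _)
      · exact hi
    have : Subsingleton (Quotient (orbits (φ N) ⊔ orbits (α N))) := ⟨fun a b => by
      induction a, b using Quotient.inductionOn₂ with
      | h a b => exact Quotient.sound (Setoid.trans' _ (Setoid.symm' _ (h a)) (h b))⟩
    exact Finite.card_le_one_iff_subsingleton.2 this
  omega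

/-- The obstruction obtained from a boundary word whose value is a non-trivial element `g`
of the base group. -/
def obstruction (a : ℕ → H) (u : ℕ → ℤˣ) (g : H)
    (hb : Bounds ψ R m ((List.range (N + 1)).map fun i => (a i, u i)))
    (hv : value ψ ((List.range (N + 1)).map fun i => (a i, u i)) = of g) (hg : g ≠ 1)
    (ha : a (N + 1) = g⁻¹ * a 0) : Obstruction ψ R m (Bool × Fin (N + 1)) where
  φ := φ N
  α := α N
  ε x := if x.1 then u x.2 else - u x.2
  κ x := if x.1 then a x.2 else (a (x.2 + 1 : ℕ))⁻¹
  p _ := 1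
  θ x := if x.1 then 1 else a (x.2 + 1 : Fin (N + 1))
  x₀ := (false, Fin.last N)
  inv x := by obtain ⟨b, i⟩ := x; simp
  dead x h := by obtain ⟨b, i⟩ := x; simp at h
  ε_α x _ := by obtain ⟨_ | _, i⟩ := x <;> simp
  p_mem x _ := one_mem _
  p_α x _ := by simp
  face x _ := by
    obtain ⟨_ | _, i⟩ := x
    · refine ⟨_, isFace_false N, ?_, ?_⟩
      · refine List.mem_map.2 ⟨N - i, List.mem_range.2 (by omega), ?_⟩
        rw [Nat.sub_sub_self (by omega), Fin.ofNat_val_eq_self]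
      · have := value_reverse (ψ := ψ) a u (N + 1)
        rw [hv, ha, ← map_inv, ← map_inv, ← map_inv, ← map_mul, ← eq_mul_inv_iff_mul_eq,
          ← map_inv, ← map_mul] at this
        refine Bounds.of_value_eq_one (by simp) ?_
        rw [← map_one of]
        convert this using 2
        · rw [List.map_map]
          refine List.map_congr_left fun i hi => ?_
          rw [List.mem_range] at hi
          simp only [Function.comp_apply, Fin.val_ofNat]
          rw [Nat.mod_eq_of_lt (by omega), show N - i + 1 = N + 1 - i by omega]
          simp
        · simp
    · refine ⟨_, isFace_true N, ?_, ?_⟩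
      · exact List.mem_map.2 ⟨i, List.mem_range.2 i.2, by rw [Fin.ofNat_val_eq_self]⟩
      · convert hb using 1
        rw [List.map_map]
        refine List.map_congr_left fun i hi => ?_
        rw [List.mem_range] at hi
        simp [Nat.mod_eq_of_lt hi]
  planar := planar N
  live := by simp
  bad := by simp [ha, hg.symm]
  good x _ h := by
    obtain ⟨_ | _, i⟩ := x
    · have hi : i ≠ Fin.last N := fun h' => h (by rw [h'])
      simp [Fin.val_add_one_of_lt (Fin.lt_last_iff_ne_last.2 hi)]
    · simp

end Sphere

theorem Bounds.eq_one_of_value_eq_of (hm : 2 ≤ m) (hL : R.L ∣ m) (hlt : R.L < m) (hA : Malnormal A)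
    (hB : Malnormal B) {l : List (H × ℤˣ)} (hl : Bounds ψ R m l) {g : H}
    (h : value ψ l = of g) : g = 1 := by
  by_contra hg
  obtain ⟨N, hN⟩ : ∃ N, l.length = N + 1 :=
    ⟨l.length - 1, by have := hl.two_le_length hm; omega⟩
  let a : ℕ → H := fun i => if h : i < l.length then l[i].1 else g⁻¹ * l[0].1
  let u : ℕ → ℤˣ := fun i => if h : i < l.length then l[i].2 else 1
  have e : (List.range (N + 1)).map (fun i => (a i, u i)) = l := by
    refine List.ext_getElem (by simp [hN]) fun i h1 h2 => ?_
    simp [a, u, h2]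
  rw [← e] at hl h
  have := Sphere.obstruction N a u g hl h hg (by simp [a, hN])
  exact (Obstruction.isEmpty hm hL hlt hA hB).false this

theorem eq_one_of_mem_normalClosure (hm : 2 ≤ m) (hL : R.L ∣ m) (hlt : R.L < m)
    (hA : Malnormal A) (hB : Malnormal B) {g : H}
    (hg : (of g : HNNExtension H A B ψ) ∈
      Subgroup.normalClosure {value ψ (R.posWord m 0)}) : g = 1 := by
  obtain h | ⟨l, h, hl, e⟩ := normalClosure_subset_boundaryValues hm hL hg
  · exact of_injective (φ := ψ) (h.trans (map_one _).symm)
  · have := hl.eq_one_of_value_eq_of hm hL hlt hA hB (g := h⁻¹ * g * h) (by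
      rw [map_mul, map_mul, e, map_inv]; group)
    simpa [inv_mul_eq_iff_eq_mul, mul_assoc] using this

end Relative

namespace Relative

open Monoid CoprodI

section Factors

variable {ι : Type*} {M : ι → Type*} [∀ i, Group (M i)]

variable (M) in
/-- The subgroup of a free product generated by some of the factors. -/
def factors (I : Set ι) : Subgroup (CoprodI M) :=
  Subgroup.closure {x | ∃ i ∈ I, ∃ g : M i, of g = x}

theorem of_mem_factors {I : Set ι} {i : ι} (hi : i ∈ I) (g : M i) : of g ∈ factors M I :=
  Subgroup.subset_closure ⟨i, hi, g, rfl⟩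

theorem factors_mono {I J : Set ι} (h : I ⊆ J) : factors M I ≤ factors M J :=
  Subgroup.closure_mono fun _ ⟨i, hi, hx⟩ => ⟨i, h hi, hx⟩

theorem exists_eq_prod_mul (I : Set ι) (w : Word M) :
    (∀ a ∈ w.toList, a.1 ∈ I) ∨ ∃ (i j : ι) (u : NeWord M i j) (v : CoprodI M), j ∉ I ∧
      v ∈ factors M I ∧ w.fstIdx = some i ∧ w.prod = u.prod * v := by
  induction w using Word.consRecOn with
  | empty => exact Or.inl fun a ha => absurd ha List.not_mem_nil
  | cons k g w h1 h2 ih =>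
    obtain h | ⟨i, j, u, v, hj, hv, hi, e⟩ := ih
    · by_cases hk : k ∈ I
      · left
        intro a ha
        obtain rfl | ha := List.mem_cons.1 ha
        · exact hk
        · exact h a ha
      · right
        refine ⟨k, k, NeWord.singleton g h2, w.prod, hk, ?_, by simp, by simp⟩
        refine Subgroup.list_prod_mem _ fun x hx => ?_
        obtain ⟨a, ha, rfl⟩ := List.mem_map.1 hx
        exact of_mem_factors (h a ha) _
    · right
      have hki : k ≠ i := by
        rintro rfl
        exact h1 hi
      exact ⟨k, j, NeWord.append (NeWord.singleton g h2) hki u, v, hj, hv, by simp,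
        by simp [e, mul_assoc]⟩

variable [DecidableEq ι] [∀ i, DecidableEq (M i)]

theorem mem_of_mem_toList {I : Set ι} {x : CoprodI M} (hx : x ∈ factors M I) :
    ∀ a ∈ (Word.equiv x).toList, a.1 ∈ I := by
  have step {i : ι} (hi : i ∈ I) (g : M i) {y : CoprodI M}
      (hy : ∀ a ∈ (Word.equiv y).toList, a.1 ∈ I) :
      ∀ a ∈ (Word.equiv (of g * y)).toList, a.1 ∈ I := by
    have e : Word.equiv (of g * y) = of g • Word.equiv y :=
      mul_smul (of g) y (Word.empty : Word M)
    rw [e]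
    rintro ⟨j, h⟩ ha
    by_cases hj : j = i
    · exact hj ▸ hi
    · exact hy ⟨j, h⟩ ((Word.mem_smul_iff_of_ne hj).1 ha)
  induction hx using Subgroup.closure_induction_left with
  | one =>
    have : Word.equiv (1 : CoprodI M) = Word.empty :=
      one_smul (CoprodI M) (Word.empty : Word M)
    rw [this]
    intro a ha
    exact absurd ha List.not_mem_nil
  | mul_left x hx y hy ih =>
    obtain ⟨i, hi, g, rfl⟩ := hx
    exact step hi g ih
  | inv_mul_cancel x hx y hy ih =>
    obtain ⟨i, hi, g, rfl⟩ := hx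
    rw [← map_inv]
    exact step hi g⁻¹ ih

theorem equiv_prod (w : Word M) : Word.equiv w.prod = w := Word.equiv.apply_symm_apply w

omit [DecidableEq ι] [∀ i, DecidableEq (M i)] in
theorem malnormal_factors (I : Set ι) : Malnormal (factors M I) := by
  classical
  intro h hh x hx hc
  obtain h' | ⟨i, j, u, v, hj, hv, -, e⟩ := exists_eq_prod_mul I (Word.equiv h)
  · refine (hh ?_).elim
    rw [← Word.equiv.symm_apply_apply h]
    refine Subgroup.list_prod_mem _ fun y hy => ?_
    obtain ⟨a, ha, rfl⟩ := List.mem_map.1 hy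
    exact of_mem_factors (h' a ha) _
  have e' : h = u.prod * v := by rw [← e]; exact (Word.equiv.symm_apply_apply h).symm
  by_contra hx1
  have hy : v * x * v⁻¹ ∈ factors M I := mul_mem (mul_mem hv hx) (inv_mem hv)
  have hy1 : Word.equiv (v * x * v⁻¹) ≠ Word.empty := by
    intro h0
    have := congrArg Word.prod h0
    rw [Word.prod_empty] at this
    have h2 : v * x * v⁻¹ = 1 := (Word.equiv.symm_apply_apply _).symm.trans this
    exact hx1 (by simpa [mul_inv_eq_iff_eq_mul] using h2)
  obtain ⟨p, q, n, hn⟩ := NeWord.of_word _ hy1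
  have hmem := mem_of_mem_toList hy
  rw [← hn] at hmem
  have hp : p ∈ I := hmem ⟨p, n.head⟩ (List.mem_of_mem_head? (by
    rw [show n.toWord.toList = n.toList from rfl, NeWord.toList_head?]; rfl))
  have hq : q ∈ I := hmem ⟨q, n.last⟩ (List.mem_of_mem_getLast? (by
    rw [show n.toWord.toList = n.toList from rfl, NeWord.toList_getLast?]; rfl))
  have hjp : j ≠ p := fun h => hj (h ▸ hp)
  have hqj : q ≠ j := fun h => hj (h ▸ hq)
  let W := NeWord.append (NeWord.append u hjp n) hqj u.inv
  have hW : W.prod = h * x * h⁻¹ := by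
    have hnp : n.prod = v * x * v⁻¹ := by
      rw [NeWord.prod, hn]
      exact Word.equiv.symm_apply_apply _
    simp only [W, NeWord.append_prod, NeWord.inv_prod, hnp, e']
    group
  have hWl := mem_of_mem_toList hc
  rw [← hW, NeWord.prod, equiv_prod] at hWl
  refine hj (hWl ⟨j, u.last⟩ (List.mem_append_left _ (List.mem_append_left _ ?_)))
  exact List.mem_of_mem_getLast? (by rw [NeWord.toList_getLast?]; rfl)

end Factors

end Relative

namespace Relative

section Alternating

open HNNExtension

variable {H : Type*}

/-- The alternating word `b 0 * t * a 0 * t⁻¹ * b 1 * t * ⋯ * b n * t`. -/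
def alternating (a b : ℕ → H) (j : ℕ) : H × ℤˣ :=
  if Even j then (b (j / 2), 1) else (a (j / 2), -1)

theorem alternating_two_mul (a b : ℕ → H) (i : ℕ) : alternating a b (2 * i) = (b i, 1) := by
  rw [alternating, if_pos (by simp), show 2 * i / 2 = i by omega]

theorem alternating_two_mul_add_one (a b : ℕ → H) (i : ℕ) :
    alternating a b (2 * i + 1) = (a i, -1) := by
  rw [alternating, if_neg (by simp), show (2 * i + 1) / 2 = i by omega]

variable [Group H] {A B : Subgroup H}

theorem Relator.posWord_add (R : Relator A B) (m m' : ℕ) (s : ℤ) :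
    R.posWord (m + m') s = R.posWord m s ++ R.posWord m' (s + m) := by
  simp [posWord, List.range_add, Function.comp_def, add_assoc]

theorem Relator.value_posWord_mul (R : Relator A B) (ψ : A ≃* B) (k : ℕ) :
    value ψ (R.posWord (k * R.L) 0) = value ψ (R.posWord R.L 0) ^ k := by
  induction k with
  | zero => simp [posWord]
  | succ k ih =>
    rw [Nat.succ_mul, R.posWord_add, value_append, ih, pow_succ,
      R.posWord_congr R.L (i := 0 + (k * R.L : ℕ)) (j := 0)
        (by rw [zero_add, zero_sub, dvd_neg, Nat.cast_mul]; exact dvd_mul_left _ _)]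

theorem value_alternating_succ (ψ : A ≃* B) (a b : ℕ → H) (n : ℕ) :
    value ψ ((List.range (2 * (n + 1) + 1)).map (alternating a b)) =
      value ψ ((List.range (2 * n + 1)).map (alternating a b)) *
        (of (a n) * t⁻¹ * of (b (n + 1)) * t) := by
  rw [show 2 * (n + 1) + 1 = 2 * n + 1 + 1 + 1 by ring, List.range_succ, List.range_succ]
  have := alternating_two_mul a b (n + 1)
  rw [mul_add_one] at this
  simp [alternating_two_mul_add_one, this, mul_assoc]

theorem exists_eq_add_mul (n : ℕ) (j : ℤ) :
    ∃ (q : ℤ) (r : ℕ), r < 2 * n + 1 ∧ j = r + (2 * n + 1 : ℕ) * q := by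
  have h0 : ((2 * n + 1 : ℕ) : ℤ) ≠ 0 := by omega
  obtain ⟨r, hr⟩ := Int.eq_ofNat_of_zero_le (Int.emod_nonneg j h0)
  refine ⟨j / (2 * n + 1 : ℕ), r, ?_, ?_⟩
  · have := Int.emod_lt_of_pos j (show (0 : ℤ) < (2 * n + 1 : ℕ) by omega)
    omega
  · rw [← hr, Int.emod_add_mul_ediv]

/-- The residue modulo `2 * n + 1`. -/
def residue (n : ℕ) (j : ℤ) : ℕ := (j % (2 * n + 1 : ℕ)).toNat

theorem residue_add_mul {n r : ℕ} (hr : r < 2 * n + 1) (q : ℤ) :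
    residue n (r + (2 * n + 1 : ℕ) * q) = r := by
  rw [residue, Int.add_mul_emod_self_left, Int.emod_eq_of_lt (by omega) (by omega),
    Int.toNat_natCast]

theorem dvd_iff_residue {n : ℕ} {j : ℤ} : ((2 * n + 1 : ℕ) : ℤ) ∣ j ↔ residue n j = 0 := by
  have h0 := Int.emod_nonneg j (show ((2 * n + 1 : ℕ) : ℤ) ≠ 0 by omega)
  rw [Int.dvd_iff_emod_eq_zero, residue]
  omega

theorem residue_sub_one {n : ℕ} (j : ℤ) :
    residue n j = 0 ∧ residue n (j - 1) = 2 * n ∨ residue n j = residue n (j - 1) + 1 := by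
  obtain ⟨q, r, hr, rfl⟩ := exists_eq_add_mul n j
  rw [residue_add_mul hr]
  obtain rfl | r := r
  · left
    have := residue_add_mul (n := n) (r := 2 * n) (by omega) (q - 1)
    refine ⟨rfl, ?_⟩
    rw [show ((0 : ℕ) : ℤ) + (2 * n + 1 : ℕ) * q - 1 =
      ((2 * n : ℕ) : ℤ) + (2 * n + 1 : ℕ) * (q - 1) by push_cast; ring, this]
  · right
    have := residue_add_mul (n := n) (r := r) (by omega) q
    rw [show ((r + 1 : ℕ) : ℤ) + (2 * n + 1 : ℕ) * q - 1 = r + (2 * n + 1 : ℕ) * q by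
      push_cast; ring, this]

/-- The relator reading an alternating word. -/
def alternatingRelator (a b : ℕ → H) (n : ℕ) (hn : n ≠ 0) (ha : ∀ i < n, a i ∉ A)
    (hb : ∀ i < n, b (i + 1) ∉ B) : Relator A B where
  L := 2 * n + 1
  three_le := by omega
  c j := (alternating a b (residue n j)).1
  e j := (alternating a b (residue n j)).2
  c_periodic j := by simp only [residue, Int.add_emod_right]
  e_periodic j := by simp only [residue, Int.add_emod_right]
  e_eq_iff j := by
    rw [dvd_iff_residue]
    obtain ⟨h1, h2⟩ | h1 := residue_sub_one (n := n) j
    · simp [h1, h2, alternating]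
    · simp only [h1, alternating, Nat.even_add_one]
      by_cases h : Even (residue n (j - 1)) <;> simp [h]
  e_zero := by simp [residue, alternating]
  notMem j hj := by
    rw [dvd_iff_residue] at hj
    have h1 := (residue_sub_one (n := n) j).resolve_left fun h => hj h.1
    have hlt : residue n j < 2 * n + 1 := by
      obtain ⟨q, r, hr, rfl⟩ := exists_eq_add_mul n j
      rwa [residue_add_mul hr]
    rw [h1] at hlt ⊢
    obtain ⟨i, hi | hi⟩ := Nat.even_or_odd' (residue n (j - 1))
    · rw [hi, alternating_two_mul, alternating_two_mul_add_one]
      exact ha i (by omega)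
    · rw [hi, show 2 * i + 1 + 1 = 2 * (i + 1) by ring, alternating_two_mul,
        alternating_two_mul_add_one]
      exact hb i (by omega)

theorem posWord_alternatingRelator (a b : ℕ → H) (n : ℕ) (hn : n ≠ 0) (ha : ∀ i < n, a i ∉ A)
    (hb : ∀ i < n, b (i + 1) ∉ B) :
    (alternatingRelator a b n hn ha hb).posWord (2 * n + 1) 0 =
      (List.range (2 * n + 1)).map (alternating a b) := by
  refine List.map_congr_left fun i hi => ?_
  have := residue_add_mul (List.mem_range.1 hi) 0
  simp only [mul_zero, add_zero] at this
  simp [alternatingRelator, this]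

end Alternating

end Relative

namespace Relative

open Monoid

section Tower

variable {G : Type*} [Group G]

variable (G) in
/-- The free product of copies of a group indexed by the integers. -/
abbrev Tower : Type _ := CoprodI fun _ : ℤ => G

/-- The inclusion of a copy of `G`. -/
def copy (j : ℤ) : G →* Tower G := CoprodI.of (M := fun _ : ℤ => G) (i := j)

/-- The translation of the copies of `G` by `n`. -/
def translate (n : ℤ) : Tower G →* Tower G := CoprodI.lift fun j => copy (j + n)

@[simp] theorem translate_copy (n j : ℤ) (g : G) : translate n (copy j g) = copy (j + n) g :=
  CoprodI.lift_of (fun j => copy (j + n)) g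

theorem translate_neg_comp_translate (n : ℤ) : (translate (-n)).comp (translate n) = MonoidHom.id (Tower G) := by
  refine CoprodI.ext_hom _ _ fun j => MonoidHom.ext fun g => ?_
  change translate (-n) (translate n (copy j g)) = copy j g
  simp

theorem translate_injective (n : ℤ) : Function.Injective (translate n : Tower G →* Tower G) :=
  Function.LeftInverse.injective fun h => DFunLike.congr_fun (translate_neg_comp_translate n) h

/-- The embedding of the tower in `F` whose `j`-th copy of `G` is conjugate to `G` by `t ^ j`. -/
def embed : Tower G →* FP G :=
  CoprodI.lift fun j => (MulAut.conj (tgen G ^ j)).toMonoidHom.comp (emb G)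

theorem embed_copy (j : ℤ) (g : G) :
    embed (copy j g) = tgen G ^ j * emb G g * (tgen G ^ j)⁻¹ :=
  CoprodI.lift_of (fun j => (MulAut.conj (tgen G ^ j)).toMonoidHom.comp (emb G)) g

theorem embed_translate (n : ℤ) (h : Tower G) :
    embed (translate n h) = tgen G ^ n * embed h * (tgen G ^ n)⁻¹ := by
  suffices embed.comp (translate n) = (MulAut.conj (tgen G ^ n)).toMonoidHom.comp (embed (G := G)) from
    DFunLike.congr_fun this h
  refine CoprodI.ext_hom _ _ fun j => MonoidHom.ext fun g => ?_
  change embed (translate n (copy j g)) = tgen G ^ n * embed (copy j g) * (tgen G ^ n)⁻¹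
  rw [translate_copy, embed_copy, embed_copy, add_comm, zpow_add]
  group

theorem expSum_embed (h : Tower G) : expSum G (embed h) = 1 := by
  suffices (expSum G).comp embed = 1 from DFunLike.congr_fun this h
  refine CoprodI.ext_hom _ _ fun j => MonoidHom.ext fun g => ?_
  change expSum G (embed (copy j g)) = 1
  rw [embed_copy]
  simp [expSum, emb]

theorem exists_eq_embed_mul_zpow (w : FP G) : ∃ (h : Tower G) (n : ℤ), w = embed h * tgen G ^ n := by
  have mul {x y : FP G} (hx : ∃ (h : Tower G) (n : ℤ), x = embed h * tgen G ^ n)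
      (hy : ∃ (h : Tower G) (n : ℤ), y = embed h * tgen G ^ n) :
      ∃ (h : Tower G) (n : ℤ), x * y = embed h * tgen G ^ n := by
    obtain ⟨h, n, rfl⟩ := hx
    obtain ⟨h', n', rfl⟩ := hy
    refine ⟨h * translate n h', n + n', ?_⟩
    rw [map_mul, embed_translate, zpow_add]
    group
  induction w using Coprod.induction_on with
  | inl g => exact ⟨copy 0 g, 0, by simp [embed_copy, emb]⟩
  | inr x =>
    induction x using FreeGroup.induction_on with
    | C1 => exact ⟨1, 0, by simp⟩
    | of u => exact ⟨1, 1, by simp [tgen]⟩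
    | inv_of u _ => exact ⟨1, -1, by simp [tgen]⟩
    | mul x y hx hy => rw [map_mul]; exact mul hx hy
  | mul x y hx hy => exact mul hx hy

theorem map_translate_factors (n : ℤ) (I : Set ℤ) :
    (factors (fun _ : ℤ => G) I).map (translate n) = factors (fun _ : ℤ => G) ((· + n) '' I) := by
  rw [factors, MonoidHom.map_closure, factors]
  congr 1
  ext x
  constructor
  · rintro ⟨_, ⟨i, hi, g, rfl⟩, rfl⟩
    exact ⟨i + n, ⟨i, hi, rfl⟩, g, (translate_copy n i g).symm⟩
  · rintro ⟨_, ⟨i, hi, rfl⟩, g, rfl⟩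
    exact ⟨copy i g, ⟨i, hi, g, rfl⟩, translate_copy n i g⟩

variable (G) in
/-- The subgroup of the tower generated by the copies of `G` at `0, …, s - 1`. -/
def window (s : ℕ) : Subgroup (Tower G) := factors (fun _ : ℤ => G) (Set.Ico 0 (s : ℤ))

theorem window_mono {r s : ℕ} (h : r ≤ s) : window G r ≤ window G s :=
  factors_mono (Set.Ico_subset_Ico_right (by exact_mod_cast h))

theorem copy_mem_window {s : ℕ} {j : ℤ} (h0 : 0 ≤ j) (h : j < s) (g : G) :
    copy j g ∈ window G s :=
  of_mem_factors (M := fun _ : ℤ => G) (Set.mem_Ico.2 ⟨h0, h⟩) g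

theorem map_translate_window_le (r : ℕ) : (window G r).map (translate 1) ≤ window G (r + 1) := by
  rw [window, map_translate_factors]
  refine factors_mono ?_
  rintro _ ⟨i, hi, rfl⟩
  simp only [Set.mem_Ico] at hi ⊢
  omega

theorem exists_mem_factors (h : Tower G) :
    ∃ N : ℕ, h ∈ factors (fun _ : ℤ => G) (Set.Ico (-N : ℤ) N) := by
  induction h using CoprodI.induction_on with
  | one => exact ⟨0, one_mem _⟩
  | of i g =>
    exact ⟨i.natAbs + 1, of_mem_factors (M := fun _ : ℤ => G) (Set.mem_Ico.2 (by omega)) g⟩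
  | mul x y hx hy =>
    obtain ⟨N, hx⟩ := hx
    obtain ⟨N', hy⟩ := hy
    exact ⟨max N N', mul_mem
      (factors_mono (Set.Ico_subset_Ico (by simp) (by simp)) hx)
      (factors_mono (Set.Ico_subset_Ico (by simp) (by simp)) hy)⟩

theorem exists_mem_window_isConj {w : FP G} (hw : Unimodular w) :
    ∃ s : ℕ, ∃ h ∈ window G s, IsConj w (embed h * tgen G) := by
  obtain ⟨h, n, rfl⟩ := exists_eq_embed_mul_zpow w
  obtain rfl : n = 1 := by
    have : expSum G (tgen G) = Multiplicative.ofAdd 1 := by simp [expSum, tgen]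
    rw [Unimodular, map_mul, expSum_embed, one_mul, map_zpow, this, ← ofAdd_zsmul] at hw
    simpa using hw
  obtain ⟨N, hN⟩ := exists_mem_factors h
  refine ⟨2 * N, translate N h, ?_, isConj_iff.2 ⟨tgen G ^ (N : ℤ), ?_⟩⟩
  · have := Subgroup.mem_map_of_mem (translate N) hN
    rw [map_translate_factors] at this
    refine factors_mono ?_ this
    rintro _ ⟨i, hi, rfl⟩
    simp only [Set.mem_Ico] at hi ⊢
    omega
  · rw [embed_translate]
    group

theorem exists_eq_copy {h : Tower G} (hh : h ∈ window G 1) : ∃ g, copy 0 g = h := by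
  suffices window G 1 ≤ (copy 0).range from this hh
  refine (Subgroup.closure_le _).2 ?_
  rintro _ ⟨i, hi, g, rfl⟩
  obtain rfl : i = 0 := by
    simp only [Set.mem_Ico] at hi
    omega
  exact ⟨g, rfl⟩

end Tower

section Reduction

variable {G : Type*} [Group G]

/-- The product of the elements `translate 1 p.1 * p.2`. -/
def pairProd (l : List (Tower G × Tower G)) : Tower G := (l.map fun p => translate 1 p.1 * p.2).prod

@[simp] theorem pairProd_nil : pairProd ([] : List (Tower G × Tower G)) = 1 := rfl

@[simp] theorem pairProd_cons (p : Tower G × Tower G) (l : List (Tower G × Tower G)) :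
    pairProd (p :: l) = translate 1 p.1 * p.2 * pairProd l := List.prod_cons

@[simp] theorem pairProd_append (l l' : List (Tower G × Tower G)) :
    pairProd (l ++ l') = pairProd l * pairProd l' := by
  simp [pairProd]

theorem exists_eq_mul_pairProd {r : ℕ} {h : Tower G} (hh : h ∈ window G (r + 2)) :
    ∃ b ∈ window G (r + 1), ∃ l : List (Tower G × Tower G),
      (∀ p ∈ l, p.1 ∈ window G (r + 1) ∧ p.2 ∈ window G (r + 1)) ∧ h = b * pairProd l := by
  have step {i : ℤ} (hi : i ∈ Set.Ico 0 ((r + 2 : ℕ) : ℤ)) (g : G) {y : Tower G}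
      (hy : ∃ b ∈ window G (r + 1), ∃ l : List (Tower G × Tower G),
        (∀ p ∈ l, p.1 ∈ window G (r + 1) ∧ p.2 ∈ window G (r + 1)) ∧ y = b * pairProd l) :
      ∃ b ∈ window G (r + 1), ∃ l : List (Tower G × Tower G),
        (∀ p ∈ l, p.1 ∈ window G (r + 1) ∧ p.2 ∈ window G (r + 1)) ∧
          copy i g * y = b * pairProd l := by
    obtain ⟨b, hb, l, hl, rfl⟩ := hy
    obtain ⟨h0, h1⟩ := Set.mem_Ico.1 hi
    obtain rfl | h0 := h0.eq_or_lt
    · exact ⟨copy 0 g * b, mul_mem (copy_mem_window le_rfl (by omega) g) hb, l, hl,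
        (mul_assoc _ _ _).symm⟩
    · refine ⟨1, one_mem _, (copy (i - 1) g, b) :: l, ?_, by simp [mul_assoc]⟩
      rintro p (_ | ⟨_, hp⟩)
      · exact ⟨copy_mem_window (by omega) (by omega) g, hb⟩
      · exact hl p hp
  induction hh using Subgroup.closure_induction_left with
  | one => exact ⟨1, one_mem _, [], by simp, by simp⟩
  | mul_left x hx y hy ih =>
    obtain ⟨i, hi, g, rfl⟩ := hx
    exact step hi g ih
  | inv_mul_cancel x hx y hy ih =>
    obtain ⟨i, hi, g, rfl⟩ := hx
    rw [← map_inv]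
    exact step hi g⁻¹ ih

theorem exists_reduced {w : FP G} {A M : Subgroup (Tower G)} (hA : A ≤ M)
    (hB : A.map (translate 1) ≤ M) (b : Tower G) (hb : b ∈ M) (l : List (Tower G × Tower G))
    (hl : ∀ p ∈ l, p.1 ∈ M ∧ p.2 ∈ M) (hw : IsConj w (embed (b * pairProd l) * tgen G)) :
    ∃ b ∈ M, ∃ l : List (Tower G × Tower G), (∀ p ∈ l, p.1 ∈ M ∧ p.2 ∈ M) ∧
      IsConj w (embed (b * pairProd l) * tgen G) ∧
        ∀ p ∈ l, p.1 ∉ A ∧ p.2 ∉ A.map (translate 1) := by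
  induction hn : l.length using Nat.strong_induction_on generalizing b l with
  | _ n ih =>
  subst hn
  by_cases hred : ∀ p ∈ l, p.1 ∉ A ∧ p.2 ∉ A.map (translate 1)
  · exact ⟨b, hb, l, hl, hw, hred⟩
  push Not at hred
  obtain ⟨⟨x, y⟩, hp, hxy⟩ := hred
  obtain ⟨l₁, l₂, rfl⟩ := List.append_of_mem hp
  obtain ⟨hx, hy⟩ := hl _ hp
  by_cases hxA : x ∈ A
  · have hc := mul_mem (hB (Subgroup.mem_map_of_mem _ hxA)) hy
    obtain rfl | ⟨l₁, ⟨x', y'⟩, rfl⟩ := l₁.eq_nil_or_concat'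
    · refine ih l₂.length (by simp) (b * (translate 1 x * y)) (mul_mem hb hc) l₂
        (fun p hp => hl p (by simp [hp])) ?_ rfl
      simpa [mul_assoc] using hw
    · have h' := hl (x', y') (by simp)
      refine ih _ (by simp) b hb (l₁ ++ (x', y' * (translate 1 x * y)) :: l₂) ?_ ?_ rfl
      · simp only [List.mem_append, List.mem_cons]
        rintro p (hp | rfl | hp)
        · exact hl p (by simp [hp])
        · exact ⟨h'.1, mul_mem h'.2 hc⟩
        · exact hl p (by simp [hp])
      · simpa [mul_assoc] using hw
  · obtain ⟨z, hz, rfl⟩ := hxy hxA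
    obtain - | ⟨⟨x', y'⟩, l₂⟩ := l₂
    · refine ih l₁.length (by simp) (x * z * b) (mul_mem (mul_mem hx (hA hz)) hb) l₁
        (fun p hp => hl p (by simp [hp])) (hw.trans (isConj_iff.2 ⟨embed (x * z), ?_⟩)) rfl
      simp [embed_translate, mul_assoc]
    · have h' := hl (x', y') (by simp)
      refine ih _ (by simp) b hb (l₁ ++ (x * z * x', y') :: l₂) ?_ ?_ rfl
      · simp only [List.mem_append, List.mem_cons]
        rintro p (hp | rfl | hp)
        · exact hl p (by simp [hp])
        · exact ⟨mul_mem (mul_mem hx (hA hz)) h'.1, h'.2⟩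
        · exact hl p (by simp [hp])
      · simpa [mul_assoc] using hw

theorem map_mem_normalClosure {F K : Type*} [Group F] [Group K] (f : F →* K) {w x : F}
    (h : IsConj w x) (k : ℕ) {g : F} (hg : g ∈ Subgroup.normalClosure {w ^ k}) :
    f g ∈ Subgroup.normalClosure {f x ^ k} := by
  suffices Subgroup.normalClosure {w ^ k} ≤ (Subgroup.normalClosure {f x ^ k}).comap f from this hg
  refine Subgroup.normalClosure_le_normal (Set.singleton_subset_iff.2 ?_)
  obtain ⟨c, hc⟩ := isConj_iff.1 h.symm
  have := Subgroup.normalClosure_normal.conj_mem _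
    (Subgroup.subset_normalClosure (Set.mem_singleton (f x ^ k))) (f c)
  rw [← hc, conj_pow, SetLike.mem_coe, Subgroup.mem_comap, map_mul, map_mul, map_inv, map_pow]
  exact this

end Reduction

section Descent

open HNNExtension

variable {G : Type*} [Group G]

/-- The isomorphism of a subgroup of the tower with its translate. -/
noncomputable def translateEquiv (A : Subgroup (Tower G)) : A ≃* A.map (translate 1) :=
  A.equivMapOfInjective (translate 1) (translate_injective 1)

/-- The homomorphism from `F` to an HNN extension of the tower. -/
noncomputable def toHNN (A : Subgroup (Tower G)) :
    FP G →* HNNExtension (Tower G) A (A.map (translate 1)) (translateEquiv A) :=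
  Coprod.lift (of.comp (copy 0)) (FreeGroup.lift fun _ => t)

@[simp] theorem toHNN_emb (A : Subgroup (Tower G)) (g : G) :
    toHNN A (emb G g) = of (copy 0 g) := by
  simp [toHNN, emb]

@[simp] theorem toHNN_tgen (A : Subgroup (Tower G)) : toHNN A (tgen G) = t := by
  simp [toHNN, tgen]

theorem toHNN_embed {r : ℕ} {h : Tower G} (hh : h ∈ window G (r + 1)) :
    toHNN (window G r) (embed h) = of h := by
  suffices window G (r + 1) ≤ ((toHNN (window G r)).comp embed).eqLocus of from this hh
  refine (Subgroup.closure_le _).2 ?_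
  rintro _ ⟨i, hi, g, rfl⟩
  obtain ⟨h0, h1⟩ := Set.mem_Ico.1 hi
  lift i to ℕ using h0
  change toHNN (window G r) (embed (copy i g)) = of (copy i g)
  clear hi
  induction i with
  | zero => simp [embed_copy]
  | succ i ih =>
    have e : (copy (i + 1 : ℕ) g : Tower G) = translate 1 (copy i g) := by simp
    have := equiv_eq_conj (φ := translateEquiv (window G r))
      ⟨copy i g, copy_mem_window (by omega) (by omega) g⟩
    rw [e, embed_translate, zpow_one, map_mul, map_mul, map_inv, toHNN_tgen, ih (by omega)]
    exact this.symm

theorem value_alternating_getD {H : Type*} [Group H] {A B : Subgroup H} (ψ : A ≃* B) (b : H)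
    (l : List (H × H)) {n : ℕ} (hn : n ≤ l.length) :
    value ψ ((List.range (2 * n + 1)).map (alternating (fun i => (l.getD i (1, 1)).1)
      fun i => (((1, b) :: l).getD i (1, 1)).2)) =
      of b * t * ((l.take n).map fun p => of p.1 * t⁻¹ * of p.2 * t).prod := by
  induction n with
  | zero => simp [alternating]
  | succ n ih =>
    rw [value_alternating_succ, ih (by omega), List.take_succ_eq_append_getElem (by omega)]
    have h : n < l.length := by omega
    simp [h, mul_assoc]

theorem toHNN_embed_mul_tgen {r : ℕ} {b : Tower G} (hb : b ∈ window G (r + 1))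
    {l : List (Tower G × Tower G)}
    (hl : ∀ p ∈ l, p.1 ∈ window G (r + 1) ∧ p.2 ∈ window G (r + 1)) :
    toHNN (window G r) (embed (b * pairProd l) * tgen G) =
      of b * t * (l.map fun p => of p.1 * t⁻¹ * of p.2 * t).prod := by
  have h : toHNN (window G r) (embed (pairProd l)) * t =
      t * (l.map fun p => of p.1 * t⁻¹ * of p.2 * t).prod := by
    induction l with
    | nil => simp
    | cons p l ih =>
      obtain ⟨h1, h2⟩ := hl p (by simp)
      rw [pairProd_cons, map_mul, map_mul, mul_assoc, ih fun q hq => hl q (by simp [hq])]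
      simp [embed_translate, toHNN_embed h1, toHNN_embed h2, mul_assoc]
  rw [map_mul, map_mul, map_mul, toHNN_embed hb, toHNN_tgen, mul_assoc, h, mul_assoc]

theorem copy_injective (j : ℤ) : Function.Injective (copy j : G →* Tower G) :=
  CoprodI.of_injective (M := fun _ : ℤ => G) j

theorem eq_one_of_emb_mem_normalClosure {w : FP G} (hw : Unimodular w) {k : ℕ} (hk : 2 ≤ k) {g : G}
    (hg : emb G g ∈ Subgroup.normalClosure {w ^ k}) : g = 1 := by
  classical
  have hex := exists_mem_window_isConj hw
  obtain ⟨h, hh, hc⟩ := Nat.find_spec hex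
  have hmin {s : ℕ} (hs : s < Nat.find hex) := Nat.find_min hex hs
  generalize Nat.find hex = s at hh hmin
  obtain hs | ⟨r, rfl⟩ : s ≤ 1 ∨ ∃ r, s = r + 2 := by
    obtain hs | hs := le_or_gt s 1
    · exact Or.inl hs
    · exact Or.inr ⟨s - 2, by omega⟩
  · obtain ⟨x, rfl⟩ := exists_eq_copy (window_mono hs hh)
    have := map_mem_normalClosure (Coprod.lift (MonoidHom.id G) (FreeGroup.lift fun _ => x⁻¹)) hc k hg
    rw [← Subgroup.mem_bot, ← Subgroup.normalClosure_eq_self (⊥ : Subgroup G), Subgroup.coe_bot]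
    simpa [embed_copy, emb, tgen] using this
  · obtain ⟨b, hb, l, hl, rfl⟩ := exists_eq_mul_pairProd hh
    obtain ⟨b, hb, l, hl, hc, hred⟩ := exists_reduced (window_mono r.le_succ)
      (map_translate_window_le r) b hb l hl hc
    have hn : l.length ≠ 0 := by
      rintro h
      obtain rfl := List.length_eq_zero_iff.1 h
      exact hmin (s := r + 1) (by omega) ⟨b, hb, by simpa using hc⟩
    let R : Relator (window G r) ((window G r).map (translate 1)) :=
      alternatingRelator (fun i => (l.getD i (1, 1)).1) (fun i => (((1, b) :: l).getD i (1, 1)).2)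
        l.length hn (fun i hi => by simpa [hi] using (hred l[i] (List.getElem_mem hi)).1)
        fun i hi => by
          rw [List.getD_cons_succ, List.getD_eq_getElem _ _ hi]
          exact (hred l[i] (List.getElem_mem hi)).2
    have hR : value (translateEquiv (window G r)) (R.posWord (k * R.L) 0) =
        toHNN (window G r) (embed (b * pairProd l) * tgen G) ^ k := by
      rw [R.value_posWord_mul, toHNN_embed_mul_tgen hb hl]
      congr 1
      refine (congrArg _ (posWord_alternatingRelator _ _ _ hn _ _)).trans ?_
      rw [value_alternating_getD _ _ _ le_rfl, List.take_length]
    have h3 := R.three_le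
    have hB : Malnormal ((window G r).map (translate 1)) := by
      rw [window, map_translate_factors]
      exact malnormal_factors _
    have := map_mem_normalClosure (toHNN (window G r)) hc k hg
    rw [toHNN_emb, ← hR] at this
    have := eq_one_of_mem_normalClosure (by nlinarith) (dvd_mul_left _ _) (by nlinarith)
      (malnormal_factors _) hB this
    exact copy_injective 0 (this.trans (map_one _).symm)

end Descent

end Relative
theorem natural_embedding {G : Type*} [Group G] (w : FP G) (hw : Unimodular w)
    (k : ℕ) (hk : 2 ≤ k) :
    Function.Injective
      ((QuotientGroup.mk' (Subgroup.normalClosure {w ^ k})).comp (emb G)) := by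
  rw [injective_iff_map_eq_one]
  intro g hg
  exact Relative.eq_one_of_emb_mem_normalClosure hw hk ((QuotientGroup.eq_one_iff _).1 hg)
end

section
/- Any equation of the form (w(t))^k = 1 with unimodular left-hand side and k ≥ 2 is solvable over any group G: if w ∈ F is unimodular and k ≥ 2, then there exist a group H, an injective group homomorphism f : G → H, and an element h ∈ H such that the homomorphism F → H that extends f and sends t to h maps w^k to the identity of H. -/
namespace UnimodularPower

open Monoid Monoid.CoprodI

section FreeProducts

theorem neWord_prod_ne_one {ι : Type*} {M : ι → Type*} [∀ i, Group (M i)] {i j : ι}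
    (w : NeWord M i j) : w.prod ≠ 1 := by
  classical
  intro h
  have h' : w.toWord = Word.empty := by
    apply Word.equiv.symm.injective
    change w.toWord.prod = Word.empty.prod
    rw [Word.prod_empty]
    exact h
  exact w.toList_ne_nil (congrArg Word.toList h')

theorem exists_neWord_of_ne_one {ι : Type*} {M : ι → Type*} [∀ i, Group (M i)]
    {x : CoprodI M} (hx : x ≠ 1) : ∃ (i j : ι) (w : NeWord M i j), w.prod = x := by
  classical
  obtain ⟨i, j, w, hw⟩ := NeWord.of_word (Word.equiv x) (by
    intro h
    apply hx
    rw [← Word.equiv.symm_apply_apply x, h]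
    exact Word.prod_empty)
  refine ⟨i, j, w, ?_⟩
  rw [NeWord.prod, hw]
  exact Word.equiv.symm_apply_apply x

/-- Homomorphisms into a free product jointly define an embedding of a free product if the
reduced forms of images of nontrivial elements of distinct factors begin and end in disjoint
sets of factors. -/
theorem lift_injective_of_neWord {ι κ : Type*} {M : ι → Type*} {N : κ → Type*}
    [∀ i, Group (M i)] [∀ i, Group (N i)] (f : ∀ i, M i →* CoprodI N) (c : κ → ι)
    (h : ∀ i (x : M i), x ≠ 1 →
      ∃ (a b : κ) (w : NeWord N a b), w.prod = f i x ∧ c a = i ∧ c b = i) :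
    Function.Injective (CoprodI.lift f) := by
  have key : ∀ {i j : ι} (w : NeWord M i j), ∃ (a b : κ) (v : NeWord N a b),
      v.prod = CoprodI.lift f w.prod ∧ c a = i ∧ c b = j := by
    intro i j w
    induction w with
    | singleton x hx => simpa using h _ x hx
    | append w₁ hne w₂ h₁ h₂ =>
      obtain ⟨a, b, v, hv, ha, hb⟩ := h₁
      obtain ⟨a', b', v', hv', ha', hb'⟩ := h₂
      refine ⟨a, b', .append v (fun e => hne (by rw [← hb, ← ha', e])) v', ?_, ha, hb'⟩
      simp [hv, hv']
  rw [injective_iff_map_eq_one]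
  intro x hx
  by_contra hne
  obtain ⟨i, j, w, rfl⟩ := exists_neWord_of_ne_one hne
  obtain ⟨a, b, v, hv, -, -⟩ := key w
  exact neWord_prod_ne_one v (hv.trans hx)

variable {G : Type*} [Group G]

/-- The homomorphism between free products of copies of `G` induced by a map of index sets. -/
def reindex (G : Type*) [Group G] {ι κ : Type*} (e : ι → κ) :
    CoprodI (fun _ : ι => G) →* CoprodI (fun _ : κ => G) :=
  CoprodI.lift fun i => CoprodI.of (M := fun _ : κ => G) (i := e i)

@[simp]
theorem reindex_of {ι κ : Type*} (e : ι → κ) (i : ι) (g : G) :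
    reindex G e (CoprodI.of (M := fun _ : ι => G) (i := i) g) =
      CoprodI.of (M := fun _ : κ => G) (i := e i) g :=
  CoprodI.lift_of (M := fun _ : ι => G) _ g

theorem exists_neWord_reindex {ι κ : Type*} {e : ι → κ} (he : Function.Injective e) {i j : ι}
    (w : NeWord (fun _ : ι => G) i j) :
    ∃ v : NeWord (fun _ : κ => G) (e i) (e j), v.prod = reindex G e w.prod := by
  induction w with
  | singleton x hx => exact ⟨.singleton x hx, by simp⟩
  | append w₁ hne w₂ h₁ h₂ =>
    obtain ⟨v₁, h₁⟩ := h₁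
    obtain ⟨v₂, h₂⟩ := h₂
    exact ⟨.append v₁ (fun e => hne (he e)) v₂, by simp [h₁, h₂]⟩

/-- Splitting off the maximal initial segment not involving the last factor. -/
theorem exists_eq_castSucc_mul {m : ℕ} {i j : Fin (m + 1)} (w : NeWord (fun _ : Fin (m + 1) => G) i j) :
    (∃ p, w.prod = reindex G Fin.castSucc p) ∨
      ∃ p, ∃ v : NeWord (fun _ : Fin (m + 1) => G) (Fin.last m) j,
        w.prod = reindex G Fin.castSucc p * v.prod := by
  induction w with
  | @singleton i x hx =>
    rcases Fin.eq_castSucc_or_eq_last i with ⟨i, rfl⟩ | rfl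
    · exact .inl ⟨CoprodI.of (i := i) x, by simp⟩
    · exact .inr ⟨1, .singleton x hx, by simp⟩
  | append w₁ hne w₂ h₁ h₂ =>
    rcases h₁ with ⟨p, hp⟩ | ⟨p, v, hv⟩
    · rcases h₂ with ⟨q, hq⟩ | ⟨q, v, hv⟩
      · exact .inl ⟨p * q, by simp [hp, hq]⟩
      · exact .inr ⟨p * q, v, by simp [hp, hv, mul_assoc]⟩
    · exact .inr ⟨p, .append v hne w₂, by simp [hv, mul_assoc]⟩

/-- Splitting off the maximal final segment not involving the first factor. -/
theorem exists_eq_mul_succ {m : ℕ} {i j : Fin (m + 1)} (w : NeWord (fun _ : Fin (m + 1) => G) i j) :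
    (∃ q, w.prod = reindex G Fin.succ q) ∨
      ∃ q, ∃ v : NeWord (fun _ : Fin (m + 1) => G) i 0,
        w.prod = v.prod * reindex G Fin.succ q := by
  induction w with
  | @singleton i x hx =>
    rcases Fin.eq_zero_or_eq_succ i with rfl | ⟨i, rfl⟩
    · exact .inr ⟨1, .singleton x hx, by simp⟩
    · exact .inl ⟨CoprodI.of (i := i) x, by simp⟩
  | append w₁ hne w₂ h₁ h₂ =>
    rcases h₂ with ⟨q, hq⟩ | ⟨q, v, hv⟩
    · rcases h₁ with ⟨p, hp⟩ | ⟨p, v, hv⟩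
      · exact .inl ⟨p * q, by simp [hp, hq]⟩
      · exact .inr ⟨p * q, v, by simp [hq, hv, mul_assoc]⟩
    · exact .inr ⟨q, .append w₁ hne v, by simp [hv, mul_assoc]⟩

theorem exists_doubleCoset_neWord {m : ℕ} (u : CoprodI fun _ : Fin (m + 1) => G)
    (hu : ∀ p q, u ≠ reindex G Fin.castSucc p * reindex G Fin.succ q) :
    ∃ p q, ∃ v : NeWord (fun _ : Fin (m + 1) => G) (Fin.last m) 0,
      u = reindex G Fin.castSucc p * v.prod * reindex G Fin.succ q := by
  have hu1 : u ≠ 1 := by simpa using hu 1 1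
  obtain ⟨i, j, w, rfl⟩ := exists_neWord_of_ne_one hu1
  rcases exists_eq_castSucc_mul w with ⟨p, hp⟩ | ⟨p, v, hv⟩
  · exact absurd hp (by simpa using hu p 1)
  · rcases exists_eq_mul_succ v with ⟨q, hq⟩ | ⟨q, v', hv'⟩
    · exact absurd (by rw [hv, hq]) (hu p q)
    · exact ⟨p, q, v', by rw [hv, hv', mul_assoc]⟩

end FreeProducts

theorem exists_amalgam {D L K : Type u} [Group D] [Group L] [Group K] (α : D →* L) (β : D →* K)
    (hα : Function.Injective α) (hβ : Function.Injective β) :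
    ∃ (X : Type u) (_ : Group X) (i : L →* X) (j : K →* X),
      Function.Injective i ∧ ∀ d, i (α d) = j (β d) := by
  let φ : Bool → D →* L × K := fun b =>
    bif b then (MonoidHom.inl L K).comp α else (MonoidHom.inr L K).comp β
  have hφ : ∀ b, Function.Injective (φ b) := by
    rintro (_ | _)
    · exact fun x y h => hβ (congrArg Prod.snd h)
    · exact fun x y h => hα (congrArg Prod.fst h)
  refine ⟨PushoutI φ, inferInstance, (PushoutI.of true).comp (MonoidHom.inl L K),
    (PushoutI.of false).comp (MonoidHom.inr L K), ?_, fun d => ?_⟩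
  · exact (PushoutI.of_injective hφ true).comp (Prod.mk_left_injective 1)
  · exact (PushoutI.of_apply_eq_base φ true d).trans (PushoutI.of_apply_eq_base φ false d).symm

/-- If two embeddings of `P` into `L` generate a free product of two copies of `P`, then they are
conjugate by an element of order dividing `k` in a group containing `L`. -/
theorem exists_conjugator_of_pow_eq_one {P L : Type u} [Group P] [Group L]
    (f : Bool → P →* L) (hf : Function.Injective (CoprodI.lift f)) {k : ℕ} (hk : 2 ≤ k) :
    ∃ (X : Type u) (_ : Group X) (i : L →* X) (s : X),
      Function.Injective i ∧ s ^ k = 1 ∧ ∀ p, s * i (f false p) * s⁻¹ = i (f true p) := by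
  let Q : Type u := P × Multiplicative (ZMod k)
  let z : Q := (1, Multiplicative.ofAdd 1)
  have hz : z ≠ 1 := by
    intro h
    have : Fact (1 < k) := ⟨hk⟩
    exact one_ne_zero (α := ZMod k) (congrArg Prod.snd h)
  have hzk : z ^ k = 1 := by
    refine Prod.ext (one_pow k) ?_
    change Multiplicative.ofAdd (1 : ZMod k) ^ k = 1
    rw [← ofAdd_nsmul]
    simp
  let K : Type u := CoprodI fun _ : Bool => Q
  let s : K := CoprodI.of (M := fun _ : Bool => Q) (i := true) z
  let a : P →* K :=
    (CoprodI.of (M := fun _ : Bool => Q) (i := false)).comp (MonoidHom.inl P _)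
  let β : Bool → P →* K := fun b =>
    bif b then (MulAut.conj s).toMonoidHom.comp a else a
  have hβ : Function.Injective (CoprodI.lift β) := by
    refine lift_injective_of_neWord (N := fun _ : Bool => Q) β id fun b p hp => ?_
    have hp' : ((p, 1) : Q) ≠ 1 := fun h => hp (congrArg Prod.fst h)
    let w : NeWord (fun _ : Bool => Q) false false := .singleton _ hp'
    have hw : w.prod = a p := NeWord.prod_singleton _ _
    cases b
    · exact ⟨false, false, w, hw, rfl, rfl⟩
    · let y : NeWord (fun _ : Bool => Q) true true := .singleton z hz
      have hy : y.prod = s := NeWord.prod_singleton _ _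
      refine ⟨true, true, .append (.append y (by decide) w) (by decide) y.inv, ?_, rfl, rfl⟩
      simp only [NeWord.append_prod, NeWord.inv_prod, hy, hw]
      rfl
  obtain ⟨X, _, i, j, hi, hij⟩ := exists_amalgam (CoprodI.lift f) (CoprodI.lift β) hf hβ
  have hij' : ∀ b p, i (f b p) = j (β b p) := fun b p => by
    simpa using hij (CoprodI.of (i := b) p)
  refine ⟨X, inferInstance, i, j s, hi, ?_, fun p => ?_⟩
  · rw [← map_pow, ← map_pow, hzk, map_one, map_one]
  · rw [hij', hij', ← map_inv, ← map_mul, ← map_mul]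
    rfl

theorem exists_shift_of_not_mem_doubleCoset {G : Type u} [Group G] {m : ℕ}
    (u : CoprodI fun _ : Fin (m + 1) => G)
    (hu : ∀ p q, u ≠ reindex G Fin.castSucc p * reindex G Fin.succ q) {k : ℕ} (hk : 2 ≤ k) :
    ∃ (X : Type u) (_ : Group X) (i : (CoprodI fun _ : Fin (m + 1) => G) →* X) (t : X),
      Function.Injective i ∧ (t * i u) ^ k = 1 ∧
        ∀ p, t * i (reindex G Fin.castSucc p) * t⁻¹ = i (reindex G Fin.succ p) := by
  obtain ⟨p, q, v, rfl⟩ := exists_doubleCoset_neWord u hu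
  let f : Bool → (CoprodI fun _ : Fin m => G) →* CoprodI fun _ : Fin (m + 1) => G := fun b =>
    bif b then (MulAut.conj (v.prod * reindex G Fin.succ q)).toMonoidHom.comp (reindex G Fin.succ)
    else (MulAut.conj (reindex G Fin.castSucc p)⁻¹).toMonoidHom.comp (reindex G Fin.castSucc)
  have hf : Function.Injective (CoprodI.lift f) := by
    refine lift_injective_of_neWord f (fun a => decide (a = Fin.last m)) fun b x hx => ?_
    cases b
    · obtain ⟨i, j, w, hw⟩ := exists_neWord_of_ne_one (x := p⁻¹ * x * p)
        (fun h => hx (by simpa using (conj_eq_one_iff (a := p⁻¹) (b := x)).1 (by simpa using h)))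
      obtain ⟨w', hw'⟩ := exists_neWord_reindex (Fin.castSucc_injective m) w
      refine ⟨_, _, w', ?_, by simp [(Fin.castSucc_lt_last i).ne],
        by simp [(Fin.castSucc_lt_last j).ne]⟩
      simp [hw', hw, f, mul_assoc]
    · obtain ⟨i, j, w, hw⟩ := exists_neWord_of_ne_one (x := q * x * q⁻¹)
        (fun h => hx (conj_eq_one_iff.1 h))
      obtain ⟨w', hw'⟩ := exists_neWord_reindex (Fin.succ_injective m) w
      refine ⟨_, _, .append (.append v (Fin.succ_ne_zero i).symm w') (Fin.succ_ne_zero j) v.inv,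
        ?_, by simp, by simp⟩
      simp [hw', hw, f, mul_assoc]
  obtain ⟨X, _, i, s, hi, hs, hconj⟩ := exists_conjugator_of_pow_eq_one f hf hk
  let y : X := i (v.prod * reindex G Fin.succ q)
  let x : X := i (reindex G Fin.castSucc p)
  refine ⟨X, inferInstance, i, y⁻¹ * s * x⁻¹, hi, ?_, fun r => ?_⟩
  · have : y⁻¹ * s * x⁻¹ * i (reindex G Fin.castSucc p * v.prod * reindex G Fin.succ q) =
        y⁻¹ * s * y⁻¹⁻¹ := by
      simp [x, y, mul_assoc]
    rw [this, conj_pow, hs]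
    simp
  · have h1 : i (f false r) = x⁻¹ * i (reindex G Fin.castSucc r) * x := by simp [f, x]
    have h2 : i (f true r) = y * i (reindex G Fin.succ r) * y⁻¹ := by
      simp [f, y, mul_assoc]
    have h := hconj r
    rw [h1, h2] at h
    calc _ = y⁻¹ * (s * (x⁻¹ * i (reindex G Fin.castSucc r) * x) * s⁻¹) * y := by group
      _ = _ := by rw [h]; group

section Equations

variable {G : Type u} [Group G]

/-- The equation `w(t) ^ k = 1` has a solution in an overgroup of `G`. -/
def PowSolvable (k : ℕ) (w : FP G) : Prop :=
  ∃ (H : Type u) (_ : Group H) (f : G →* H) (h : H), Function.Injective f ∧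
    (Monoid.Coprod.lift f (FreeGroup.lift fun _ => h)) (w ^ k) = 1

theorem PowSolvable.of_conj {k : ℕ} {w : FP G} (c : FP G)
    (h : PowSolvable k (c * w * c⁻¹)) : PowSolvable k w := by
  obtain ⟨H, _, f, h, hf, hw⟩ := h
  refine ⟨H, inferInstance, f, h, hf, ?_⟩
  rw [conj_pow, map_mul, map_mul, map_inv] at hw
  exact conj_eq_one_iff.1 hw

/-- The homomorphism sending the `i`-th copy of `G` to its conjugate by `t ^ i`. -/
def levels (G : Type u) [Group G] (m : ℕ) : (CoprodI fun _ : Fin m => G) →* FP G :=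
  CoprodI.lift fun i => (MulAut.conj (tgen G ^ (i : ℕ))).toMonoidHom.comp (emb G)

theorem levels_of {m : ℕ} (i : Fin m) (g : G) :
    levels G m (CoprodI.of (M := fun _ : Fin m => G) (i := i) g) =
      tgen G ^ (i : ℕ) * emb G g * (tgen G ^ (i : ℕ))⁻¹ :=
  CoprodI.lift_of (M := fun _ : Fin m => G) _ g

theorem levels_castSucc {m : ℕ} (p : CoprodI fun _ : Fin m => G) :
    levels G (m + 1) (reindex G Fin.castSucc p) = levels G m p := by
  refine DFunLike.congr_fun
    (f := (levels G (m + 1)).comp (reindex G Fin.castSucc)) (g := levels G m) ?_ p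
  ext i g
  simp [levels_of]

theorem levels_succ {m : ℕ} (p : CoprodI fun _ : Fin m => G) :
    levels G (m + 1) (reindex G Fin.succ p) = tgen G * levels G m p * (tgen G)⁻¹ := by
  refine DFunLike.congr_fun (f := (levels G (m + 1)).comp (reindex G Fin.succ))
    (g := (MulAut.conj (tgen G)).toMonoidHom.comp (levels G m)) ?_ p
  ext i g
  simp [levels_of, pow_succ', mul_assoc]

theorem powSolvable_of_not_mem_doubleCoset {m : ℕ} (u : CoprodI fun _ : Fin (m + 1) => G)
    (hu : ∀ p q, u ≠ reindex G Fin.castSucc p * reindex G Fin.succ q) {k : ℕ} (hk : 2 ≤ k) :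
    PowSolvable k (tgen G * levels G (m + 1) u) := by
  obtain ⟨X, _, i, t, hi, htu, ht⟩ := exists_shift_of_not_mem_doubleCoset u hu hk
  let f : G →* X := i.comp (CoprodI.of (M := fun _ : Fin (m + 1) => G) (i := 0))
  let F : FP G →* X := Monoid.Coprod.lift f (FreeGroup.lift fun _ => t)
  have hFt : F (tgen G) = t := by simp [F, tgen]
  have hFg : ∀ g, F (emb G g) = f g := fun g => by simp [F, emb]
  have hF : F.comp (levels G (m + 1)) = i := by
    ext j g
    simp only [MonoidHom.comp_apply, levels_of, map_mul, map_inv, map_pow, hFt, hFg]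
    induction j using Fin.induction with
    | zero => simp [f]
    | succ j ih =>
      have := ht (CoprodI.of (i := j) g)
      rw [reindex_of, reindex_of] at this
      rw [← this, ← ih]
      simp [pow_succ', mul_assoc]
  refine ⟨X, inferInstance, f, t, hi.comp (CoprodI.of_injective _), ?_⟩
  change F _ = 1
  rw [map_pow, map_mul, hFt, ← MonoidHom.comp_apply F, hF, htu]

theorem powSolvable_tgen_mul_levels {k : ℕ} (hk : 2 ≤ k) (m : ℕ)
    (u : CoprodI fun _ : Fin (m + 1) => G) : PowSolvable k (tgen G * levels G (m + 1) u) := by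
  induction m with
  | zero =>
    by_cases hu : ∀ p q, u ≠ reindex G Fin.castSucc p * reindex G Fin.succ q
    · exact powSolvable_of_not_mem_doubleCoset u hu hk
    · push Not at hu
      obtain ⟨p, q, rfl⟩ := hu
      have h0 : ∀ x : CoprodI fun _ : Fin 0 => G, x = 1 := fun x => by
        by_contra hx
        obtain ⟨i, -⟩ := exists_neWord_of_ne_one hx
        exact i.elim0
      refine ⟨G, inferInstance, MonoidHom.id G, 1, Function.injective_id, ?_⟩
      rw [h0 p, h0 q]
      simp [tgen]
  | succ m ih =>
    by_cases hu : ∀ p q, u ≠ reindex G Fin.castSucc p * reindex G Fin.succ q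
    · exact powSolvable_of_not_mem_doubleCoset u hu hk
    · push Not at hu
      obtain ⟨p, q, rfl⟩ := hu
      refine .of_conj ((levels G (m + 1) p)⁻¹ * (tgen G)⁻¹) ?_
      convert ih (q * p) using 1
      rw [map_mul, levels_castSucc, levels_succ, map_mul]
      group

/-- The subgroup generated by the conjugates of `G` by `t ^ i` with `a ≤ i ≤ b`. -/
def band (G : Type u) [Group G] (a b : ℤ) : Subgroup (FP G) :=
  Subgroup.closure {y | ∃ i : ℤ, a ≤ i ∧ i ≤ b ∧ ∃ g, y = tgen G ^ i * emb G g * (tgen G ^ i)⁻¹}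

theorem band_mono {a b a' b' : ℤ} (ha : a' ≤ a) (hb : b ≤ b') : band G a b ≤ band G a' b' :=
  Subgroup.closure_mono fun _ ⟨i, h, h', hg⟩ => ⟨i, ha.trans h, h'.trans hb, hg⟩

theorem conj_mem_band {a b : ℤ} (n : ℤ) {y : FP G} (hy : y ∈ band G a b) :
    tgen G ^ n * y * (tgen G ^ n)⁻¹ ∈ band G (n + a) (n + b) := by
  have : band G a b ≤
      (band G (n + a) (n + b)).comap (MulAut.conj (tgen G ^ n)).toMonoidHom := by
    refine (Subgroup.closure_le _).2 ?_
    rintro _ ⟨i, hai, hib, g, rfl⟩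
    refine Subgroup.subset_closure ⟨n + i, by lia, by lia, g, ?_⟩
    rw [MulEquiv.coe_toMonoidHom, MulAut.conj_apply, zpow_add]
    group
  exact this hy

theorem band_le_range_levels {m : ℕ} : band G 0 m ≤ (levels G (m + 1)).range := by
  refine (Subgroup.closure_le _).2 ?_
  rintro _ ⟨i, hi, him, g, rfl⟩
  obtain ⟨n, rfl⟩ := Int.eq_ofNat_of_zero_le hi
  exact ⟨CoprodI.of (i := (⟨n, by lia⟩ : Fin (m + 1))) g, by simp [levels_of]⟩

theorem exists_zpow_mul_mem_band (x : FP G) :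
    ∃ (n a b : ℤ), ∃ y ∈ band G a b, x = tgen G ^ n * y := by
  induction x using Monoid.Coprod.induction_on with
  | inl g => exact ⟨0, 0, 0, emb G g, Subgroup.subset_closure ⟨0, by simp, by simp, g, by simp⟩,
      by simp [emb]⟩
  | inr z =>
    refine ⟨FreeGroup.freeGroupUnitEquivInt z, 0, 0, 1, one_mem _, ?_⟩
    conv_lhs => rw [← FreeGroup.freeGroupUnitEquivInt.symm_apply_apply z]
    rw [tgen, ← map_zpow, mul_one]
    rfl
  | mul x x' h h' =>
    obtain ⟨n, a, b, y, hy, rfl⟩ := h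
    obtain ⟨n', a', b', y', hy', rfl⟩ := h'
    refine ⟨n + n', min (-n' + a) a', max (-n' + b) b', _,
      mul_mem (band_mono (min_le_left _ _) (le_max_left _ _) (conj_mem_band (-n') hy))
        (band_mono (min_le_right _ _) (le_max_right _ _) hy'), ?_⟩
    simp [zpow_add, mul_assoc]

theorem expSum_eq_one_of_mem_band {a b : ℤ} {y : FP G} (hy : y ∈ band G a b) :
    expSum G y = 1 := by
  have : band G a b ≤ (expSum G).ker := by
    refine (Subgroup.closure_le _).2 ?_
    rintro _ ⟨i, -, -, g, rfl⟩
    simp [MonoidHom.mem_ker, expSum, emb]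
  exact this hy

theorem exists_conj_eq_tgen_mul_levels {w : FP G} (hw : Unimodular w) :
    ∃ (c : FP G) (m : ℕ) (u : CoprodI fun _ : Fin (m + 1) => G),
      c * w * c⁻¹ = tgen G * levels G (m + 1) u := by
  obtain ⟨n, a, b, y, hy, rfl⟩ := exists_zpow_mul_mem_band w
  have hn : n = 1 := by
    have h := hw
    rw [Unimodular, map_mul, expSum_eq_one_of_mem_band hy, mul_one, map_zpow] at h
    have ht : expSum G (tgen G) = Multiplicative.ofAdd 1 := by simp [expSum, tgen]
    rw [ht, ← ofAdd_zsmul] at h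
    simpa using Multiplicative.ofAdd.injective h
  subst hn
  obtain ⟨u, hu⟩ := band_le_range_levels (m := (b - a).toNat)
    (band_mono (by lia) (by lia) (conj_mem_band (-a) hy))
  refine ⟨tgen G ^ (-a), _, u, ?_⟩
  rw [hu]
  group

end Equations

end UnimodularPower

/-- Any equation `(w(t))^k = 1` with unimodular `w` and `k ≥ 2` is solvable over any group. -/
theorem equation_solvable {G : Type u} [Group G] (w : FP G) (hw : Unimodular w)
    (k : ℕ) (hk : 2 ≤ k) :
    ∃ (H : Type u) (_ : Group H) (f : G →* H) (h : H),
      Function.Injective f ∧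
        (Monoid.Coprod.lift f (FreeGroup.lift fun _ => h)) (w ^ k) = 1 := by
  obtain ⟨c, m, u, h⟩ := UnimodularPower.exists_conj_eq_tgen_mul_levels hw
  exact UnimodularPower.PowSolvable.of_conj c
    (h ▸ UnimodularPower.powSolvable_tgen_mul_levels hk m u)
end
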